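/- arXiv:2004.07824 — 3 statements merged into one kernel-verified Lean document; each statement's English description precedes it below -/
import Mathlib

section
/- First commutation relations: A_1 is multiplication by p_1/(1+b), i.e. A_1 f = (p_1·f)/(1+b) for all f ∈ 𝒫, and for every integer j ≥ 1 and every f ∈ 𝒫 one has A_{j+1} f = D_α(A_j f) − A_j(D_α f); in other words, A_{j+1} = [D_α, A_j] as operators on 𝒫. -/
open MvPolynomial

noncomputable section

/-- The base field `K = ℚ(b)`: rational functions in an indeterminate `b` over `ℚ`. -/
abbrev K : Type := RatFunc ℚ

/-- The indeterminate `b ∈ K`. -/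
def bb : K := RatFunc.X

/-- `α = 1 + b`. -/
def alpha : K := 1 + bb

/-- Variables: `p i` (used for `i ≥ 1`) and `y i` (used for `i ≥ 0`). -/
inductive Var : Type
  | p : ℕ → Var
  | y : ℕ → Var
  deriving DecidableEq

/-- The ambient polynomial ring `R = K[p₁, p₂, …, y₀, y₁, …]`. -/
abbrev R : Type := MvPolynomial Var K

/-- The variable `p_i`. -/
def P (i : ℕ) : R := X (Var.p i)

/-- The variable `y_i`. -/
def Y (i : ℕ) : R := X (Var.y i)

/-- Partial derivative `∂/∂p_i`. -/
def dP (i : ℕ) (f : R) : R := pderiv (Var.p i) f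

/-- Partial derivative `∂/∂y_i`. -/
def dY (i : ℕ) (f : R) : R := pderiv (Var.y i) f

/-- `𝒫`: the subalgebra of polynomials in the `p`-variables only. -/
def Psub : Subalgebra K R := MvPolynomial.supported K (Set.range Var.p)

/-- `𝒫_Y`: the `K`-linear span of the monomials `p_λ` and `y_i·p_λ`. -/
def PY : Submodule K R :=
  Submodule.span K ((Psub : Set R) ∪ {g : R | ∃ i : ℕ, ∃ f ∈ (Psub : Set R), g = Y i * f})

/-- The Laplace–Beltrami operator
`D_α = (1/2)(α Σ_{i,j≥1} i j p_{i+j} ∂²/∂p_i∂p_j + Σ_{i,j≥1} (i+j) p_i p_j ∂/∂p_{i+j}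
        + b Σ_{i≥1} i(i−1) p_i ∂/∂p_i)`. -/
def Dalpha (f : R) : R :=
  (2 : K)⁻¹ •
    (alpha • (∑ᶠ (i : ℕ) (j : ℕ), (((i + 1) * (j + 1) : ℕ) : K) •
        (P (i + 1 + (j + 1)) * dP (i + 1) (dP (j + 1) f)))
      + (∑ᶠ (i : ℕ) (j : ℕ), (((i + 1) + (j + 1) : ℕ) : K) •
        (P (i + 1) * P (j + 1) * dP (i + 1 + (j + 1)) f))
      + bb • (∑ᶠ (i : ℕ), (((i + 1) * i : ℕ) : K) • (P (i + 1) * dP (i + 1) f)))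

/-- `Λ_Y = α Σ_{i,j≥1} i y_{i+j−1} ∂²/∂p_i∂y_{j−1} + Σ_{i,j≥1} y_{i−1} p_j ∂/∂y_{i+j−1}
      + b Σ_{i≥1} i y_i ∂/∂y_i`. -/
def LamY (f : R) : R :=
  alpha • (∑ᶠ (i : ℕ) (j : ℕ), ((i + 1 : ℕ) : K) • (Y (i + j + 1) * dP (i + 1) (dY j f)))
    + (∑ᶠ (i : ℕ) (j : ℕ), Y i * P (j + 1) * dY (i + j + 1) f)
    + bb • (∑ᶠ (i : ℕ), ((i + 1 : ℕ) : K) • (Y (i + 1) * dY (i + 1) f))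

/-- `Y_+ = Σ_{i≥0} y_{i+1} ∂/∂y_i`. -/
def Yplus (f : R) : R := ∑ᶠ (i : ℕ), Y (i + 1) * dY i f

/-- `Θ_Y = Σ_{i≥1} p_i ∂/∂y_i`. -/
def ThetaY (f : R) : R := ∑ᶠ (i : ℕ), P (i + 1) * dY (i + 1) f

/-- `A j` is the operator `A_{j+1}` of the paper:
`A_{j+1} f = (1/(1+b))·Θ_Y(Y_+(Λ_Y^j(y₀·f)))`. -/
def A (j : ℕ) (f : R) : R := (1 + bb)⁻¹ • ThetaY (Yplus (LamY^[j] (Y 0 * f)))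

theorem derivation_mul (D : Derivation K R R) (f g : R) : D (f * g) = f * D g + D f * g := by
  rw [D.leibniz, smul_eq_mul, smul_eq_mul, mul_comm g]

theorem dP_mul (i : ℕ) (f g : R) : dP i (f * g) = f * dP i g + dP i f * g :=
  derivation_mul _ f g

theorem dY_mul (i : ℕ) (f g : R) : dY i (f * g) = f * dY i g + dY i f * g :=
  derivation_mul _ f g

@[simp] theorem dP_P (i k : ℕ) : dP i (P k) = if i = k then 1 else 0 := by
  by_cases h : i = k
  · subst h; simp [dP, P]
  · simp [dP, P, h, pderiv_X, Ne.symm h]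

@[simp] theorem dP_Y (i k : ℕ) : dP i (Y k) = 0 := by
  simp [dP, Y, pderiv_X]

@[simp] theorem dY_P (i k : ℕ) : dY i (P k) = 0 := by
  simp [dY, P, pderiv_X]

@[simp] theorem dY_Y (i k : ℕ) : dY i (Y k) = if i = k then 1 else 0 := by
  by_cases h : i = k
  · subst h; simp [dY, Y]
  · simp [dY, Y, h, pderiv_X, Ne.symm h]

theorem pderiv_pderiv_comm (u v : Var) (f : R) :
    pderiv u (pderiv v f) = pderiv v (pderiv u f) := by
  have h : ⁅pderiv (R := K) u, pderiv v⁆ = 0 := MvPolynomial.derivation_ext fun w => by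
    rw [Derivation.commutator_apply, pderiv_X, pderiv_X]
    by_cases h1 : v = w <;> by_cases h2 : u = w <;> simp [h1, h2]
  rw [← sub_eq_zero, ← Derivation.commutator_apply, h, Derivation.zero_apply]

theorem dP_dP_comm (i j : ℕ) (f : R) : dP i (dP j f) = dP j (dP i f) :=
  pderiv_pderiv_comm _ _ _

theorem dP_dY_comm (i j : ℕ) (f : R) : dP i (dY j f) = dY j (dP i f) :=
  pderiv_pderiv_comm _ _ _

theorem exists_forall_ge_dP_dY_eq_zero (f : R) :
    ∃ N, ∀ i, N ≤ i → dP i f = 0 ∧ dY i f = 0 := by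
  induction f using MvPolynomial.induction_on with
  | C a => exact ⟨0, fun i _ => by simp [dP, dY]⟩
  | add f g hf hg =>
    obtain ⟨N, hN⟩ := hf
    obtain ⟨M, hM⟩ := hg
    refine ⟨max N M, fun i hi => ?_⟩
    obtain ⟨h1, h2⟩ := hN i (by omega)
    obtain ⟨h3, h4⟩ := hM i (by omega)
    simp only [dP, dY] at h1 h2 h3 h4
    simp [dP, dY, h1, h2, h3, h4]
  | mul_X f v hf =>
    obtain ⟨N, hN⟩ := hf
    rcases v with k | k
    · refine ⟨max N (k + 1), fun i hi => ?_⟩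
      obtain ⟨h1, h2⟩ := hN i (by omega)
      have hk : i ≠ k := by omega
      change dP i (f * P k) = 0 ∧ dY i (f * P k) = 0
      simp [dP_mul, dY_mul, h1, h2, hk]
    · refine ⟨max N (k + 1), fun i hi => ?_⟩
      obtain ⟨h1, h2⟩ := hN i (by omega)
      have hk : i ≠ k := by omega
      change dP i (f * Y k) = 0 ∧ dY i (f * Y k) = 0
      simp [dP_mul, dY_mul, h1, h2, hk]

theorem finite_support_of_forall_ge {F : ℕ → R} {N : ℕ} (h : ∀ i, N ≤ i → F i = 0) :
    F.support.Finite :=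
  (Set.finite_lt_nat N).subset fun i hi => by
    by_contra hc
    exact hi (h i (not_lt.mp hc))

theorem finsum_eq_sum_range_of_forall_ge {F : ℕ → R} {N : ℕ} (h : ∀ i, N ≤ i → F i = 0) :
    ∑ᶠ i, F i = ∑ i ∈ Finset.range N, F i :=
  finsum_eq_sum_of_support_subset _ fun i hi => by
    by_contra hc
    exact hi (h i (by simpa using hc))

theorem finsum_succ {F : ℕ → R} (h : F 0 = 0) : ∑ᶠ i, F (i + 1) = ∑ᶠ i, F i := by
  rw [← finsum_mem_range (f := F) (add_left_injective 1)]
  rw [finsum_mem_inter_support_eq' F _ Set.univ, finsum_mem_univ]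
  rintro (_ | i) hi
  · exact absurd h hi
  · simp

theorem finsum_finsum_eq_finsum_diag {G : ℕ → ℕ → R} {N : ℕ}
    (h : ∀ i j, N ≤ i + j → G i j = 0) :
    ∑ᶠ (i : ℕ) (j : ℕ), G i j = ∑ᶠ m : ℕ, ∑ l ∈ Finset.range (m + 1), G l (m - l) := by
  rw [finsum_eq_sum_range_of_forall_ge (F := fun m => ∑ l ∈ Finset.range (m + 1), G l (m - l))
      (N := N), Finset.sum_range_diag_flip, finsum_eq_sum_range_of_forall_ge (N := N)]
  · refine Finset.sum_congr rfl fun i hi => ?_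
    rw [Finset.mem_range] at hi
    exact finsum_eq_sum_range_of_forall_ge fun j hj => h i j (by omega)
  · exact fun i hi => finsum_eq_zero_of_forall_eq_zero fun j => h i j (by omega)
  · refine fun m hm => Finset.sum_eq_zero fun l hl => h _ _ ?_
    rw [Finset.mem_range] at hl
    omega

theorem finite_support_varDerivation (a c : ℕ → R) (f : R) :
    (fun i => a i * dP i f + c i * dY i f).support.Finite := by
  obtain ⟨N, hN⟩ := exists_forall_ge_dP_dY_eq_zero f
  exact finite_support_of_forall_ge (N := N) fun i hi => by simp [hN i hi]

/-- The derivation `Σ a_i ∂/∂p_i + Σ c_i ∂/∂y_i`. -/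
def varDerivation (a c : ℕ → R) : Derivation K R R where
  toFun f := ∑ᶠ i, (a i * dP i f + c i * dY i f)
  map_add' f g := by
    rw [← finsum_add_distrib (finite_support_varDerivation a c f)
      (finite_support_varDerivation a c g)]
    exact finsum_congr fun i => by simp only [dP, dY, map_add]; ring
  map_smul' r f := by
    rw [RingHom.id_apply, smul_finsum]
    exact finsum_congr fun i => by simp [dP, dY]
  map_one_eq_zero' := by
    simp [dP, dY]
  leibniz' f g := by
    change ∑ᶠ i, (a i * dP i (f * g) + c i * dY i (f * g)) =
      f * ∑ᶠ i, (a i * dP i g + c i * dY i g) + g * ∑ᶠ i, (a i * dP i f + c i * dY i f)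
    rw [mul_finsum, mul_finsum, ← finsum_add_distrib]
    · exact finsum_congr fun i => by rw [dP_mul, dY_mul]; ring
    · exact (finite_support_varDerivation a c g).subset
        (Function.support_subset_iff'.mpr fun i hi => by simp_all)
    · exact (finite_support_varDerivation a c f).subset
        (Function.support_subset_iff'.mpr fun i hi => by simp_all)

theorem varDerivation_apply (a c : ℕ → R) (f : R) :
    varDerivation a c f = ∑ᶠ i, (a i * dP i f + c i * dY i f) := rfl

@[simp] theorem varDerivation_P (a c : ℕ → R) (k : ℕ) : varDerivation a c (P k) = a k := by
  rw [varDerivation_apply, finsum_eq_single _ k fun i hi => by simp [hi]]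
  simp

@[simp] theorem varDerivation_Y (a c : ℕ → R) (k : ℕ) : varDerivation a c (Y k) = c k := by
  rw [varDerivation_apply, finsum_eq_single _ k fun i hi => by simp [hi]]
  simp

/-- The operator `f ↦ Σ V_i (∂f/∂p_i)`. -/
def sumCompDP (V : ℕ → Derivation K R R) : R →ₗ[K] R where
  toFun f := ∑ᶠ i, V i (dP i f)
  map_add' f g := by
    rw [← finsum_add_distrib]
    · exact finsum_congr fun i => by simp [dP]
    · obtain ⟨N, hN⟩ := exists_forall_ge_dP_dY_eq_zero f
      exact finite_support_of_forall_ge (N := N) fun i hi => by simp [hN i hi]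
    · obtain ⟨N, hN⟩ := exists_forall_ge_dP_dY_eq_zero g
      exact finite_support_of_forall_ge (N := N) fun i hi => by simp [hN i hi]
  map_smul' r f := by
    rw [RingHom.id_apply, smul_finsum]
    exact finsum_congr fun i => by simp [dP]

theorem sumCompDP_apply (V : ℕ → Derivation K R R) (f : R) :
    sumCompDP V f = ∑ᶠ i, V i (dP i f) := rfl

@[simp] theorem sumCompDP_one (V : ℕ → Derivation K R R) : sumCompDP V 1 = 0 := by
  simp [sumCompDP_apply, dP]

@[simp] theorem sumCompDP_Y (V : ℕ → Derivation K R R) (m : ℕ) : sumCompDP V (Y m) = 0 := by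
  simp [sumCompDP_apply]

theorem sumCompDP_P_mul (V : ℕ → Derivation K R R) (k : ℕ) (f : R) :
    sumCompDP V (P k * f) =
      P k * sumCompDP V f + V k f + varDerivation (fun i => V i (P k)) 0 f := by
  obtain ⟨N, hN⟩ := exists_forall_ge_dP_dY_eq_zero f
  have h1 : V k f = ∑ᶠ i, if i = k then V i f else 0 := by
    rw [finsum_eq_single _ k fun i hi => by simp [hi]]
    simp
  rw [h1, sumCompDP_apply, sumCompDP_apply, varDerivation_apply, mul_finsum,
    ← finsum_add_distrib, ← finsum_add_distrib]
  · refine finsum_congr fun i => ?_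
    rw [dP_mul, map_add, derivation_mul, dP_P]
    by_cases h : i = k <;> (simp [h]; try ring)
  · exact finite_support_of_forall_ge (N := max N (k + 1)) fun i hi => by
      have h2 : i ≠ k := by omega
      simp [hN i (by omega), h2]
  · exact finite_support_of_forall_ge (N := N) fun i hi => by simp [hN i hi]
  · exact finite_support_of_forall_ge (N := N) fun i hi => by simp [hN i hi]
  · exact finite_support_of_forall_ge (N := k + 1) fun i hi => by
      have h2 : i ≠ k := by omega
      simp [h2]

local notation "CK" => (C : K →+* R)

theorem derivation_ext_P_Y {D E : Derivation K R R} (hP : ∀ k, D (P k) = E (P k))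
    (hY : ∀ k, D (Y k) = E (Y k)) : D = E :=
  MvPolynomial.derivation_ext fun v => match v with
    | Var.p k => hP k
    | Var.y k => hY k

theorem varDerivation_dP (a : ℕ → R) (f : R) : varDerivation a 0 f = ∑ᶠ i, a i * dP i f := by
  simp [varDerivation_apply]

theorem varDerivation_dY (c : ℕ → R) (f : R) : varDerivation 0 c f = ∑ᶠ i, c i * dY i f := by
  simp [varDerivation_apply]

/-- The derivation `p_j ↦ j p_{k+j}`, `y_j ↦ 0`. -/
def shiftP (k : ℕ) : Derivation K R R := varDerivation (fun j => (j : K) • P (k + j)) 0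

/-- The derivation `p_j ↦ 0`, `y_j ↦ w_j y_{j+k}`. -/
def shiftY (w : ℕ → K) (k : ℕ) : Derivation K R R := varDerivation 0 fun j => w j • Y (j + k)

/-- The image of `p_k` under twice the Laplace–Beltrami operator. -/
def quad (k : ℕ) : R :=
  (k : K) • ∑ l ∈ Finset.range (k - 1), P (l + 1) * P (k - 1 - l) +
    (bb * ((k * (k - 1) : ℕ) : K)) • P k

/-- The Laplace–Beltrami operator as a linear map. -/
def laplaceBeltrami : R →ₗ[K] R :=
  (2 : K)⁻¹ • (alpha • sumCompDP (fun i => (i : K) • shiftP i) + (varDerivation quad 0).toLinearMap)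

/-- A weighted version of `Λ_Y`:
`α Σ i u_j y_{i+j} ∂²/∂p_i∂y_j + Σ v_i y_i p_j ∂/∂y_{i+j} + b Σ w_i y_i ∂/∂y_i`. -/
def weightedLam (u v w : ℕ → K) : R →ₗ[K] R :=
  alpha • sumCompDP (fun i => (i : K) • shiftY u i) +
    (varDerivation 0 fun m => ∑ l ∈ Finset.range m, v l • (Y l * P (m - l)) +
      (bb * w m) • Y m).toLinearMap

theorem finsum_diag_dP (f : R) :
    ∑ᶠ (i : ℕ) (j : ℕ), (((i + 1) + (j + 1) : ℕ) : K) •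
      (P (i + 1) * P (j + 1) * dP (i + 1 + (j + 1)) f) =
    varDerivation
      (fun k => (k : K) • ∑ l ∈ Finset.range (k - 1), P (l + 1) * P (k - 1 - l)) 0 f := by
  obtain ⟨N, hN⟩ := exists_forall_ge_dP_dY_eq_zero f
  rw [varDerivation_dP]
  refine Eq.trans ?_ ((finsum_succ (by simp)).trans (finsum_succ (by simp)))
  rw [finsum_finsum_eq_finsum_diag (N := N) fun i j hij => by
      rw [(hN (i + 1 + (j + 1)) (by omega)).1, mul_zero, smul_zero]]
  refine finsum_congr fun m => ?_
  simp only [Nat.add_sub_cancel, Finset.smul_sum, Finset.sum_mul]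
  refine Finset.sum_congr rfl fun l hl => ?_
  have hl : l ≤ m := by simpa [Nat.lt_succ_iff] using hl
  rw [show l + 1 + (m - l + 1) = m + 1 + 1 by omega, show m - l + 1 = m + 1 - l by omega,
    smul_mul_assoc]

theorem finsum_diag_dY (f : R) :
    ∑ᶠ (i : ℕ) (j : ℕ), Y i * P (j + 1) * dY (i + j + 1) f =
    varDerivation 0 (fun m => ∑ l ∈ Finset.range m, Y l * P (m - l)) f := by
  obtain ⟨N, hN⟩ := exists_forall_ge_dP_dY_eq_zero f
  rw [varDerivation_dY]
  refine Eq.trans ?_ (finsum_succ (by simp))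
  rw [finsum_finsum_eq_finsum_diag (N := N) fun i j hij => by
      rw [(hN (i + j + 1) (by omega)).2, mul_zero]]
  refine finsum_congr fun m => ?_
  rw [Finset.sum_mul]
  refine Finset.sum_congr rfl fun l hl => ?_
  have hl : l ≤ m := by simpa [Nat.lt_succ_iff] using hl
  rw [show l + (m - l) + 1 = m + 1 by omega, show m - l + 1 = m + 1 - l by omega]

theorem Dalpha_eq (f : R) : Dalpha f = laplaceBeltrami f := by
  have h1 : ∑ᶠ (i : ℕ) (j : ℕ), (((i + 1) * (j + 1) : ℕ) : K) •
        (P (i + 1 + (j + 1)) * dP (i + 1) (dP (j + 1) f)) =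
      sumCompDP (fun i => (i : K) • shiftP i) f := by
    rw [sumCompDP_apply]
    refine Eq.trans ?_ (finsum_succ (by simp))
    refine finsum_congr fun i => ?_
    rw [Derivation.smul_apply, shiftP, varDerivation_dP, smul_finsum]
    refine Eq.trans ?_ (finsum_succ (by simp))
    refine finsum_congr fun j => ?_
    rw [dP_dP_comm, smul_mul_assoc, smul_smul, Nat.cast_mul]
  have h3 : ∑ᶠ (i : ℕ), (((i + 1) * i : ℕ) : K) • (P (i + 1) * dP (i + 1) f) =
      varDerivation (fun i => ((i * (i - 1) : ℕ) : K) • P i) 0 f := by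
    rw [varDerivation_dP]
    refine Eq.trans ?_ (finsum_succ (by simp))
    exact finsum_congr fun i => by rw [smul_mul_assoc, Nat.add_sub_cancel]
  have h : varDerivation quad 0 =
      varDerivation
        (fun k => (k : K) • ∑ l ∈ Finset.range (k - 1), P (l + 1) * P (k - 1 - l)) 0 +
      bb • varDerivation (fun i => ((i * (i - 1) : ℕ) : K) • P i) 0 :=
    derivation_ext_P_Y (fun k => by simp [quad, smul_smul]) (fun k => by simp)
  rw [Dalpha, finsum_diag_dP, h1, h3, laplaceBeltrami, h]
  simp [add_assoc]

theorem LamY_eq (f : R) : LamY f = weightedLam 1 1 (fun m => (m : K)) f := by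
  have h1 : ∑ᶠ (i : ℕ) (j : ℕ), ((i + 1 : ℕ) : K) • (Y (i + j + 1) * dP (i + 1) (dY j f)) =
      sumCompDP (fun i => (i : K) • shiftY 1 i) f := by
    rw [sumCompDP_apply]
    refine Eq.trans ?_ (finsum_succ (by simp))
    refine finsum_congr fun i => ?_
    rw [Derivation.smul_apply, shiftY, varDerivation_dY, smul_finsum]
    refine finsum_congr fun j => ?_
    rw [dP_dY_comm, Pi.one_apply, one_smul, show i + j + 1 = j + (i + 1) by omega]
  have h3 : ∑ᶠ (i : ℕ), ((i + 1 : ℕ) : K) • (Y (i + 1) * dY (i + 1) f) =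
      varDerivation 0 (fun i => (i : K) • Y i) f := by
    rw [varDerivation_dY]
    refine Eq.trans ?_ (finsum_succ (by simp))
    exact finsum_congr fun i => by rw [smul_mul_assoc]
  have h : (varDerivation 0 fun m => ∑ l ∈ Finset.range m, (1 : ℕ → K) l • (Y l * P (m - l)) +
      (bb * (m : K)) • Y m) =
      varDerivation 0 (fun m => ∑ l ∈ Finset.range m, Y l * P (m - l)) +
      bb • varDerivation 0 (fun i => (i : K) • Y i) :=
    derivation_ext_P_Y (fun k => by simp) (fun k => by simp [smul_smul])
  rw [LamY, finsum_diag_dY, h1, h3, weightedLam, h]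
  simp [add_assoc]

theorem Yplus_eq (f : R) : Yplus f = shiftY 1 1 f := by
  simp [Yplus, shiftY, varDerivation_dY]

theorem ThetaY_eq (f : R) : ThetaY f = varDerivation 0 (fun i => if i = 0 then 0 else P i) f := by
  rw [ThetaY, varDerivation_dY]
  refine Eq.trans ?_ (finsum_succ (by simp))
  simp

@[simp] theorem shiftP_P (k l : ℕ) : shiftP k (P l) = (l : K) • P (k + l) := by simp [shiftP]

@[simp] theorem shiftP_Y (k m : ℕ) : shiftP k (Y m) = 0 := by simp [shiftP]

@[simp] theorem shiftY_P (w : ℕ → K) (k l : ℕ) : shiftY w k (P l) = 0 := by simp [shiftY]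

@[simp] theorem shiftY_Y (w : ℕ → K) (k m : ℕ) : shiftY w k (Y m) = w m • Y (m + k) := by
  simp [shiftY]

theorem C_two_inv_mul_two : (CK 2⁻¹ : R) * 2 = 1 := by
  rw [show (2 : R) = C (2 : K) from (map_ofNat C 2).symm, ← C_mul,
    inv_mul_cancel₀ two_ne_zero, C_1]

theorem weightedLam_P_mul (u v w : ℕ → K) (k : ℕ) (f : R) :
    weightedLam u v w (P k * f) =
      P k * weightedLam u v w f + (alpha * (k : K)) • shiftY u k f := by
  have h : varDerivation (fun i => ((i : K) • shiftY u i) (P k)) 0 = 0 :=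
    derivation_ext_P_Y (by simp) (by simp)
  simp only [weightedLam, LinearMap.add_apply, LinearMap.smul_apply, sumCompDP_P_mul, h,
    Derivation.coeFn_coe, derivation_mul, varDerivation_P, Derivation.zero_apply, Pi.zero_apply]
  simp only [Derivation.smul_apply, smul_add, mul_smul_comm, mul_smul, mul_add]
  abel_nf
  simp

theorem weightedLam_Y (u v w : ℕ → K) (m : ℕ) :
    weightedLam u v w (Y m) =
      ∑ l ∈ Finset.range m, v l • (Y l * P (m - l)) + (bb * w m) • Y m := by
  simp [weightedLam]

theorem laplaceBeltrami_P_mul (k : ℕ) (f : R) :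
    laplaceBeltrami (P k * f) = P k * laplaceBeltrami f + (alpha * (k : K)) • shiftP k f +
      (2⁻¹ : K) • (quad k * f) := by
  have h : varDerivation (fun i => ((i : K) • shiftP i) (P k)) 0 = (k : K) • shiftP k :=
    derivation_ext_P_Y
      (fun l => by simp [smul_smul, mul_comm, add_comm]) (fun l => by simp)
  simp only [laplaceBeltrami, LinearMap.add_apply, LinearMap.smul_apply, sumCompDP_P_mul, h,
    Derivation.coeFn_coe, derivation_mul, varDerivation_P]
  simp only [Derivation.smul_apply, smul_eq_C_mul, C_mul]
  linear_combination (CK alpha * C (k : K) * shiftP k f) * C_two_inv_mul_two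

theorem laplaceBeltrami_one : laplaceBeltrami 1 = 0 := by simp [laplaceBeltrami]

theorem laplaceBeltrami_Y (m : ℕ) : laplaceBeltrami (Y m) = 0 := by simp [laplaceBeltrami]

/-- `D_α` extended to the span of the `y_i p_λ` so that it commutes with `Λ_Y` there. -/
def twistedLB : R →ₗ[K] R :=
  laplaceBeltrami + weightedLam (fun m => (m : K)) (fun m => (m : K))
    (fun m => 2⁻¹ * ((m : K) * ((m : K) - 1)))

/-- The commutator of `twistedLB` with multiplication by `p_k`. -/
def commP (k : ℕ) : R →ₗ[K] R :=
  (alpha * (k : K)) • (shiftP k + shiftY (fun m => (m : K)) k).toLinearMap +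
    LinearMap.mulLeft K ((2⁻¹ : K) • quad k)

theorem commP_apply (k : ℕ) (f : R) :
    commP k f = (alpha * (k : K)) • (shiftP k f + shiftY (fun m => (m : K)) k f) +
      (2⁻¹ : K) • quad k * f := by
  simp [commP]

theorem twistedLB_P_mul (k : ℕ) (f : R) :
    twistedLB (P k * f) = P k * twistedLB f + commP k f := by
  simp only [twistedLB, LinearMap.add_apply, weightedLam_P_mul, laplaceBeltrami_P_mul,
    commP_apply, smul_eq_C_mul, C_mul]
  ring

theorem twistedLB_Y (m : ℕ) :
    twistedLB (Y m) = ∑ l ∈ Finset.range m, (l : K) • (Y l * P (m - l)) +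
      (bb * (2⁻¹ * ((m : K) * ((m : K) - 1)))) • Y m := by
  simp [twistedLB, laplaceBeltrami_Y, weightedLam_Y]

theorem commP_P_mul (k l : ℕ) (f : R) :
    commP k (P l * f) = P l * commP k f + (alpha * ((k : K) * (l : K))) • (P (k + l) * f) := by
  simp only [commP_apply, derivation_mul, shiftP_P, shiftY_P, smul_eq_C_mul, C_mul]
  ring

theorem shiftY_P_mul (w : ℕ → K) (k l : ℕ) (f : R) :
    shiftY w k (P l * f) = P l * shiftY w k f := by
  simp

/-- The span of the `y_i p_λ`, as an inductive predicate. -/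
inductive IsYLinear : R → Prop
  | y (m : ℕ) : IsYLinear (Y m)
  | add {f g : R} : IsYLinear f → IsYLinear g → IsYLinear (f + g)
  | smul (c : K) {f : R} : IsYLinear f → IsYLinear (c • f)
  | mulP (k : ℕ) {f : R} : IsYLinear f → IsYLinear (P k * f)

namespace IsYLinear

theorem zero : IsYLinear 0 := by
  simpa using (IsYLinear.y 0).smul 0

theorem sum {ι : Type*} (s : Finset ι) {F : ι → R} (h : ∀ i ∈ s, IsYLinear (F i)) :
    IsYLinear (∑ i ∈ s, F i) :=
  Finset.sum_induction F IsYLinear (fun _ _ => .add) zero h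

theorem shiftY {f : R} (hf : IsYLinear f) (w : ℕ → K) (k : ℕ) : IsYLinear (shiftY w k f) := by
  induction hf with
  | y m => rw [shiftY_Y]; exact (y _).smul _
  | add _ _ hf hg => rw [map_add]; exact hf.add hg
  | smul c _ hf => rw [Derivation.map_smul]; exact hf.smul c
  | mulP k _ hf => rw [shiftY_P_mul]; exact hf.mulP k

theorem weightedLam {f : R} (hf : IsYLinear f) (u v w : ℕ → K) :
    IsYLinear (weightedLam u v w f) := by
  induction hf with
  | y m =>
    rw [weightedLam_Y]
    refine (sum _ fun l _ => ?_).add ((y m).smul _)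
    rw [mul_comm]
    exact ((y l).mulP _).smul _
  | add _ _ hf hg => rw [map_add]; exact hf.add hg
  | smul c _ hf => rw [map_smul]; exact hf.smul c
  | mulP k h hf => rw [weightedLam_P_mul]; exact (hf.mulP k).add ((h.shiftY _ _).smul _)

end IsYLinear

/-- The operator `Λ_Y` as a linear map. -/
abbrev lam : R →ₗ[K] R := weightedLam 1 1 fun m => (m : K)

theorem commP_shiftY (k l : ℕ) {f : R} (hf : IsYLinear f) :
    commP k (shiftY 1 l f) =
      shiftY 1 l (commP k f) + (alpha * ((k : K) * (l : K))) • shiftY 1 (k + l) f := by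
  induction hf with
  | y m =>
    have hq : shiftY 1 l (quad k) = 0 := by simp [quad]
    simp only [commP_apply, shiftP_Y, shiftY_Y, derivation_mul, map_add, Derivation.map_smul, hq,
      zero_add, Pi.one_apply, one_smul, smul_zero, zero_mul, add_zero]
    simp only [smul_eq_C_mul, C_mul, map_natCast]
    rw [show m + l + k = m + k + l by omega, show m + (k + l) = m + k + l by omega]
    push_cast
    ring
  | add _ _ hf hg => simp only [map_add, hf, hg, smul_add]; abel
  | smul c _ hf => simp only [map_smul, Derivation.map_smul, hf, smul_add, smul_comm c]
  | mulP j _ hf =>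
    simp only [shiftY_P_mul, commP_P_mul, hf, map_add, Derivation.map_smul]
    simp only [smul_eq_C_mul, C_mul]
    ring

theorem lam_Y (m : ℕ) :
    lam (Y m) = ∑ l ∈ Finset.range m, P (m - l) * Y l + CK bb * m * Y m := by
  simp [weightedLam_Y, smul_eq_C_mul, mul_comm (Y _)]

theorem twistedLB_Y_eq (m : ℕ) :
    twistedLB (Y m) = ∑ l ∈ Finset.range m, (l : R) * (P (m - l) * Y l) +
      CK bb * (CK 2⁻¹ * (m * (m - 1))) * Y m := by
  simp only [twistedLB_Y, smul_eq_C_mul, C_mul, C_sub, map_natCast, C_1, mul_comm (Y _)]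

theorem quad_succ (k : ℕ) :
    quad (k + 1) = (k + 1 : R) * ∑ l ∈ Finset.range k, P (l + 1) * P (k - l) +
      CK bb * ((k + 1) * k) * P (k + 1) := by
  simp [quad, smul_eq_C_mul]

theorem sum_range_reflect_mul (k : ℕ) (F : ℕ → R) :
    ∑ l ∈ Finset.range k, ((k : R) - l) * F (k - l) =
      ∑ l ∈ Finset.range k, (l + 1 : R) * F (l + 1) := by
  rw [← Finset.sum_range_reflect]
  refine Finset.sum_congr rfl fun l hl => ?_
  rw [Finset.mem_range] at hl
  obtain ⟨d, rfl⟩ := Nat.exists_eq_add_of_lt hl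
  rw [show l + d + 1 - (l + d + 1 - 1 - l) = l + 1 by omega,
    show l + d + 1 - 1 - l = d by omega]
  push_cast
  ring

theorem sum_succ_mul_P_mul_P (k : ℕ) :
    2 * ∑ l ∈ Finset.range k, (l + 1 : R) * (P (l + 1) * P (k - l)) =
      (k + 1 : R) * ∑ l ∈ Finset.range k, P (l + 1) * P (k - l) := by
  have h : ∑ l ∈ Finset.range k, (l + 1 : R) * (P (l + 1) * P (k - l)) =
      ∑ l ∈ Finset.range k, ((k : R) - l) * (P (l + 1) * P (k - l)) := by
    rw [← Finset.sum_range_reflect]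
    refine Finset.sum_congr rfl fun l hl => ?_
    rw [Finset.mem_range] at hl
    obtain ⟨d, rfl⟩ := Nat.exists_eq_add_of_lt hl
    rw [show l + d + 1 - 1 - l = d by omega, show l + d + 1 - d = l + 1 by omega,
      show l + d + 1 - l = d + 1 by omega]
    push_cast
    ring
  rw [two_mul]
  nth_rewrite 2 [h]
  rw [← Finset.sum_add_distrib, Finset.mul_sum]
  exact Finset.sum_congr rfl fun l _ => by ring

theorem commP_Y (k m : ℕ) :
    commP k (Y m) = CK alpha * k * m * Y (m + k) + CK 2⁻¹ * quad k * Y m := by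
  simp [commP_apply, smul_eq_C_mul, mul_assoc]

theorem lam_C_mul (c : K) (f : R) : lam (C c * f) = C c * lam f := by
  rw [← smul_eq_C_mul, map_smul, smul_eq_C_mul]

theorem lam_natCast_mul (n : ℕ) (f : R) : lam (n * f) = n * lam f := by
  rw [← map_natCast C, lam_C_mul]

theorem lam_P_mul (k : ℕ) (f : R) :
    lam (P k * f) = P k * lam f + CK alpha * k * shiftY 1 k f := by
  simp [weightedLam_P_mul, smul_eq_C_mul]

theorem lam_P_mul_Y (k m : ℕ) :
    lam (P k * Y m) = P k * lam (Y m) + CK alpha * k * Y (m + k) := by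
  simp [lam_P_mul]

theorem commP_natCast_mul (k n : ℕ) (f : R) : commP k (n * f) = n * commP k f := by
  rw [← map_natCast C, ← smul_eq_C_mul, map_smul, smul_eq_C_mul]

theorem commP_C_mul (k : ℕ) (c : K) (f : R) : commP k (C c * f) = C c * commP k f := by
  rw [← smul_eq_C_mul, map_smul, smul_eq_C_mul]

theorem twistedLB_natCast_mul (n : ℕ) (f : R) : twistedLB (n * f) = n * twistedLB f := by
  rw [← map_natCast C, ← smul_eq_C_mul, map_smul, smul_eq_C_mul]

theorem twistedLB_C_mul (c : K) (f : R) : twistedLB (C c * f) = C c * twistedLB f := by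
  rw [← smul_eq_C_mul, map_smul, smul_eq_C_mul]

theorem lam_quad_succ_mul_Y (k m : ℕ) :
    lam (quad (k + 1) * Y m) = quad (k + 1) * lam (Y m) +
      2 * CK alpha * (k + 1) *
        ∑ l ∈ Finset.range k, (l + 1 : R) * (P (k - l) * Y (m + (l + 1))) +
      CK bb * CK alpha * ((k + 1) * k * (k + 1)) * Y (m + (k + 1)) := by
  have h1 : ∀ l ∈ Finset.range k, lam (P (l + 1) * (P (k - l) * Y m)) =
      (P (l + 1) * P (k - l)) * lam (Y m) +
        CK alpha * (((k : R) - l) * (P (k + 1 - (k - l)) * Y (m + (k - l)))) +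
        CK alpha * ((l + 1 : R) * (P (k - l) * Y (m + (l + 1)))) := fun l hl => by
    rw [Finset.mem_range] at hl
    rw [lam_P_mul, lam_P_mul_Y, shiftY_P_mul, shiftY_Y, Pi.one_apply, one_smul,
      Nat.cast_sub hl.le, show k + 1 - (k - l) = l + 1 by omega]
    push_cast
    ring
  have h2 : ∑ l ∈ Finset.range k, ((k : R) - l) * (P (k + 1 - (k - l)) * Y (m + (k - l))) =
      ∑ l ∈ Finset.range k, (l + 1 : R) * (P (k - l) * Y (m + (l + 1))) := by
    rw [sum_range_reflect_mul k fun j => P (k + 1 - j) * Y (m + j)]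
    exact Finset.sum_congr rfl fun l _ => by rw [Nat.add_sub_add_right]
  have h3 : quad (k + 1) * Y m =
      ((k + 1 : ℕ) : R) * ∑ l ∈ Finset.range k, P (l + 1) * (P (k - l) * Y m) +
        CK bb * (((k + 1) * k : ℕ) * (P (k + 1) * Y m)) := by
    simp only [quad_succ, ← mul_assoc _ _ (Y m), ← Finset.sum_mul]
    push_cast
    ring
  rw [h3, map_add, lam_natCast_mul, map_sum, Finset.sum_congr rfl h1, Finset.sum_add_distrib,
    Finset.sum_add_distrib, ← Finset.sum_mul, ← Finset.mul_sum, ← Finset.mul_sum, h2,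
    lam_C_mul, lam_natCast_mul, lam_P_mul_Y, quad_succ]
  push_cast
  ring

theorem sum_range_add_succ_split (k m : ℕ) (F : ℕ → R) :
    ∑ l ∈ Finset.range (m + (k + 1)), F l =
      ∑ l ∈ Finset.range m, F l + ∑ l ∈ Finset.range k, F (m + (l + 1)) + F m := by
  rw [Finset.sum_range_add, Finset.sum_range_succ' _ k, add_zero, add_assoc]

theorem commP_lam_Y (k m : ℕ) :
    commP k (lam (Y m)) - lam (commP k (Y m)) +
      (alpha * (k : K)) • (twistedLB (shiftY 1 k (Y m)) - shiftY 1 k (twistedLB (Y m))) = 0 := by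
  rcases k with _ | k
  · simp [commP_apply, quad]
  have h1 : commP (k + 1) (lam (Y m)) =
      CK alpha * (k + 1) * ∑ l ∈ Finset.range m, (l : R) * (P (m - l) * Y (l + (k + 1))) +
      CK 2⁻¹ * quad (k + 1) * ∑ l ∈ Finset.range m, P (m - l) * Y l +
      CK alpha * (k + 1) * m * ∑ l ∈ Finset.range m, P (m + (k + 1) - l) * Y l -
      CK alpha * (k + 1) * ∑ l ∈ Finset.range m, (l : R) * (P (m + (k + 1) - l) * Y l) +
      CK bb * m * (CK alpha * (k + 1) * m * Y (m + (k + 1)) +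
        CK 2⁻¹ * quad (k + 1) * Y m) := by
    have h : ∀ l ∈ Finset.range m, commP (k + 1) (P (m - l) * Y l) =
        CK alpha * (k + 1) * ((l : R) * (P (m - l) * Y (l + (k + 1)))) +
        CK 2⁻¹ * quad (k + 1) * (P (m - l) * Y l) +
        CK alpha * (k + 1) * m * (P (m + (k + 1) - l) * Y l) -
        CK alpha * (k + 1) * ((l : R) * (P (m + (k + 1) - l) * Y l)) := fun l hl => by
      rw [Finset.mem_range] at hl
      rw [commP_P_mul, commP_Y, show k + 1 + (m - l) = m + (k + 1) - l by omega]
      simp only [smul_eq_C_mul, C_mul, C_sub, map_natCast, Nat.cast_sub hl.le]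
      push_cast
      ring
    rw [lam_Y, map_add, map_sum, Finset.sum_congr rfl h, mul_assoc (CK bb), commP_C_mul,
      commP_natCast_mul, commP_Y]
    simp only [Finset.sum_add_distrib, Finset.sum_sub_distrib, ← Finset.mul_sum]
    push_cast
    ring
  have h2 : lam (commP (k + 1) (Y m)) =
      CK alpha * (k + 1) * m * lam (Y (m + (k + 1))) +
      CK 2⁻¹ * lam (quad (k + 1) * Y m) := by
    rw [commP_Y, map_add, mul_assoc, mul_assoc, mul_assoc, lam_C_mul, lam_natCast_mul,
      lam_natCast_mul, lam_C_mul]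
    push_cast
    ring
  have h3 : shiftY 1 (k + 1) (twistedLB (Y m)) =
      ∑ l ∈ Finset.range m, (l : R) * (P (m - l) * Y (l + (k + 1))) +
        CK bb * (CK 2⁻¹ * (m * (m - 1))) * Y (m + (k + 1)) := by
    simp only [twistedLB_Y, map_add, map_sum, Derivation.map_smul, mul_comm (Y _), shiftY_P_mul,
      shiftY_Y, Pi.one_apply, one_smul]
    simp only [smul_eq_C_mul, C_mul, C_sub, map_natCast, C_1]
  have h4 : ∑ l ∈ Finset.range k,
      ((m + (l + 1) : ℕ) : R) * (P (m + (k + 1) - (m + (l + 1))) * Y (m + (l + 1))) =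
      m * ∑ l ∈ Finset.range k, P (m + (k + 1) - (m + (l + 1))) * Y (m + (l + 1)) +
      ∑ l ∈ Finset.range k, (l + 1 : R) * (P (k - l) * Y (m + (l + 1))) := by
    rw [Finset.mul_sum, ← Finset.sum_add_distrib]
    refine Finset.sum_congr rfl fun l _ => ?_
    rw [show m + (k + 1) - (m + (l + 1)) = k - l by omega]
    push_cast
    ring
  rw [h1, h2, h3, shiftY_Y, Pi.one_apply, one_smul, lam_quad_succ_mul_Y, twistedLB_Y_eq, lam_Y,
    lam_Y, sum_range_add_succ_split, sum_range_add_succ_split, h4]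
  simp only [smul_eq_C_mul, C_mul, map_natCast]
  push_cast
  linear_combination (CK alpha * (k + 1) ^ 2 * m * CK bb * Y (m + (k + 1)) - CK alpha * (k + 1) *
        ∑ l ∈ Finset.range k, (l + 1 : R) * (P (k - l) * Y (m + (l + 1)))) * C_two_inv_mul_two

theorem commP_lam (k : ℕ) {f : R} (hf : IsYLinear f) :
    commP k (lam f) - lam (commP k f) +
      (alpha * (k : K)) • (twistedLB (shiftY 1 k f) - shiftY 1 k (twistedLB f)) = 0 := by
  induction hf with
  | y m => exact commP_lam_Y k m
  | @add f g _ _ hf hg =>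
    simp only [map_add, smul_eq_C_mul] at *
    linear_combination hf + hg
  | @smul c f _ hf =>
    simp only [map_smul, Derivation.map_smul] at *
    simp only [smul_eq_C_mul] at *
    linear_combination C c * hf
  | @mulP l f h hf =>
    have h1 := commP_shiftY k l h
    have h2 := commP_shiftY l k h
    rw [add_comm l k] at h2
    simp only [shiftY_P_mul, commP_P_mul, twistedLB_P_mul, weightedLam_P_mul, map_add,
      map_smul] at *
    simp only [smul_eq_C_mul, C_mul, map_natCast, Nat.cast_add, C_add] at *
    linear_combination P l * hf + CK alpha * l * h1 + CK alpha * k * h2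

theorem sum_P_mul_sum_eq (m : ℕ) :
    ∑ n ∈ Finset.range m, P (m - n) * ∑ l ∈ Finset.range n, ((n : R) - l) * (P (n - l) * Y l) =
      ∑ n ∈ Finset.range m, CK 2⁻¹ * (((m : R) - n) *
        ∑ l ∈ Finset.range (m - n - 1), P (l + 1) * P (m - n - 1 - l)) * Y n := by
  have h : ∀ x y, x ∈ Finset.range m ∧ y ∈ Finset.range x ↔
      x ∈ Finset.Ico (y + 1) m ∧ y ∈ Finset.range m := by
    intro x y
    simp only [Finset.mem_range, Finset.mem_Ico]
    omega
  simp only [Finset.mul_sum]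
  rw [Finset.sum_comm' h]
  refine Finset.sum_congr rfl fun n hn => ?_
  rw [Finset.mem_range] at hn
  obtain ⟨d, rfl⟩ := Nat.exists_eq_add_of_lt hn
  have h1 := sum_succ_mul_P_mul_P d
  rw [Finset.sum_Ico_eq_sum_range, show n + d + 1 - (n + 1) = d by omega,
    show n + d + 1 - n - 1 = d by omega, ← Finset.mul_sum, ← Finset.mul_sum]
  have h2 : ∑ l ∈ Finset.range d, P (n + d + 1 - (n + 1 + l)) *
      ((((n + 1 + l : ℕ) : R) - n) * (P (n + 1 + l - n) * Y n)) =
      (∑ l ∈ Finset.range d, (l + 1 : R) * (P (l + 1) * P (d - l))) * Y n := by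
    rw [Finset.sum_mul]
    refine Finset.sum_congr rfl fun l _ => ?_
    rw [show n + d + 1 - (n + 1 + l) = d - l by omega, show n + 1 + l - n = l + 1 by omega]
    push_cast
    ring
  rw [h2]
  push_cast
  linear_combination CK 2⁻¹ * Y n * h1 -
    (∑ l ∈ Finset.range d, (l + 1 : R) * (P (l + 1) * P (d - l))) * Y n * C_two_inv_mul_two

theorem twistedLB_lam_Y (m : ℕ) : twistedLB (lam (Y m)) = lam (twistedLB (Y m)) := by
  have h1 : ∀ n ∈ Finset.range m,
      twistedLB (P (m - n) * Y n) - (n : R) * lam (P (m - n) * Y n) =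
      - (P (m - n) * ∑ l ∈ Finset.range n, ((n : R) - l) * (P (n - l) * Y l)) +
      CK 2⁻¹ * (((m : R) - n) *
        ∑ l ∈ Finset.range (m - n - 1), P (l + 1) * P (m - n - 1 - l)) * Y n +
      CK bb * m * (CK 2⁻¹ * (m - 1) * (P (m - n) * Y n) - (n : R) * (P (m - n) * Y n)) := by
    intro n hn
    rw [Finset.mem_range] at hn
    obtain ⟨d, rfl⟩ := Nat.exists_eq_add_of_lt hn
    have h : ∑ l ∈ Finset.range n, ((n : R) - l) * (P (n - l) * Y l) =
        n * ∑ l ∈ Finset.range n, P (n - l) * Y l -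
          ∑ l ∈ Finset.range n, (l : R) * (P (n - l) * Y l) := by
      rw [Finset.mul_sum, ← Finset.sum_sub_distrib]
      exact Finset.sum_congr rfl fun l _ => by ring
    rw [h, twistedLB_P_mul, lam_P_mul_Y, commP_Y, lam_Y, twistedLB_Y_eq,
      show n + d + 1 - n = d + 1 by omega, quad_succ]
    simp only [Nat.add_sub_cancel]
    push_cast
    linear_combination -(CK bb * n * (d + 1) * P (d + 1) * Y n) * C_two_inv_mul_two
  have h2 : twistedLB (lam (Y m)) - lam (twistedLB (Y m)) =
      ∑ n ∈ Finset.range m, (twistedLB (P (m - n) * Y n) - (n : R) * lam (P (m - n) * Y n)) +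
      CK bb * m * (twistedLB (Y m) - CK 2⁻¹ * (m - 1) * lam (Y m)) := by
    have h3 : lam (CK bb * (CK 2⁻¹ * (m * (m - 1))) * Y m) =
        CK bb * (CK 2⁻¹ * (m * (m - 1))) * lam (Y m) := by
      have h4 : (CK bb * (CK 2⁻¹ * (m * (m - 1))) : R) =
          C (bb * (2⁻¹ * ((m : K) * ((m : K) - 1)))) := by
        simp only [C_mul, C_sub, map_natCast, C_1]
      rw [h4, lam_C_mul]
    rw [lam_Y, twistedLB_Y_eq m, map_add, map_add, map_sum, map_sum, mul_assoc (CK bb),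
      twistedLB_C_mul, twistedLB_natCast_mul, h3, Finset.sum_sub_distrib, twistedLB_Y_eq m, lam_Y]
    simp only [lam_natCast_mul]
    ring
  rw [← sub_eq_zero, h2, Finset.sum_congr rfl h1, Finset.sum_add_distrib, Finset.sum_add_distrib,
    Finset.sum_neg_distrib, sum_P_mul_sum_eq, ← Finset.mul_sum, Finset.sum_sub_distrib,
    ← Finset.mul_sum, twistedLB_Y_eq, lam_Y]
  ring

theorem twistedLB_lam {f : R} (hf : IsYLinear f) : twistedLB (lam f) = lam (twistedLB f) := by
  induction hf with
  | y m => exact twistedLB_lam_Y m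
  | add _ _ hf hg => simp only [map_add, hf, hg]
  | smul c _ hf => simp only [map_smul, hf]
  | mulP k h hf =>
    have h1 := commP_lam k h
    simp only [twistedLB_P_mul, weightedLam_P_mul, map_add, map_smul, hf, smul_sub] at *
    linear_combination h1

/-- The operator `Θ_Y Y_+`. -/
def thetaShift (f : R) : R :=
  varDerivation 0 (fun i => if i = 0 then 0 else P i) (shiftY 1 1 f)

theorem thetaShift_add (f g : R) : thetaShift (f + g) = thetaShift f + thetaShift g := by
  simp [thetaShift]

theorem thetaShift_smul (c : K) (f : R) : thetaShift (c • f) = c • thetaShift f := by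
  simp [thetaShift]

theorem thetaShift_P_mul (k : ℕ) (f : R) : thetaShift (P k * f) = P k * thetaShift f := by
  simp [thetaShift]

theorem thetaShift_Y (m : ℕ) : thetaShift (Y m) = P (m + 1) := by
  simp [thetaShift]

theorem shiftP_thetaShift (k : ℕ) {f : R} (hf : IsYLinear f) :
    shiftP k (thetaShift f) =
      thetaShift (shiftP k f + shiftY (fun m => (m : K)) k f + shiftY 1 k f) := by
  induction hf with
  | y m =>
    rw [thetaShift_Y, shiftP_P, shiftP_Y, shiftY_Y, shiftY_Y, zero_add, ← add_smul,
      thetaShift_smul, thetaShift_Y, show k + (m + 1) = m + k + 1 by omega]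
    simp
  | add _ _ hf hg =>
    simp only [map_add, thetaShift_add] at *
    rw [hf, hg]
    ring
  | smul c _ hf =>
    simp only [Derivation.map_smul, thetaShift_add, thetaShift_smul] at *
    rw [hf, smul_add, smul_add]
  | mulP l _ hf =>
    simp only [derivation_mul, thetaShift_P_mul, thetaShift_add, shiftP_P, shiftY_P, zero_mul,
      add_zero, smul_mul_assoc, thetaShift_smul] at *
    rw [hf]
    ring

theorem laplaceBeltrami_thetaShift_Y (m : ℕ) :
    laplaceBeltrami (thetaShift (Y m)) = thetaShift (twistedLB (Y m) + lam (Y m)) := by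
  have h1 : laplaceBeltrami (P (m + 1)) = (2⁻¹ : K) • quad (m + 1) := by
    have h := laplaceBeltrami_P_mul (m + 1) 1
    simpa [laplaceBeltrami_one] using h
  have h2 : twistedLB (Y m) + lam (Y m) =
      ∑ l ∈ Finset.range m, ((l : K) + 1) • (P (m - l) * Y l) +
        (bb * (2⁻¹ * (((m : K) + 1) * m))) • Y m := by
    simp only [twistedLB_Y_eq, lam_Y, smul_eq_C_mul, C_add, C_mul, map_natCast, C_1,
      add_mul, Finset.sum_add_distrib, one_mul]
    linear_combination -(CK bb * m * Y m) * C_two_inv_mul_two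
  have h4 : ∀ (s : Finset ℕ) (F : ℕ → R), thetaShift (∑ l ∈ s, F l) = ∑ l ∈ s, thetaShift (F l) :=
    fun s F => by simp only [thetaShift, map_sum]
  have h5 := sum_succ_mul_P_mul_P m
  rw [h2, thetaShift_Y, h1, thetaShift_add, h4, quad_succ]
  simp only [thetaShift_smul, thetaShift_P_mul, thetaShift_Y]
  simp only [smul_eq_C_mul, C_mul, C_add, map_natCast, C_1, mul_comm (P (m - _))]
  linear_combination (∑ l ∈ Finset.range m, (l + 1 : R) * (P (l + 1) * P (m - l))) *
    C_two_inv_mul_two - CK 2⁻¹ * h5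

theorem laplaceBeltrami_thetaShift {f : R} (hf : IsYLinear f) :
    laplaceBeltrami (thetaShift f) = thetaShift (twistedLB f + lam f) := by
  induction hf with
  | y m => exact laplaceBeltrami_thetaShift_Y m
  | add _ _ hf hg =>
    simp only [map_add, thetaShift_add] at *
    rw [hf, hg]
    ring
  | smul c _ hf =>
    simp only [map_smul, thetaShift_add, thetaShift_smul] at *
    rw [hf, smul_add]
  | @mulP k f h hf =>
    have h1 := shiftP_thetaShift k h
    have h2 : thetaShift (quad k * f) = quad k * thetaShift f := by
      simp [thetaShift, quad]
    simp only [thetaShift_P_mul, laplaceBeltrami_P_mul, twistedLB_P_mul, weightedLam_P_mul,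
      commP_apply, thetaShift_add, thetaShift_smul, smul_mul_assoc, h2] at *
    rw [hf, h1]
    simp only [smul_eq_C_mul]
    ring

theorem P_mem_Psub (k : ℕ) : P k ∈ Psub :=
  X_mem_supported.mpr ⟨k, rfl⟩

theorem Psub_induction {p : (f : R) → f ∈ Psub → Prop} (one : p 1 (one_mem _))
    (smul : ∀ (c : K) (f : R) (hf : f ∈ Psub), p f hf → p (c • f) (Psub.smul_mem hf c))
    (add : ∀ (f g : R) (hf : f ∈ Psub) (hg : g ∈ Psub), p f hf → p g hg →
      p (f + g) (add_mem hf hg))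
    (mulP : ∀ (k : ℕ) (f : R) (hf : f ∈ Psub), p f hf → p (P k * f) (mul_mem (P_mem_Psub k) hf))
    {f : R} (hf : f ∈ Psub) : p f hf := by
  suffices h : ∃ h, p f h from h.2
  rw [Psub, supported_eq_range_rename] at hf
  obtain ⟨g, rfl⟩ := hf
  induction g using MvPolynomial.induction_on with
  | C a =>
    have h : ∃ h, p (a • 1) h := ⟨_, smul a 1 _ one⟩
    simpa [smul_eq_C_mul] using h
  | add g h hg hh =>
    have h : ∃ h', p (_ + _) h' := ⟨_, add _ _ _ _ hg.2 hh.2⟩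
    simpa using h
  | mul_X g v hg =>
    obtain ⟨_, k, rfl⟩ := v
    have h : ∃ h, p (P k * _) h := ⟨_, mulP k _ _ hg.2⟩
    simpa [P, mul_comm] using h

theorem varDerivation_zero_apply_of_mem_Psub (c : ℕ → R) {f : R} (hf : f ∈ Psub) :
    varDerivation 0 c f = 0 := by
  induction hf using Psub_induction with
  | one => simp
  | smul c f _ hf => rw [Derivation.map_smul, hf, smul_zero]
  | add f g _ _ hf hg => rw [map_add, hf, hg, add_zero]
  | mulP k f _ hf => simp [hf]

theorem IsYLinear.Y_mul_of_mem_Psub (m : ℕ) {f : R} (hf : f ∈ Psub) : IsYLinear (Y m * f) := by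
  induction hf using Psub_induction with
  | one => simpa using IsYLinear.y m
  | smul c f _ hf => rw [mul_smul_comm]; exact hf.smul c
  | add f g _ _ hf hg => rw [mul_add]; exact hf.add hg
  | mulP k f _ hf => rw [mul_left_comm]; exact hf.mulP k

theorem shiftY_Y_zero_mul (k : ℕ) {f : R} (hf : f ∈ Psub) :
    shiftY (fun m => (m : K)) k (Y 0 * f) = 0 := by
  have h : shiftY (fun m => (m : K)) k f = 0 := varDerivation_zero_apply_of_mem_Psub _ hf
  simp [h]

theorem twistedLB_Y_zero_mul {f : R} (hf : f ∈ Psub) :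
    twistedLB (Y 0 * f) = Y 0 * laplaceBeltrami f := by
  induction hf using Psub_induction with
  | one => simp [twistedLB_Y, laplaceBeltrami_one]
  | smul c f _ hf => simp [hf]
  | add f g _ _ hf hg => simp [mul_add, hf, hg]
  | mulP k f h hf =>
    rw [mul_left_comm, twistedLB_P_mul, commP_apply, shiftY_Y_zero_mul k h, hf,
      laplaceBeltrami_P_mul, derivation_mul, shiftP_Y]
    simp only [smul_eq_C_mul]
    ring

theorem thetaShift_Y_zero_mul {f : R} (hf : f ∈ Psub) : thetaShift (Y 0 * f) = P 1 * f := by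
  induction hf using Psub_induction with
  | one => simp [thetaShift_Y]
  | smul c f _ hf => rw [mul_smul_comm, thetaShift_smul, hf, mul_smul_comm]
  | add f g _ _ hf hg => rw [mul_add, thetaShift_add, hf, hg, mul_add]
  | mulP k f _ hf => rw [mul_left_comm, thetaShift_P_mul, hf, mul_left_comm]

theorem A_eq (j : ℕ) (f : R) : A j f = (1 + bb)⁻¹ • thetaShift (lam^[j] (Y 0 * f)) := by
  rw [A, ThetaY_eq, Yplus_eq, thetaShift, show LamY = lam from funext LamY_eq]

theorem isYLinear_iterate_lam (n : ℕ) {f : R} (hf : IsYLinear f) : IsYLinear (lam^[n] f) := by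
  induction n with
  | zero => exact hf
  | succ n ih => rw [Function.iterate_succ_apply']; exact ih.weightedLam _ _ _

theorem twistedLB_iterate_lam (n : ℕ) {f : R} (hf : IsYLinear f) :
    twistedLB (lam^[n] f) = lam^[n] (twistedLB f) := by
  induction n with
  | zero => rfl
  | succ n ih =>
    rw [Function.iterate_succ_apply', twistedLB_lam (isYLinear_iterate_lam n hf), ih,
      Function.iterate_succ_apply']

/-- **First commutation relations** (Theorem 4.4 of Chapuy–Dołęga):
`A₁` is multiplication by `p₁/(1+b)` on `𝒫`, and for every `j ≥ 1`,
`A_{j+1} = [D_α, A_j]` as operators on `𝒫`.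
(Here `A j` denotes the operator `A_{j+1}` of the paper.) -/
theorem first_commutation_relations :
    (∀ f ∈ Psub, A 0 f = (1 + bb)⁻¹ • (P 1 * f)) ∧
    (∀ j : ℕ, 1 ≤ j → ∀ f ∈ Psub,
      A j f = Dalpha (A (j - 1) f) - A (j - 1) (Dalpha f)) := by
  refine ⟨fun f hf => by rw [A_eq, Function.iterate_zero_apply, thetaShift_Y_zero_mul hf], ?_⟩
  intro j hj f hf
  obtain ⟨n, rfl⟩ := Nat.exists_eq_add_of_le' hj
  have h := IsYLinear.Y_mul_of_mem_Psub 0 hf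
  rw [Nat.add_sub_cancel, A_eq, A_eq, A_eq, Dalpha_eq, Dalpha_eq, map_smul,
    laplaceBeltrami_thetaShift (isYLinear_iterate_lam n h), twistedLB_iterate_lam n h,
    twistedLB_Y_zero_mul hf, ← Function.iterate_succ_apply' lam, thetaShift_add, smul_add,
    add_sub_cancel_left]
end
end

section
/- Second commutation relations: for every integer m ≥ 1 and every f ∈ 𝒫 one has B^{(k)}_{m+1} f = Ω_Y^{(k)}(B^{(k)}_m f) − B^{(k)}_m(Ω_Y^{(k)} f); in other words, B^{(k)}_{m+1} = [Ω_Y^{(k)}, B^{(k)}_m] as operators on 𝒫. -/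
open MvPolynomial

noncomputable section

/-- `Λ_Y + u`: the operator `f ↦ Λ_Y f + u·f`. -/
def Lu (u : K) (f : R) : R := LamY f + u • f

/-- The composition `(Λ_Y+u₁) ∘ ⋯ ∘ (Λ_Y+u_k)`. -/
def prodLu (k : ℕ) (u : Fin k → K) : R → R :=
  (List.ofFn (fun i => Lu (u i))).foldr (fun g h => g ∘ h) (id : R → R)

/-- The operator `Y_+ ∘ (Λ_Y+u₁) ∘ ⋯ ∘ (Λ_Y+u_k)`. -/
def Wop (k : ℕ) (u : Fin k → K) (f : R) : R := Yplus (prodLu k u f)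

/-- The operator `B_m^{(k)}` (for `m ≥ 1`):
`B_m^{(k)} f = ((m−1)!/(1+b))·Θ_Y((Y_+ ∘ (Λ_Y+u₁) ∘ ⋯ ∘ (Λ_Y+u_k))^m (y₀·f))`. -/
def B (k : ℕ) (u : Fin k → K) (m : ℕ) (f : R) : R :=
  (((m - 1).factorial : K) * (1 + bb)⁻¹) • ThetaY ((Wop k u)^[m] (Y 0 * f))

/-- The operator `Ω_Y^{(k)} f = (1/(1+b))·Θ_Y(Y_+((Λ_Y+u₁)⋯(Λ_Y+u_k)(Λ_Y(y₀·f))))`. -/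
def Omega (k : ℕ) (u : Fin k → K) (f : R) : R :=
  (1 + bb)⁻¹ • ThetaY (Yplus (prodLu k u (LamY (Y 0 * f))))

namespace TwoPoint

/-- Variables of the two-point ring `𝒫[y, z]`. -/
inductive CVar : Type
  | p : ℕ → CVar
  | y : CVar
  | z : CVar

/-- The two-point ring `𝒫[y, z]`; one thinks of `p_i` as the power sums of variables
`x₁, x₂, x₃, …` with `y = x₁` and `z = x₂`. -/
abbrev S : Type := MvPolynomial CVar K

/-- The power sum `p_i` in `𝒫[y, z]`. -/
def p (i : ℕ) : S := X (CVar.p i)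

/-- The variable `y`. -/
def y : S := X CVar.y

/-- The variable `z`. -/
def z : S := X CVar.z

section Lift

variable {A : Type} [CommRing A] [Algebra K A]

/-- The linear map sending `p_λ y^m z^n` to `r_λ t(m, n)`. -/
def pLift (r : ℕ → A) (t : ℕ → ℕ → A) : S →ₗ[K] A :=
  (((basisMonomials Bool A).constr A fun d => t (d true) (d false)).restrictScalars K) ∘ₗ
    (aeval (R := K) (fun v : CVar => match v with
      | .p i => (C (r i) : MvPolynomial Bool A)
      | .y => X true
      | .z => X false)).toLinearMap

lemma pLift_p_mul (r : ℕ → A) (t : ℕ → ℕ → A) (k : ℕ) (G : S) :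
    pLift r t (p k * G) = r k * pLift r t G := by
  simp only [pLift, p, LinearMap.comp_apply, AlgHom.toLinearMap_apply, map_mul, aeval_X,
    LinearMap.restrictScalars_apply, ← smul_eq_C_mul, map_smul, smul_eq_mul]

lemma pLift_pow (r : ℕ → A) (t : ℕ → ℕ → A) (m n : ℕ) :
    pLift r t (y ^ m * z ^ n) = t m n := by
  have h : (X true ^ m * X false ^ n : MvPolynomial Bool A) =
      basisMonomials Bool A (Finsupp.single true m + Finsupp.single false n) := by
    rw [coe_basisMonomials, X_pow_eq_monomial, X_pow_eq_monomial, monomial_mul, one_mul]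
  simp only [pLift, y, z, LinearMap.comp_apply, AlgHom.toLinearMap_apply, map_mul, map_pow,
    aeval_X, LinearMap.restrictScalars_apply]
  rw [h, Module.Basis.constr_basis]
  simp

lemma mem_of_p_mul_of_pow (N : Submodule K S) (hp : ∀ k, ∀ G ∈ N, p k * G ∈ N)
    (h : ∀ m n, y ^ m * z ^ n ∈ N) (G : S) : G ∈ N := by
  have key : ∀ m n, G * (y ^ m * z ^ n) ∈ N := by
    induction G using MvPolynomial.induction_on with
    | C a =>
      intro m n
      rw [← smul_eq_C_mul]
      exact N.smul_mem _ (h m n)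
    | add f g hf hg =>
      intro m n
      rw [add_mul]
      exact N.add_mem (hf m n) (hg m n)
    | mul_X f v hf =>
      intro m n
      cases v with
      | p k =>
        have := hp k _ (hf m n)
        rwa [p, mul_left_comm, ← mul_assoc] at this
      | y =>
        have := hf (m + 1) n
        rwa [pow_succ', y, mul_assoc, ← mul_assoc] at this
      | z =>
        have := hf m (n + 1)
        rwa [pow_succ', mul_left_comm (y ^ m), ← mul_assoc] at this
  simpa using key 0 0

lemma linearMap_ext {r : ℕ → A} {f g : S →ₗ[K] A}
    (hf : ∀ k G, f (p k * G) = r k * f G) (hg : ∀ k G, g (p k * G) = r k * g G)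
    (h : ∀ m n, f (y ^ m * z ^ n) = g (y ^ m * z ^ n)) (G : S) : f G = g G := by
  refine mem_of_p_mul_of_pow (LinearMap.eqLocus f g) (fun k G hG => ?_) h G
  have hG' : f G = g G := hG
  change f (p k * G) = g (p k * G)
  rw [hf, hg, hG']

end Lift

/-- The swap of `y` and `z`. -/
def sw : S →ₐ[K] S := aeval fun v => match v with
  | .p i => p i
  | .y => z
  | .z => y

/-- The substitution `y ↦ z`. -/
def dl : S →ₐ[K] S := aeval fun v => match v with
  | .p i => p i
  | .y => z
  | .z => z

/-- The substitution `z ↦ 0`. -/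
def ev : S →ₐ[K] S := aeval fun v => match v with
  | .p i => p i
  | .y => y
  | .z => 0

@[simp] lemma sw_p (i : ℕ) : sw (p i) = p i := by simp only [sw, p, aeval_X]
@[simp] lemma sw_y : sw y = z := by simp only [sw, y, aeval_X]
@[simp] lemma sw_z : sw z = y := by simp only [sw, z, aeval_X]
@[simp] lemma dl_p (i : ℕ) : dl (p i) = p i := by simp only [dl, p, aeval_X]
@[simp] lemma dl_y : dl y = z := by simp only [dl, y, aeval_X]
@[simp] lemma dl_z : dl z = z := by simp only [dl, z, aeval_X]
@[simp] lemma ev_p (i : ℕ) : ev (p i) = p i := by simp only [ev, p, aeval_X]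
@[simp] lemma ev_y : ev y = y := by simp only [ev, y, aeval_X]
@[simp] lemma ev_z : ev z = 0 := by simp only [ev, z, aeval_X]

lemma algHom_ext' {A : Type} [CommRing A] [Algebra K A] {f g : S →ₐ[K] A}
    (hp : ∀ i, f (p i) = g (p i)) (hy : f y = g y) (hz : f z = g z) (G : S) : f G = g G := by
  have : f = g := by
    apply MvPolynomial.algHom_ext
    rintro (i | _ | _)
    exacts [hp i, hy, hz]
  rw [this]

@[simp] lemma sw_sw (G : S) : sw (sw G) = G :=
  algHom_ext' (f := sw.comp sw) (g := AlgHom.id K S) (by simp) (by simp) (by simp) G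

lemma sw_ev (G : S) : sw (ev G) = dl (ev G) :=
  algHom_ext' (f := sw.comp ev) (g := dl.comp ev) (by simp) (by simp) (by simp) G

/-- Summation over the first point: `G(y, z) ↦ ∑_k G(x_k, z)`. -/
def th : S →ₗ[K] S := pLift p fun m n => p m * z ^ n

lemma th_p_mul (k : ℕ) (G : S) : th (p k * G) = p k * th G := pLift_p_mul ..

lemma th_pow (m n : ℕ) : th (y ^ m * z ^ n) = p m * z ^ n := pLift_pow ..

lemma th_z_mul (G : S) : th (z * G) = z * th G :=
  linearMap_ext (r := p) (f := th ∘ₗ LinearMap.mulLeft K z) (g := LinearMap.mulLeft K z ∘ₗ th)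
    (fun k G => by simp [mul_left_comm z, th_p_mul])
    (fun k G => by simp [mul_left_comm z, th_p_mul])
    (fun m n => by
      simp only [LinearMap.comp_apply, LinearMap.mulLeft_apply, th_pow]
      rw [show z * (y ^ m * z ^ n) = y ^ m * z ^ (n + 1) by ring, th_pow]
      ring) G

/-- Summation over the second point, the first point excluded:
`G(y, z) ↦ ∑_{k ≠ 1} G(y, x_k)`. -/
def ta : S →ₗ[K] S :=
  sw.toLinearMap ∘ₗ (th - dl.toLinearMap) ∘ₗ sw.toLinearMap

lemma ta_apply (G : S) : ta G = sw (th (sw G) - dl (sw G)) := rfl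

lemma ta_p_mul (k : ℕ) (G : S) : ta (p k * G) = p k * ta G := by
  simp [ta_apply, th_p_mul, mul_sub]

lemma ta_y_mul (G : S) : ta (y * G) = y * ta G := by
  simp [ta_apply, th_z_mul, mul_sub]

lemma ta_pow (m n : ℕ) : ta (y ^ m * z ^ n) = (p n - y ^ n) * y ^ m := by
  rw [ta_apply, map_mul, map_pow, map_pow, sw_y, sw_z, mul_comm, th_pow]
  simp [sub_mul]

/-- `∑_{j=1}^m p_j y^{m-j}`. -/
def hq : ℕ → S
  | 0 => 0
  | m + 1 => y * hq m + p (m + 1)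

/-- `∑_{j=1}^n z^j y^{n-j}`. -/
def he : ℕ → S
  | 0 => 0
  | n + 1 => y * he n + z ^ (n + 1)

lemma y_mul_he (n : ℕ) : y * he n = z * he n + z * y ^ n - z ^ (n + 1) := by
  induction n with
  | zero => simp [he]
  | succ n ih =>
    rw [he]
    linear_combination y * ih

lemma he_sub_sw (n : ℕ) : he n - sw (he n) = z ^ n - y ^ n := by
  induction n with
  | zero => simp [he]
  | succ n ih =>
    have h := congrArg sw (y_mul_he n)
    simp only [map_mul, map_sub, map_add, map_pow, sw_y, sw_z] at h
    simp only [he, map_mul, map_add, map_pow, sw_y, sw_z]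
    linear_combination y * ih - h

/-- The divided-difference part of the Dunkl operator. -/
def T : S →ₗ[K] S := pLift p fun m n => hq m * z ^ n - z ^ m * he n

lemma T_p_mul (k : ℕ) (G : S) : T (p k * G) = p k * T G := pLift_p_mul ..

lemma T_pow (m n : ℕ) : T (y ^ m * z ^ n) = hq m * z ^ n - z ^ m * he n := pLift_pow ..

lemma T_z_mul (G : S) : T (z * G) = z * T G - z * sw G :=
  linearMap_ext (r := p) (f := T ∘ₗ LinearMap.mulLeft K z)
    (g := LinearMap.mulLeft K z ∘ₗ (T - sw.toLinearMap))
    (fun k G => by simp [mul_left_comm z, T_p_mul])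
    (fun k G => by simp [mul_left_comm z, T_p_mul, mul_sub])
    (fun m n => by
      simp only [LinearMap.comp_apply, LinearMap.mulLeft_apply, T_pow, LinearMap.sub_apply,
        AlgHom.toLinearMap_apply, map_mul, map_pow, sw_y, sw_z]
      rw [show z * (y ^ m * z ^ n) = y ^ m * z ^ (n + 1) by ring, T_pow, he]
      linear_combination -z ^ m * y_mul_he n) G |>.trans (by simp [mul_sub])

lemma T_y_mul (G : S) : T (y * G) = y * T G + z * sw G + th (y * G) - z * dl G :=
  linearMap_ext (r := p) (f := T ∘ₗ LinearMap.mulLeft K y)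
    (g := LinearMap.mulLeft K y ∘ₗ T + LinearMap.mulLeft K z ∘ₗ sw.toLinearMap
      + th ∘ₗ LinearMap.mulLeft K y - LinearMap.mulLeft K z ∘ₗ dl.toLinearMap)
    (fun k G => by simp [mul_left_comm y, T_p_mul])
    (fun k G => by
      simp [mul_left_comm y, mul_left_comm z, T_p_mul, th_p_mul, mul_sub, mul_add])
    (fun m n => by
      simp only [LinearMap.comp_apply, LinearMap.mulLeft_apply, T_pow, LinearMap.sub_apply,
        LinearMap.add_apply, AlgHom.toLinearMap_apply, map_mul, map_pow, sw_y, sw_z, dl_y, dl_z]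
      rw [show y * (y ^ m * z ^ n) = y ^ (m + 1) * z ^ n by ring, T_pow, th_pow, hq]
      linear_combination z ^ m * y_mul_he n) G

/-- The derivation `∑_i i y^i ∂/∂p_i`. -/
def Dp : Derivation K S S := mkDerivation K fun v => match v with
  | .p i => (i : K) • y ^ i
  | _ => 0

/-- The derivation `y ∂/∂y`. -/
def Dy : Derivation K S S := mkDerivation K fun v => match v with
  | .y => y
  | _ => 0

@[simp] lemma Dp_p (i : ℕ) : Dp (p i) = (i : K) • y ^ i := by simp only [Dp, p, mkDerivation_X]
@[simp] lemma Dp_y : Dp y = 0 := by rw [Dp, y, mkDerivation_X]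
@[simp] lemma Dp_z : Dp z = 0 := by rw [Dp, z, mkDerivation_X]
@[simp] lemma Dy_p (i : ℕ) : Dy (p i) = 0 := by rw [Dy, p, mkDerivation_X]
@[simp] lemma Dy_y : Dy y = y := by rw [Dy, y, mkDerivation_X, ← y]
@[simp] lemma Dy_z : Dy z = 0 := by rw [Dy, z, mkDerivation_X]

/-- The Dunkl operator at the first point. -/
def xi : S →ₗ[K] S := alpha • Dp.toLinearMap + bb • Dy.toLinearMap + T

lemma xi_apply (G : S) : xi G = alpha • Dp G + bb • Dy G + T G := rfl

lemma xi_one : xi 1 = 0 := by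
  have := T_pow 0 0
  simp only [pow_zero, mul_one, hq, he, mul_zero, sub_zero] at this
  simp [xi_apply, this]

lemma xi_p_mul (k : ℕ) (G : S) : xi (p k * G) = p k * xi G + (alpha * k) • (y ^ k * G) := by
  simp only [xi_apply, T_p_mul, Derivation.leibniz, Dp_p, Dy_p, smul_eq_mul, smul_eq_C_mul,
    map_mul, mul_zero]
  ring

lemma xi_z_mul (G : S) : xi (z * G) = z * xi G - z * sw G := by
  simp only [xi_apply, T_z_mul, Derivation.leibniz, Dp_z, Dy_z, smul_eq_mul, smul_eq_C_mul,
    mul_zero]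
  ring

lemma xi_y_mul (G : S) :
    xi (y * G) = y * xi G + bb • (y * G) + z * sw G + th (y * G) - z * dl G := by
  simp only [xi_apply, T_y_mul, Derivation.leibniz, Dp_y, Dy_y, smul_eq_mul, smul_eq_C_mul,
    mul_zero]
  ring

lemma xi_y_mul' (G : S) :
    xi (y * G) = y * xi G + bb • (y * G) + z * sw G + sw (ta (z * sw G)) := by
  rw [xi_y_mul, ta_apply]
  simp
  ring

lemma Dp_y_pow (m : ℕ) : Dp (y ^ m) = 0 := by simp [Derivation.leibniz_pow]
lemma Dp_z_pow (m : ℕ) : Dp (z ^ m) = 0 := by simp [Derivation.leibniz_pow]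
lemma Dy_z_pow (m : ℕ) : Dy (z ^ m) = 0 := by simp [Derivation.leibniz_pow]

lemma Dy_y_pow (m : ℕ) : Dy (y ^ m) = (m : K) • y ^ m := by
  induction m with
  | zero => simp
  | succ n ih =>
    rw [pow_succ, Derivation.leibniz, ih, Dy_y]
    simp only [smul_eq_mul, smul_eq_C_mul, Nat.cast_succ, map_add, map_one]
    ring

lemma xi_pow (m n : ℕ) :
    xi (y ^ m * z ^ n) = (bb * m) • (y ^ m * z ^ n) + (hq m * z ^ n - z ^ m * he n) := by
  simp only [xi_apply, T_pow, Derivation.leibniz, Dp_y_pow, Dp_z_pow, Dy_z_pow, Dy_y_pow,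
    smul_eq_mul, smul_eq_C_mul, map_mul]
  ring

lemma xi_y_pow (m : ℕ) : xi (y ^ m) = (bb * m) • y ^ m + hq m := by
  simpa [he] using xi_pow m 0

lemma ta_y_pow_mul (m : ℕ) (G : S) : ta (y ^ m * G) = y ^ m * ta G := by
  induction m with
  | zero => simp
  | succ n ih => rw [pow_succ', mul_assoc, ta_y_mul, ih, mul_assoc]

lemma ta_hq_mul (m : ℕ) (G : S) : ta (hq m * G) = hq m * ta G := by
  induction m with
  | zero => simp [hq]
  | succ n ih => rw [hq, add_mul, map_add, mul_assoc, ta_y_mul, ih, ta_p_mul]; ring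

lemma ta_z_pow (n : ℕ) : ta (z ^ n) = p n - y ^ n := by
  simpa using ta_pow 0 n

lemma ta_z_pow_mul_he (m n : ℕ) :
    ta (z ^ m * he n) = hq (m + n) - y ^ n * hq m - (n : S) * y ^ (m + n) := by
  induction n with
  | zero => simp [he]
  | succ n ih =>
    rw [he, mul_add, map_add, mul_left_comm, ta_y_mul, ih, ← pow_add, ta_z_pow,
      ← add_assoc, hq]
    push_cast
    ring

/-- The Dunkl operator commutes with summation over the other point. -/
lemma xi_ta (G : S) : xi (ta G) = ta (xi G) := by
  refine mem_of_p_mul_of_pow (LinearMap.eqLocus (xi ∘ₗ ta) (ta ∘ₗ xi)) (fun k G hG => ?_)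
    (fun m n => ?_) G
  · have hG' : xi (ta G) = ta (xi G) := hG
    change xi (ta (p k * G)) = ta (xi (p k * G))
    rw [ta_p_mul, xi_p_mul, xi_p_mul, hG', map_add, ta_p_mul, map_smul, ta_y_pow_mul]
  · change xi (ta (y ^ m * z ^ n)) = ta (xi (y ^ m * z ^ n))
    rw [ta_pow, sub_mul, map_sub, xi_p_mul, ← pow_add, xi_y_pow, xi_y_pow, xi_pow, map_add,
      map_sub, map_smul, ta_y_pow_mul, ta_hq_mul, ta_z_pow, ta_z_pow_mul_he, alpha]
    simp only [smul_eq_C_mul, map_add, map_mul, map_one, Nat.cast_add, map_natCast,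
      add_comm n m]
    ring

lemma xi_z_pow_mul (k : ℕ) (G : S) : xi (z ^ k * G) = z ^ k * xi G - he k * sw G := by
  induction k with
  | zero => simp [he]
  | succ k ih =>
    rw [pow_succ', mul_assoc, xi_z_mul, ih, he, map_mul, map_pow, sw_z]
    linear_combination sw G * y_mul_he k

/-- The Dunkl operator at the second point. -/
def xi2 : S →ₗ[K] S := sw.toLinearMap ∘ₗ xi ∘ₗ sw.toLinearMap

lemma xi2_apply (G : S) : xi2 G = sw (xi (sw G)) := rfl

lemma sw_xi (G : S) : sw (xi G) = xi2 (sw G) := by simp [xi2_apply]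
lemma sw_xi2 (G : S) : sw (xi2 G) = xi (sw G) := by simp [xi2_apply]

/-- The defect of the commutation relation between the two Dunkl operators. -/
def defect : S →ₗ[K] S :=
  xi ∘ₗ xi2 - xi2 ∘ₗ xi - sw.toLinearMap ∘ₗ (xi2 - xi)

lemma defect_apply (G : S) :
    defect G = xi (xi2 G) - xi2 (xi G) - sw (xi2 G - xi G) := rfl

lemma defect_sw (G : S) : defect (sw G) = -sw (defect G) := by
  simp only [defect_apply, map_sub, sw_xi, sw_xi2, sw_sw]
  ring

lemma defect_p_mul (k : ℕ) (G : S) : defect (p k * G) = p k * defect G := by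
  have h2 : ∀ G, xi2 (p k * G) = p k * xi2 G + (alpha * k) • (z ^ k * G) := fun G => by
    simp [xi2_apply, xi_p_mul]
  have h3 : ∀ G, xi2 (y ^ k * G) = y ^ k * xi2 G - sw (he k) * sw G := fun G => by
    simp [xi2_apply, xi_z_pow_mul]
  simp only [defect_apply, h2, h3, xi_p_mul, xi_z_pow_mul, map_add, map_sub, map_mul, map_pow,
    map_smul, sw_p, sw_y, sw_z]
  simp only [smul_eq_C_mul]
  linear_combination -C (alpha * (k : K)) * sw G * he_sub_sw k

lemma defect_z_mul (G : S) : defect (z * G) = z * defect G := by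
  have h2 : ∀ G, xi2 (z * G) = z * xi2 G + bb • (z * G) + y * sw G + ta (z * G) := fun G => by
    simp [xi2_apply, xi_y_mul']
  simp only [defect_apply, h2, xi_z_mul, xi_y_mul', xi_ta, map_add, map_sub, map_mul,
    map_smul, sw_y, sw_z, sw_sw, sw_xi, sw_xi2]
  simp only [smul_eq_C_mul]
  ring

lemma defect_eq_zero (G : S) : defect G = 0 := by
  induction G using MvPolynomial.induction_on with
  | C a =>
    rw [← mul_one (C a), ← smul_eq_C_mul, map_smul]
    simp [defect_apply, xi2_apply, xi_one]
  | add f g hf hg => rw [map_add, hf, hg, add_zero]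
  | mul_X f v hf =>
    rw [mul_comm]
    cases v with
    | p k => rw [← p, defect_p_mul, hf, mul_zero]
    | z => rw [← z, defect_z_mul, hf, mul_zero]
    | y =>
      have h : X CVar.y * f = sw (z * sw f) := by simp [y]
      rw [h, defect_sw, defect_z_mul, defect_sw, hf]
      simp

lemma xi_ev (G : S) : xi (ev G) = ev (xi G) := by
  have hth : ∀ G, th (ev G) = ev (th G) := linearMap_ext (r := p)
    (f := th ∘ₗ ev.toLinearMap) (g := ev.toLinearMap ∘ₗ th)
    (fun k G => by simp [th_p_mul]) (fun k G => by simp [th_p_mul]) (fun m n => by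
      cases n with
      | zero => have := th_pow m 0; simp at this; simp [this]
      | succ n => simp [th_pow])
  induction G using MvPolynomial.induction_on with
  | C a =>
    rw [← mul_one (C a), ← smul_eq_C_mul]
    simp [xi_one]
  | add f g hf hg => simp [hf, hg]
  | mul_X f v hf =>
    rw [mul_comm]
    cases v with
    | p k => rw [← p, map_mul, ev_p, xi_p_mul, xi_p_mul, hf]; simp
    | z => rw [← z, map_mul, ev_z, xi_z_mul]; simp
    | y =>
      rw [← y, map_mul, ev_y, xi_y_mul, xi_y_mul, hf, sw_ev]
      have := hth (y * f)
      simp only [map_mul, ev_y] at this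
      simp [this]
      abel

lemma sw_th_ev (G : S) : sw (th (ev G)) = th (ev G) :=
  linearMap_ext (r := p) (f := sw.toLinearMap ∘ₗ th ∘ₗ ev.toLinearMap)
    (g := th ∘ₗ ev.toLinearMap)
    (fun k G => by simp [th_p_mul]) (fun k G => by simp [th_p_mul]) (fun m n => by
      cases n with
      | zero => have := th_pow m 0; simp at this; simp [this]
      | succ n => simp) G

lemma th_ev (G : S) : th (ev G) = ta (sw (ev G)) + ev G := by
  rw [ta_apply, sw_sw, map_sub, sw_th_ev, ← sw_ev, sw_sw, sub_add_cancel]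

lemma th_ta_sw (G : S) : th (ta (sw G)) = th (ta G) :=
  linearMap_ext (r := p) (f := th ∘ₗ ta ∘ₗ sw.toLinearMap) (g := th ∘ₗ ta)
    (fun k G => by simp [th_p_mul, ta_p_mul]) (fun k G => by simp [th_p_mul, ta_p_mul])
    (fun m n => by
      have h : ∀ m, th (y ^ m) = p m := fun m => by simpa using th_pow m 0
      have h' : sw (y ^ m * z ^ n) = y ^ n * z ^ m := by simp [mul_comm]
      simp only [LinearMap.comp_apply, AlgHom.toLinearMap_apply, h', ta_pow, sub_mul, map_sub,
        th_p_mul, ← pow_add, h]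
      rw [add_comm, mul_comm]) G

section Abstract

variable {E : Type*} [Ring E]

/-- `∑_{r < m} a^r b^{m-r}`. -/
def mixedSum (a b : E) : ℕ → E
  | 0 => 0
  | m + 1 => a * mixedSum a b m + b ^ (m + 1)

lemma commute_mixedSum {a b c : E} (ha : Commute c a) (hb : Commute c b) (m : ℕ) :
    Commute c (mixedSum a b m) := by
  induction m with
  | zero => exact Commute.zero_right c
  | succ m ih => exact (ha.mul_right ih).add_right (hb.pow_right _)

lemma mul_mul_pow_eq {a b x s : E} (hab : Commute a b) (hx : x * b = b * x - b * s)
    (hs : s * b = a * s) (m : ℕ) :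
    a * x * b ^ m = b ^ m * (a * x) - a * mixedSum a b m * s := by
  induction m with
  | zero => simp [mixedSum]
  | succ m ih =>
    have h1 : a * x * b = b * (a * x) - a * b * s := by
      rw [mul_assoc, hx, mul_sub, ← mul_assoc, ← mul_assoc, hab.eq, mul_assoc]
    have h2 : b ^ m * (a * b * s) = a * b ^ (m + 1) * s := by
      rw [← mul_assoc, ← mul_assoc, ← (hab.pow_right m).eq, pow_succ, ← mul_assoc]
    have h3 : mixedSum a b m * a = a * mixedSum a b m :=
      (commute_mixedSum (Commute.refl a) hab m).eq.symm
    rw [pow_succ, ← mul_assoc, ih, sub_mul, mul_assoc (b ^ m), h1, mul_sub, h2,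
      mul_assoc _ s b, hs, mixedSum, mul_add, add_mul, ← mul_assoc, ← pow_succ,
      ← mul_assoc _ a s, mul_assoc a _ a, h3]
    abel

variable [Algebra K E]

/-- The product `(t + u₁) ⋯ (t + u_k)`. -/
def lp (L : List K) (t : E) : E := (L.map fun u => t + algebraMap K E u).prod

lemma lp_cons (u : K) (L : List K) (t : E) : lp (u :: L) t = (t + algebraMap K E u) * lp L t := by
  simp [lp]

lemma semiconjBy_lp {x t t' : E} (h : SemiconjBy x t t') (L : List K) :
    SemiconjBy x (lp L t) (lp L t') := by
  induction L with
  | nil => simp [lp]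
  | cons u L ih =>
    rw [lp_cons, lp_cons]
    exact (h.add_right (Algebra.commutes u x).symm).mul_right ih

lemma lp_mul_lp {a b a' b' : E} (h : Commute a b) (h' : Commute a' b') (hs : a + b = a' + b')
    (hm : a * b = a' * b') (L : List K) : lp L a * lp L b = lp L a' * lp L b' := by
  induction L with
  | nil => simp [lp]
  | cons u L ih =>
    have key : ∀ {c d : E}, Commute c d → lp (u :: L) c * lp (u :: L) d =
        (c * d + (c + d) * algebraMap K E u + algebraMap K E u * algebraMap K E u) *
          (lp L c * lp L d) := by
      intro c d hcd
      have e1 : Commute (d + algebraMap K E u) (lp L c) :=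
        semiconjBy_lp (hcd.symm.add_left (Algebra.commutes u c)) L
      have e2 : algebraMap K E u * d = d * algebraMap K E u := Algebra.commutes u d
      rw [lp_cons, lp_cons, mul_assoc, ← mul_assoc (lp L c), ← e1.eq, ← mul_assoc, ← mul_assoc,
        ← mul_assoc]
      congr 2
      simp only [add_mul, mul_add, e2]
      abel
    rw [key h, key h', hs, hm, ih]

variable {s x₁ x₂ y₁ y₂ : E}

lemma mul_lp_relation (hx : s * x₁ = x₂ * s) (hc : x₁ * x₂ - x₂ * x₁ = s * (x₂ - x₁))
    (hxy : x₁ * y₂ = y₂ * (x₁ - s)) (L : List K) :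
    x₁ * (y₂ * lp L x₂) = y₂ * lp L x₂ * x₁ - y₂ * lp L x₂ * s := by
  have h : Commute (x₁ - s) x₂ := by
    rw [Commute, SemiconjBy, sub_mul, mul_sub, ← hx, sub_eq_sub_iff_sub_eq_sub, hc, mul_sub]
  rw [← mul_assoc, hxy, mul_assoc, (semiconjBy_lp h L).eq, ← mul_assoc, mul_sub]

lemma commute_mul_lp (hx : s * x₁ = x₂ * s) (hx' : s * x₂ = x₁ * s)
    (hc : x₁ * x₂ - x₂ * x₁ = s * (x₂ - x₁)) (hy : y₁ * y₂ = y₂ * y₁)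
    (hxy : x₁ * y₂ = y₂ * (x₁ - s)) (hxy' : x₂ * y₁ = y₁ * (x₂ - s)) (L : List K) :
    Commute (y₁ * lp L x₁) (y₂ * lp L x₂) := by
  have h : Commute (x₁ - s) x₂ := by
    rw [Commute, SemiconjBy, sub_mul, mul_sub, ← hx, sub_eq_sub_iff_sub_eq_sub, hc, mul_sub]
  have h' : Commute (x₂ - s) x₁ := by
    rw [Commute, SemiconjBy, sub_mul, mul_sub, ← hx', sub_eq_sub_iff_sub_eq_sub, ← neg_sub, hc,
      mul_sub, neg_sub]
  have e : y₂ * lp L (x₁ - s) = lp L x₁ * y₂ := semiconjBy_lp hxy.symm L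
  have e' : y₁ * lp L (x₂ - s) = lp L x₂ * y₁ := semiconjBy_lp hxy'.symm L
  have hl : lp L (x₁ - s) * lp L x₂ = lp L (x₂ - s) * lp L x₁ := by
    refine lp_mul_lp h h' (by abel) ?_ L
    rw [mul_sub] at hc
    rw [sub_mul, sub_mul, sub_eq_sub_iff_sub_eq_sub, hc]
  calc y₁ * lp L x₁ * (y₂ * lp L x₂) = y₁ * (lp L x₁ * y₂) * lp L x₂ := by
        simp only [mul_assoc]
    _ = y₁ * y₂ * (lp L (x₁ - s) * lp L x₂) := by rw [← e]; simp only [mul_assoc]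
    _ = y₂ * (y₁ * lp L (x₂ - s)) * lp L x₁ := by rw [hl, hy]; simp only [mul_assoc]
    _ = y₂ * lp L x₂ * (y₁ * lp L x₁) := by rw [e']; simp only [mul_assoc]

end Abstract

/-- The operator `y (ξ + u₁) ⋯ (ξ + u_k)` at the first point. -/
def a1 (L : List K) : Module.End K S :=
  (LinearMap.mulLeft K y : Module.End K S) * lp L (xi : Module.End K S)

/-- The operator `z (ξ₂ + u₁) ⋯ (ξ₂ + u_k)` at the second point. -/
def a2 (L : List K) : Module.End K S :=
  (LinearMap.mulLeft K z : Module.End K S) * lp L (xi2 : Module.End K S)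

lemma a1_apply (L : List K) (G : S) : a1 L G = y * lp L (xi : Module.End K S) G := rfl

/-- The swap as an endomorphism. -/
def swE : Module.End K S := sw.toLinearMap

lemma swE_apply (G : S) : swE G = sw G := rfl

lemma swE_mul_xi : swE * xi = xi2 * swE :=
  LinearMap.ext fun G => sw_xi G

lemma swE_mul_xi2 : swE * xi2 = xi * swE :=
  LinearMap.ext fun G => sw_xi2 G

lemma swE_mul_a2 (L : List K) : swE * a2 L = a1 L * swE := by
  have h : swE * (LinearMap.mulLeft K z : Module.End K S) = LinearMap.mulLeft K y * swE := by
    refine LinearMap.ext fun G => ?_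
    simp [swE_apply]
  have h' : swE * lp L (xi2 : Module.End K S) = lp L xi * swE := semiconjBy_lp swE_mul_xi2 L
  rw [a2, a1, ← mul_assoc, h, mul_assoc, h', mul_assoc]

lemma xi_commutator : (xi * xi2 - xi2 * xi : Module.End K S) = swE * (xi2 - xi) := by
  refine LinearMap.ext fun G => ?_
  exact sub_eq_zero.mp (defect_eq_zero G)

lemma xi_mul_z : (xi * LinearMap.mulLeft K z : Module.End K S) =
    LinearMap.mulLeft K z * (xi - swE) := by
  refine LinearMap.ext fun G => ?_
  simp [swE_apply, xi_z_mul, mul_sub]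

lemma xi2_mul_y : (xi2 * LinearMap.mulLeft K y : Module.End K S) =
    LinearMap.mulLeft K y * (xi2 - swE) := by
  refine LinearMap.ext fun G => ?_
  simp [swE_apply, xi2_apply, xi_z_mul, mul_sub]

lemma commute_a1_a2 (L : List K) : Commute (a1 L) (a2 L) :=
  commute_mul_lp swE_mul_xi swE_mul_xi2 xi_commutator
    (LinearMap.ext fun G => mul_left_comm y z G) xi_mul_z xi2_mul_y L

lemma a1_xi_a2_pow (L : List K) (m : ℕ) :
    a1 L * xi * a2 L ^ m = a2 L ^ m * (a1 L * xi) - a1 L * mixedSum (a1 L) (a2 L) m * swE :=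
  mul_mul_pow_eq (commute_a1_a2 L) (mul_lp_relation swE_mul_xi xi_commutator xi_mul_z L)
    (swE_mul_a2 L) m

lemma commute_ta_xi : Commute (ta : Module.End K S) xi :=
  LinearMap.ext fun G => (xi_ta G).symm

lemma commute_ta_a1 (L : List K) : Commute (ta : Module.End K S) (a1 L) :=
  Commute.mul_right (LinearMap.ext fun G => ta_y_mul G)
    (semiconjBy_lp commute_ta_xi L)

lemma commute_ev_a1 (L : List K) : Commute (ev.toLinearMap : Module.End K S) (a1 L) :=
  Commute.mul_right (LinearMap.ext fun G => by simp)
    (semiconjBy_lp (LinearMap.ext fun G => (xi_ev G).symm) L)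

lemma sw_a1_pow (L : List K) (m : ℕ) (G : S) : sw ((a1 L ^ m) G) = (a2 L ^ m) (sw G) := by
  have h : SemiconjBy swE (a2 L) (a1 L) := swE_mul_a2 L
  have := LinearMap.congr_fun (h.pow_right m).eq (sw G)
  simp only [Module.End.mul_apply, swE_apply, sw_sw] at this
  rw [← this, sw_sw]

lemma ev_a1_pow {f : S} (hf : ev f = f) (L : List K) (m : ℕ) :
    ev ((a1 L ^ m) f) = (a1 L ^ m) f := by
  have := LinearMap.congr_fun ((commute_ev_a1 L).pow_right m).eq f
  simpa [hf] using this

lemma xi_a1 {g : S} (hg : ev g = g) (L : List K) :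
    xi (a1 L g) = a1 L (xi g) + alpha • a1 L g + ta (sw (a1 L g)) := by
  have hg' : ev (a1 L g) = a1 L g := by simpa using ev_a1_pow hg L 1
  have hc : xi (lp L (xi : Module.End K S) g) = lp L (xi : Module.End K S) (xi g) :=
    LinearMap.congr_fun (semiconjBy_lp (Commute.refl (xi : Module.End K S)) L).eq g
  have h1 : sw (a1 L g) = z * sw (lp L (xi : Module.End K S) g) := by simp [a1_apply]
  have h2 : dl (a1 L g) = z * dl (lp L (xi : Module.End K S) g) := by simp [a1_apply]
  have h3 : sw (a1 L g) = dl (a1 L g) := by rw [← hg', sw_ev]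
  have h4 := th_ev (a1 L g)
  rw [hg'] at h4
  rw [a1_apply L g, xi_y_mul, hc, ← a1_apply, ← a1_apply, ← h1, ← h2, h4, h3, alpha, add_smul,
    one_smul]
  abel

lemma xi_a1_pow {f : S} (hf : ev f = f) (hs : sw f = f) (L : List K) (m : ℕ) :
    xi ((a1 L ^ m) f) = (a1 L ^ m) (xi f) + (m * alpha) • (a1 L ^ m) f
      + ta (mixedSum (a1 L) (a2 L) m f) := by
  induction m with
  | zero => simp [mixedSum]
  | succ m ih =>
    have h := LinearMap.congr_fun (commute_ta_a1 L).eq (mixedSum (a1 L) (a2 L) m f)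
    simp only [Module.End.mul_apply] at h
    have h2 := sw_a1_pow L (m + 1) f
    rw [pow_succ', Module.End.mul_apply, hs] at h2
    rw [pow_succ', Module.End.mul_apply, Module.End.mul_apply, xi_a1 (ev_a1_pow hf L m), ih,
      map_add, map_add, map_smul, ← h, h2, mixedSum, LinearMap.add_apply, map_add,
      Module.End.mul_apply, Nat.cast_succ, add_mul, add_smul, one_mul]
    abel

/-- The commutation relation for the operators `θ a₁^m` on functions of the `p_i` alone. -/
lemma th_commutation {f : S} (hf : ev f = f) (hs : sw f = f) (L : List K) (m : ℕ) :
    th (a1 L (xi (th ((a1 L ^ m) f)))) - th ((a1 L ^ m) (th (a1 L (xi f)))) =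
      (m * alpha) • th ((a1 L ^ (m + 1)) f) := by
  have hh : ev (a1 L (xi f)) = a1 L (xi f) := by
    have h0 : ev (xi f) = xi f := by rw [← xi_ev, hf]
    simpa using ev_a1_pow h0 L 1
  have e1 := th_ev ((a1 L ^ m) f)
  rw [ev_a1_pow hf, sw_a1_pow, hs] at e1
  have e2 := th_ev (a1 L (xi f))
  rw [hh] at e2
  have e3 : a1 L (xi (ta ((a2 L ^ m) f))) =
      ta ((a2 L ^ m) (a1 L (xi f))) - ta (a1 L (mixedSum (a1 L) (a2 L) m f)) := by
    have h := LinearMap.congr_fun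
      ((commute_ta_a1 L).mul_right commute_ta_xi).eq ((a2 L ^ m) f)
    have h' := LinearMap.congr_fun (a1_xi_a2_pow L m) f
    simp only [Module.End.mul_apply, LinearMap.sub_apply, swE_apply, hs] at h h'
    rw [← h, h', map_sub]
  have e4 : a1 L (ta (mixedSum (a1 L) (a2 L) m f)) = ta (a1 L (mixedSum (a1 L) (a2 L) m f)) :=
    (LinearMap.congr_fun (commute_ta_a1 L).eq _).symm
  have e5 : th ((a1 L ^ m) (ta (sw (a1 L (xi f))))) = th (ta ((a2 L ^ m) (a1 L (xi f)))) := by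
    have h := LinearMap.congr_fun ((commute_ta_a1 L).pow_right m).eq (sw (a1 L (xi f)))
    simp only [Module.End.mul_apply] at h
    rw [← h, ← th_ta_sw, sw_a1_pow, sw_sw]
  have e6 : (a1 L ^ m) (a1 L (xi f)) = a1 L ((a1 L ^ m) (xi f)) := by
    rw [← Module.End.mul_apply, ← pow_succ, pow_succ', Module.End.mul_apply]
  rw [e1, e2]
  simp only [map_add, e3, e5, e6, xi_a1_pow hf hs, e4, map_sub, map_smul, pow_succ',
    Module.End.mul_apply]
  abel

section Transfer

lemma finite_support_pderiv {σ : Type*} (v : ℕ → σ) (hv : Function.Injective v)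
    (c : ℕ → MvPolynomial σ K) (g : MvPolynomial σ K) :
    (Function.support fun i => c i * pderiv (v i) g).Finite := by
  refine (g.vars.finite_toSet.preimage hv.injOn).subset fun i hi => ?_
  by_contra h
  exact hi (by simp only [pderiv_eq_zero_of_notMem_vars h, mul_zero])

lemma derivation_sum_apply {σ ι : Type*} (s : Finset ι)
    (D : ι → Derivation K (MvPolynomial σ K) (MvPolynomial σ K)) (g : MvPolynomial σ K) :
    (∑ i ∈ s, D i) g = ∑ i ∈ s, D i g := by
  classical
  induction s using Finset.induction_on with
  | empty => simp
  | insert i s hi ih => simp [Finset.sum_insert hi, ih]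

lemma finsum_pderiv {σ : Type*} (v : ℕ → σ) (hv : Function.Injective v)
    (c : ℕ → MvPolynomial σ K) (D : Derivation K (MvPolynomial σ K) (MvPolynomial σ K))
    (hD : ∀ i, D (X (v i)) = c i) (hD0 : ∀ w ∉ Set.range v, D (X w) = 0)
    (g : MvPolynomial σ K) : ∑ᶠ i, c i * pderiv (v i) g = D g := by
  classical
  set s := (g.vars.finite_toSet.preimage hv.injOn).toFinset with hs
  have hsub : (Function.support fun i => c i * pderiv (v i) g) ⊆ s := by
    intro i hi
    by_contra h
    rw [hs] at h
    simp only [Set.Finite.coe_toFinset, Set.mem_preimage] at h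
    exact hi (by simp only [pderiv_eq_zero_of_notMem_vars h, mul_zero])
  rw [finsum_eq_sum_of_support_subset _ hsub]
  have key : (∑ i ∈ s, c i • pderiv (v i) : Derivation K (MvPolynomial σ K) _) g = D g := by
    refine derivation_eq_of_forall_mem_vars fun w hw => ?_
    rw [derivation_sum_apply]
    simp only [Derivation.smul_apply, smul_eq_mul]
    by_cases hr : w ∈ Set.range v
    · obtain ⟨i, rfl⟩ := hr
      rw [hD, Finset.sum_eq_single i]
      · simp
      · intro j _ hj
        rw [pderiv_X_of_ne (fun h => hj (hv h).symm), mul_zero]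
      · intro hi
        exact absurd (by simpa [hs] using hw) hi
    · rw [hD0 w hr]
      refine Finset.sum_eq_zero fun j _ => ?_
      rw [pderiv_X_of_ne (fun h => hr ⟨j, h.symm⟩), mul_zero]
  rw [← key, derivation_sum_apply]
  simp

/-- The linear map `p_λ y^m ↦ y_m p_λ`, which kills the multiples of `z`. -/
def phi : S →ₗ[K] R := pLift P fun m n => if n = 0 then Y m else 0

lemma phi_p_mul (k : ℕ) (G : S) : phi (p k * G) = P k * phi G := pLift_p_mul ..

lemma phi_pow (m n : ℕ) : phi (y ^ m * z ^ n) = if n = 0 then Y m else 0 := pLift_pow ..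

lemma phi_y_pow (m : ℕ) : phi (y ^ m) = Y m := by simpa using phi_pow m 0

lemma phi_z_mul (G : S) : phi (z * G) = 0 :=
  linearMap_ext (r := P) (f := phi ∘ₗ LinearMap.mulLeft K z) (g := 0)
    (fun k G => by simp [mul_left_comm z, phi_p_mul]) (by simp)
    (fun m n => by
      rw [LinearMap.comp_apply, LinearMap.mulLeft_apply,
        show z * (y ^ m * z ^ n) = y ^ m * z ^ (n + 1) by ring, phi_pow]
      simp) G

lemma derivation_phi (D : Derivation K R R) (hD : ∀ k, D (P k) = 0) (L : S →ₗ[K] S)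
    (hL : ∀ k G, L (p k * G) = p k * L G)
    (h : ∀ m n, phi (L (y ^ m * z ^ n)) = if n = 0 then D (Y m) else 0) (G : S) :
    D (phi G) = phi (L G) :=
  linearMap_ext (r := P) (f := D.toLinearMap ∘ₗ phi) (g := phi ∘ₗ L)
    (fun k G => by simp [phi_p_mul, hD]) (fun k G => by simp [hL, phi_p_mul])
    (fun m n => by
      rw [LinearMap.comp_apply, LinearMap.comp_apply, h, phi_pow]
      split_ifs <;> simp) G

/-- The derivation with `y_i ↦ c_i` which kills the `p_i`. -/
def dY' (c : ℕ → R) : Derivation K R R := mkDerivation K fun v => match v with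
  | .p _ => 0
  | .y i => c i

lemma dY'_P (c : ℕ → R) (k : ℕ) : dY' c (P k) = 0 := by rw [dY', P, mkDerivation_X]
lemma dY'_Y (c : ℕ → R) (k : ℕ) : dY' c (Y k) = c k := by rw [dY', Y, mkDerivation_X]

lemma injective_y : Function.Injective Var.y := fun _ _ h => Var.y.inj h

lemma finsum_dY (c : ℕ → R) (g : R) : ∑ᶠ i, c i * dY i g = dY' c g := by
  refine finsum_pderiv Var.y injective_y c (dY' c) (dY'_Y c) (fun w hw => ?_) g
  cases w with
  | p i => exact dY'_P c i
  | y i => exact absurd ⟨i, rfl⟩ hw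

lemma finsum_dY_add (k : ℕ) (c : ℕ → R) (hc : ∀ i < k, c i = 0) (g : R) :
    ∑ᶠ i, c (i + k) * dY (i + k) g = dY' c g := by
  refine finsum_pderiv (fun i => Var.y (i + k)) (fun i j h => by simpa using h)
    (fun i => c (i + k)) (dY' c) (fun i => dY'_Y c _) (fun w hw => ?_) g
  cases w with
  | p i => exact dY'_P c i
  | y i =>
    refine (dY'_Y c i).trans (hc i ?_)
    by_contra h
    exact hw ⟨i - k, by simp only [Nat.sub_add_cancel (not_lt.mp h)]⟩

lemma dY'_shift_phi (k : ℕ) (G : S) :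
    dY' (fun i => Y (i + k)) (phi G) = phi (y ^ k * G) :=
  derivation_phi _ (dY'_P _) (LinearMap.mulLeft K (y ^ k))
    (fun k G => by simp [mul_left_comm])
    (fun m n => by
      rw [LinearMap.mulLeft_apply, ← mul_assoc, ← pow_add, phi_pow, dY'_Y, add_comm]) G

lemma Yplus_phi (G : S) : Yplus (phi G) = phi (y * G) := by
  rw [Yplus, finsum_dY fun i => Y (i + 1)]
  simpa using dY'_shift_phi 1 G

lemma dP_phi (k : ℕ) (G : S) : dP k (phi G) = phi (pderiv (CVar.p k) G) := by
  refine mem_of_p_mul_of_pow (LinearMap.eqLocus ((pderiv (Var.p k)).toLinearMap ∘ₗ phi)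
    (phi ∘ₗ (pderiv (CVar.p k)).toLinearMap)) (fun i G hG => ?_) (fun m n => ?_) G
  · have hG' : pderiv (Var.p k) (phi G) = phi (pderiv (CVar.p k) G) := hG
    change pderiv (Var.p k) (phi (p i * G)) = phi (pderiv (CVar.p k) (p i * G))
    rw [phi_p_mul, Derivation.leibniz, Derivation.leibniz, hG', map_add, smul_eq_mul,
      smul_eq_mul, smul_eq_mul, smul_eq_mul, phi_p_mul]
    by_cases h : i = k
    · subst h
      simp [P, p]
    · rw [P, p, pderiv_X_of_ne (by simpa using h), pderiv_X_of_ne (by simpa using h)]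
      simp
  · change pderiv (Var.p k) (phi (y ^ m * z ^ n)) = phi (pderiv (CVar.p k) (y ^ m * z ^ n))
    have hy : pderiv (CVar.p k) y = 0 := pderiv_X_of_ne (by simp)
    have hz : pderiv (CVar.p k) z = 0 := pderiv_X_of_ne (by simp)
    rw [phi_pow, Derivation.leibniz, Derivation.leibniz_pow, Derivation.leibniz_pow, hy, hz]
    split_ifs
    · simp [Y]
    · simp

lemma dP_dY (i j : ℕ) (g : R) : dP i (dY j g) = dY j (dP i g) := by
  have h : ⁅(pderiv (Var.p i) : Derivation K R R), (pderiv (Var.y j) : Derivation K R R)⁆ =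
      0 := by
    refine derivation_ext fun v => ?_
    classical
    rw [Derivation.commutator_apply, pderiv_X, pderiv_X, Pi.single_apply, Pi.single_apply]
    split_ifs <;> simp
  have := DFunLike.congr_fun h g
  rw [Derivation.commutator_apply] at this
  exact sub_eq_zero.mp this

lemma he_eq_z_mul (n : ℕ) : ∃ G, he n = z * G := by
  induction n with
  | zero => exact ⟨0, by simp [he]⟩
  | succ n ih =>
    obtain ⟨G, hG⟩ := ih
    exact ⟨y * G + z ^ n, by rw [he, hG]; ring⟩

lemma hq_eq_sum (n : ℕ) : hq n = ∑ i ∈ Finset.range n, p (n - i) * y ^ i := by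
  induction n with
  | zero => simp [hq]
  | succ n ih =>
    rw [hq, ih, Finset.sum_range_succ', Finset.mul_sum]
    simp only [Nat.add_sub_add_right, pow_succ', mul_left_comm, Nat.sub_zero, pow_zero, mul_one]

lemma phi_T_pow (m n : ℕ) : phi (T (y ^ m * z ^ n)) =
    if n = 0 then ∑ i ∈ Finset.range m, Y i * P (m - i) else 0 := by
  obtain ⟨G, hG⟩ := he_eq_z_mul n
  rw [T_pow, map_sub, hG, mul_left_comm, phi_z_mul, sub_zero]
  cases n with
  | zero =>
    simp only [hq_eq_sum, pow_zero, mul_one, map_sum, phi_p_mul, phi_y_pow, if_true]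
    exact Finset.sum_congr rfl fun _ _ => mul_comm _ _
  | succ n => rw [pow_succ', mul_left_comm, phi_z_mul]; simp

lemma finsum_quadratic (g : R) :
    ∑ᶠ (i : ℕ) (j : ℕ), Y i * P (j + 1) * dY (i + j + 1) g =
      dY' (fun n => ∑ i ∈ Finset.range n, Y i * P (n - i)) g := by
  have h1 : ∀ i, ∑ᶠ j, Y i * P (j + 1) * dY (i + j + 1) g =
      dY' (fun n => if i < n then Y i * P (n - i) else 0) g := by
    intro i
    rw [← finsum_dY_add (i + 1) _ (fun j hj => if_neg (by omega))]
    refine finsum_congr fun j => ?_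
    rw [if_pos (by omega), show j + (i + 1) - i = j + 1 by omega,
      show j + (i + 1) = i + j + 1 by omega]
  simp only [h1]
  obtain ⟨N, hN⟩ : ∃ N, ∀ n, Var.y n ∈ g.vars → n < N := by
    obtain ⟨N, hN⟩ := (g.vars.finite_toSet.preimage injective_y.injOn).bddAbove
    exact ⟨N + 1, fun n hn => Nat.lt_succ_of_le (hN hn)⟩
  have hsub : (Function.support fun i =>
      dY' (fun n => if i < n then Y i * P (n - i) else 0) g) ⊆ Finset.range N := by
    intro i hi
    by_contra h
    refine hi ((derivation_eq_of_forall_mem_vars (D₂ := 0) fun w hw => ?_).trans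
      (Derivation.zero_apply _))
    cases w with
    | p k => exact dY'_P _ k
    | y k =>
      have hk := hN k hw
      simp only [Finset.coe_range, Set.mem_Iio, not_lt] at h
      exact (dY'_Y _ k).trans (if_neg (by omega))
  rw [finsum_eq_sum_of_support_subset _ hsub, ← derivation_sum_apply]
  refine derivation_eq_of_forall_mem_vars fun w hw => ?_
  rw [derivation_sum_apply]
  cases w with
  | p k =>
    rw [← P, dY'_P]
    exact Finset.sum_eq_zero fun i _ => dY'_P _ k
  | y k =>
    have hk := hN k hw
    rw [← Y, dY'_Y]
    simp only [dY'_Y]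
    rw [← Finset.sum_filter]
    congr 1
    ext i
    simp only [Finset.mem_filter, Finset.mem_range]
    omega

lemma finsum_Dp (G : S) :
    ∑ᶠ i : ℕ, (((i + 1 : ℕ) : K) • y ^ (i + 1)) * pderiv (CVar.p (i + 1)) G = Dp G := by
  refine finsum_pderiv (fun i => CVar.p (i + 1)) (fun i j h => by simpa using h) _ Dp
    (fun i => Dp_p (i + 1)) (fun w hw => ?_) G
  cases w with
  | y => exact Dp_y
  | z => exact Dp_z
  | p i =>
    cases i with
    | zero => exact (Dp_p 0).trans (by simp)
    | succ i => exact absurd ⟨i, rfl⟩ hw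

lemma LamY_phi (G : S) : LamY (phi G) = phi (xi G) := by
  have h1 : ∑ᶠ (i : ℕ) (j : ℕ),
      ((i + 1 : ℕ) : K) • (Y (i + j + 1) * dP (i + 1) (dY j (phi G))) = phi (Dp G) := by
    rw [← finsum_Dp, map_finsum phi
      (finite_support_pderiv (fun i => CVar.p (i + 1)) (fun i j h => by simpa using h) _ G)]
    refine finsum_congr fun i => ?_
    simp only [dP_dY, dP_phi]
    rw [← smul_finsum, smul_mul_assoc, map_smul, ← dY'_shift_phi, ← finsum_dY]
    simp only [show ∀ j, i + j + 1 = j + (i + 1) by intro j; omega]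
  have h2 : ∑ᶠ (i : ℕ), ((i + 1 : ℕ) : K) • (Y (i + 1) * dY (i + 1) (phi G)) = phi (Dy G) := by
    have h := finsum_dY_add 1 (fun i => (i : K) • Y i) (by simp) (phi G)
    simp only [smul_mul_assoc] at h
    rw [h]
    refine derivation_phi _ (dY'_P _) Dy.toLinearMap (fun k G => by simp) (fun m n => ?_) G
    change phi (Dy (y ^ m * z ^ n)) = _
    rw [Derivation.leibniz, Dy_z_pow, smul_zero, zero_add, Dy_y_pow, smul_comm, map_smul,
      smul_eq_mul, mul_comm, phi_pow, dY'_Y]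
    split_ifs <;> simp
  have h3 : dY' (fun n => ∑ i ∈ Finset.range n, Y i * P (n - i)) (phi G) = phi (T G) :=
    derivation_phi _ (dY'_P _) T T_p_mul (fun m n => by rw [phi_T_pow, dY'_Y]) G
  rw [LamY, h1, h2, finsum_quadratic, h3, xi_apply, map_add, map_add, map_smul, map_smul]
  abel

/-- The substitution killing `y` and `z`. -/
def psi : S →ₐ[K] R := aeval fun v => match v with
  | .p i => P i
  | _ => 0

lemma psi_p (i : ℕ) : psi (p i) = P i := by simp only [psi, p, aeval_X]
lemma psi_z : psi z = 0 := by simp only [psi, z, aeval_X]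

/-- The substitution killing the `y_i`. -/
def iota : R →ₐ[K] S := aeval fun v => match v with
  | .p i => p i
  | .y _ => 0

lemma iota_P (i : ℕ) : iota (P i) = p i := by simp only [iota, P, aeval_X]

lemma ThetaY_phi (G : S) : ThetaY (phi (y * G)) = psi (th (y * G)) := by
  have h := finsum_dY_add 1 (fun i => if i = 0 then 0 else P i) (by simp) (phi (y * G))
  simp only [Nat.add_eq_zero_iff, one_ne_zero, and_false, if_false] at h
  rw [ThetaY, h]
  refine linearMap_ext (r := P)
    (f := (dY' _).toLinearMap ∘ₗ phi ∘ₗ LinearMap.mulLeft K y)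
    (g := psi.toLinearMap ∘ₗ th ∘ₗ LinearMap.mulLeft K y)
    (fun k G => by simp [mul_left_comm y, phi_p_mul, dY'_P])
    (fun k G => by simp [mul_left_comm y, th_p_mul, psi_p]) (fun m n => ?_) G
  change dY' _ (phi (y * (y ^ m * z ^ n))) = psi (th (y * (y ^ m * z ^ n)))
  rw [← mul_assoc, ← pow_succ', phi_pow, th_pow, map_mul, map_pow, psi_p, psi_z]
  split_ifs with hn
  · subst hn
    rw [dY'_Y]
    simp
  · simp [hn]

lemma phi_iota (f : R) : phi (iota f) = Y 0 * psi (iota f) := by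
  induction f using MvPolynomial.induction_on with
  | C a =>
    rw [← mul_one (C a), ← smul_eq_C_mul]
    have := phi_y_pow 0
    rw [pow_zero] at this
    simp [this]
  | add f g hf hg => simp only [map_add, hf, hg, mul_add]
  | mul_X f v hf =>
    cases v with
    | p i => rw [← P, map_mul, iota_P, mul_comm, phi_p_mul, hf, map_mul, psi_p]; ring
    | y i => simp [iota]

lemma psi_iota {f : R} (hf : f ∈ Psub) : psi (iota f) = f := by
  obtain ⟨g, rfl⟩ : ∃ g : MvPolynomial ℕ K, rename Var.p g = f := by
    have h : f ∈ Algebra.adjoin K ((X : Var → R) '' Set.range Var.p) := hf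
    induction h using Algebra.adjoin_induction with
    | mem f h =>
      obtain ⟨_, ⟨i, rfl⟩, rfl⟩ := h
      exact ⟨X i, by simp⟩
    | algebraMap r => exact ⟨C r, by simp [algebraMap_eq]⟩
    | add f g hf' hg' h1 h2 =>
      obtain ⟨a, rfl⟩ := h1 hf'
      obtain ⟨b, rfl⟩ := h2 hg'
      exact ⟨a + b, map_add _ _ _⟩
    | mul f g hf' hg' h1 h2 =>
      obtain ⟨a, rfl⟩ := h1 hf'
      obtain ⟨b, rfl⟩ := h2 hg'
      exact ⟨a * b, map_mul _ _ _⟩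
  have : (psi.comp iota).comp (rename Var.p) = rename (R := K) Var.p := by
    apply MvPolynomial.algHom_ext
    intro i
    simp only [AlgHom.comp_apply, rename_X]
    rw [← P, iota_P, psi_p]
  exact DFunLike.congr_fun this g

lemma sw_iota (f : R) : sw (iota f) = iota f := by
  have : sw.comp iota = iota := by
    apply MvPolynomial.algHom_ext
    rintro (i | i) <;> simp [iota]
  exact DFunLike.congr_fun this f

lemma ev_iota (f : R) : ev (iota f) = iota f := by
  have : ev.comp iota = iota := by
    apply MvPolynomial.algHom_ext
    rintro (i | i) <;> simp [iota]
  exact DFunLike.congr_fun this f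

lemma iota_psi_th {G : S} (hG : ev G = G) : iota (psi (th G)) = th G := by
  have := linearMap_ext (r := p)
    (f := iota.toLinearMap ∘ₗ psi.toLinearMap ∘ₗ th ∘ₗ ev.toLinearMap)
    (g := th ∘ₗ ev.toLinearMap)
    (fun k G => by simp [th_p_mul, psi_p, iota_P]) (fun k G => by simp [th_p_mul])
    (fun m n => by
      cases n with
      | zero => have := th_pow m 0; simp at this; simp [this, psi_p, iota_P]
      | succ n => simp) G
  simpa [hG] using this

lemma prodLu_phi (k : ℕ) (u : Fin k → K) (G : S) :
    prodLu k u (phi G) = phi (lp (List.ofFn u) (xi : Module.End K S) G) := by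
  have key : ∀ (L : List K) (G : S),
      (L.map Lu).foldr (fun g h => g ∘ h) (id : R → R) (phi G) =
        phi (lp L (xi : Module.End K S) G) := by
    intro L
    induction L with
    | nil => intro G; simp [lp]
    | cons v L ih =>
      intro G
      rw [List.map_cons, List.foldr_cons, Function.comp_apply, ih, Lu, LamY_phi, lp_cons,
        Module.End.mul_apply, LinearMap.add_apply, Module.algebraMap_end_apply, map_add,
        map_smul]
  rw [prodLu, ← key, List.map_ofFn]
  rfl

lemma Wop_phi (k : ℕ) (u : Fin k → K) (G : S) :
    Wop k u (phi G) = phi (a1 (List.ofFn u) G) := by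
  rw [Wop, prodLu_phi, Yplus_phi, a1_apply]

lemma Wop_iterate_phi (k : ℕ) (u : Fin k → K) (m : ℕ) (G : S) :
    (Wop k u)^[m] (phi G) = phi ((a1 (List.ofFn u) ^ m) G) := by
  induction m with
  | zero => simp
  | succ m ih =>
    rw [Function.iterate_succ_apply', ih, Wop_phi, pow_succ', Module.End.mul_apply]

lemma B_psi (k : ℕ) (u : Fin k → K) (m : ℕ) {F : S} (hF : phi F = Y 0 * psi F) :
    B k u (m + 1) (psi F) =
      ((m.factorial : K) * alpha⁻¹) • psi (th ((a1 (List.ofFn u) ^ (m + 1)) F)) := by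
  rw [B, ← hF, Wop_iterate_phi, pow_succ', Module.End.mul_apply, a1_apply, ThetaY_phi]
  rfl

lemma Omega_psi (k : ℕ) (u : Fin k → K) {F : S} (hF : phi F = Y 0 * psi F) :
    Omega k u (psi F) = alpha⁻¹ • psi (th (a1 (List.ofFn u) (xi F))) := by
  rw [Omega, ← hF, LamY_phi, prodLu_phi, Yplus_phi, a1_apply, ThetaY_phi]
  rfl

lemma phi_th {G : S} (hG : ev G = G) (c : K) : phi (c • th G) = Y 0 * psi (c • th G) := by
  rw [map_smul, map_smul, ← iota_psi_th hG, phi_iota, mul_smul_comm]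

end Transfer

lemma alpha_ne_zero : alpha ≠ 0 := by
  intro h
  have h' : algebraMap (Polynomial ℚ) K (Polynomial.X + Polynomial.C 1) = 0 := by
    rw [map_add, RatFunc.algebraMap_X, Polynomial.C_1, map_one, add_comm]
    exact h
  rw [map_eq_zero_iff _ (RatFunc.algebraMap_injective ℚ)] at h'
  exact Polynomial.X_add_C_ne_zero 1 h'

end TwoPoint

open TwoPoint

/-- **Second commutation relations** (Theorem 4.5 of Chapuy–Dołęga): for every `m ≥ 1`,
`B^{(k)}_{m+1} = [Ω_Y^{(k)}, B^{(k)}_m]` as operators on `𝒫`. -/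
theorem second_commutation_relations (k : ℕ) (hk : 1 ≤ k) (u : Fin k → K) :
    ∀ m : ℕ, 1 ≤ m → ∀ f ∈ Psub,
      B k u (m + 1) f = Omega k u (B k u m f) - B k u m (Omega k u f) := by
  intro m hm f hf
  obtain ⟨n, rfl⟩ : ∃ n, m = n + 1 := ⟨m - 1, by omega⟩
  set L := List.ofFn u with hL
  set F := iota f with hF
  have hev : ev F = F := ev_iota f
  have hphi : phi F = Y 0 * psi F := phi_iota f
  have hg := ev_a1_pow hev L (n + 1)
  have hh : ev (a1 L (xi F)) = a1 L (xi F) := by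
    simpa using ev_a1_pow (f := xi F) (by rw [← xi_ev, hev]) L 1
  rw [← psi_iota hf, ← hF, B_psi k u (n + 1) hphi, B_psi k u n hphi, Omega_psi k u hphi, ← hL,
    ← map_smul psi, ← map_smul psi, ← map_smul psi, Omega_psi k u (phi_th hg _),
    B_psi k u n (phi_th hh _), ← hL]
  simp only [map_smul, smul_smul]
  have key := congrArg psi (th_commutation hev (sw_iota f) L (n + 1))
  rw [map_sub, map_smul] at key
  have e : alpha⁻¹ * ((n.factorial : K) * alpha⁻¹) = (n.factorial : K) * alpha⁻¹ * alpha⁻¹ := by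
    ring
  rw [e, ← smul_sub, key, smul_smul]
  congr 1
  rw [Nat.factorial_succ]
  push_cast
  field_simp [alpha_ne_zero]
end
end

section
/- Lax equations in solved form: for every integer j ≥ 0 and every f ∈ 𝒫, A_{j+1} f = Σ_{i=0}^{j} (−1)^{j−i}·C(j,i)·D_α^i( A_1( D_α^{j−i} f ) ), and likewise B^{(k)}_{j+1} f = Σ_{i=0}^{j} (−1)^{j−i}·C(j,i)·(Ω_Y^{(k)})^i( B^{(k)}_1( (Ω_Y^{(k)})^{j−i} f ) ), where C(j,i) is the binomial coefficient. Equivalently, the exponential generating series A(s) = Σ_{j≥0} (s^j/j!)·A_{j+1} and B^{(k)}(s) = Σ_{j≥0} (s^j/j!)·B^{(k)}_{j+1} of operators satisfy the Lax equations (d/ds)A(s) = [D_α, A(s)] and (d/ds)B^{(k)}(s) = [Ω_Y^{(k)}, B^{(k)}(s)], with solutions A(s) = e^{sD_α}·A_1·e^{−sD_α} and B^{(k)}(s) = e^{sΩ_Y^{(k)}}·B^{(k)}_1·e^{−sΩ_Y^{(k)}}. -/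
open MvPolynomial

noncomputable section

namespace LaxRing

/-! ### Commutator identities in an associative ring -/

section Ring

variable {S : Type*} [Ring S]

/-- The sequence of iterated commutators `(ad D)^n e`. -/
def adSeq (D e : S) : ℕ → S
  | 0 => e
  | n + 1 => D * adSeq D e n - adSeq D e n * D

/-- The sum `∑_{i < n} Y L^i Y L^(n - 1 - i)`, defined by recursion on `n`. -/
def powSum (L Y : S) : ℕ → S
  | 0 => 0
  | n + 1 => powSum L Y n * L + Y * L ^ n * Y

theorem adSeq_eq_sum (D e : S) (n : ℕ) :
    adSeq D e n = ∑ i ∈ Finset.range (n + 1),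
      ((-1 : ℤ) ^ (n - i) * (n.choose i : ℤ)) • (D ^ i * e * D ^ (n - i)) := by
  have key : adSeq D e n =
      ((LinearMap.mulLeft ℤ D + -LinearMap.mulRight ℤ D) ^ n) e := by
    induction n with
    | zero => rfl
    | succ n ih =>
      rw [pow_succ', Module.End.mul_apply, ← ih]
      simp [adSeq, sub_eq_add_neg]
  have hcomm : Commute (LinearMap.mulLeft ℤ D) (-LinearMap.mulRight ℤ D) :=
    (LinearMap.commute_mulLeft_right D D).neg_right
  rw [key, hcomm.add_pow, LinearMap.sum_apply]
  refine Finset.sum_congr rfl fun i _ => ?_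
  rw [neg_pow, LinearMap.pow_mulLeft, LinearMap.pow_mulRight]
  rcases Nat.even_or_odd (n - i) with h | h <;>
    simp [h.neg_one_pow, Module.End.mul_apply, Module.End.natCast_apply, mul_assoc,
      ((Nat.cast_commute (n.choose i) (D ^ i)).left_comm _).symm]

variable {D L Y e : S}

theorem D_mul_pow (hDL : D * L = L * D) (n : ℕ) : D * L ^ n = L ^ n * D :=
  (Commute.pow_right (show Commute D L from hDL) n).eq

theorem D_mul_Y_pow (hDL : D * L = L * D) (hDY : D * Y = Y * D + Y * L) (n : ℕ) :
    D * (Y * L ^ n) = Y * L ^ n * D + Y * L ^ (n + 1) := by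
  rw [← mul_assoc, hDY, add_mul, mul_assoc Y D, D_mul_pow hDL, pow_succ']
  noncomm_ring

theorem L_commutator_adSeq (hDL : D * L = L * D) (hDY : D * Y = Y * D + Y * L)
    (hLe : L * e = e * L + Y) (n : ℕ) :
    L * adSeq D e n = adSeq D e n * L + Y * L ^ n := by
  induction n with
  | zero => simpa [adSeq] using hLe
  | succ n ih =>
    have h := D_mul_Y_pow hDL hDY n
    simp only [adSeq]
    linear_combination (norm := noncomm_ring) D * ih - ih * D + h
      - hDL * adSeq D e n + adSeq D e n * hDL

theorem D_commutator_powSum (hDL : D * L = L * D) (hDY : D * Y = Y * D + Y * L) (n : ℕ) :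
    D * powSum L Y n = powSum L Y n * D + 2 * (powSum L Y n * L) + Y * L ^ n * Y
      - Y * Y * L ^ n := by
  induction n with
  | zero => simp [powSum]
  | succ n ih =>
    have h := D_mul_Y_pow hDL hDY n
    simp only [powSum]
    linear_combination (norm := noncomm_ring) ih * L + powSum L Y n * hDL + h * Y
      + Y * L ^ n * hDY

theorem Y_commutator_adSeq (hDL : D * L = L * D) (hDY : D * Y = Y * D + Y * L)
    (hLe : L * e = e * L + Y) (hYe : Y * e = e * Y) (n : ℕ) :
    Y * adSeq D e n = adSeq D e n * Y - powSum L Y n := by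
  induction n with
  | zero => simpa [adSeq, powSum] using hYe
  | succ n ih =>
    have h := D_commutator_powSum hDL hDY n
    have h' := L_commutator_adSeq hDL hDY hLe n
    simp only [adSeq, powSum]
    linear_combination (norm := noncomm_ring) D * ih - ih * D - h - hDY * adSeq D e n
      + adSeq D e n * hDY - Y * h' - ih * L

theorem Y_pow_commutator_adSeq (hDL : D * L = L * D) (hDY : D * Y = Y * D + Y * L)
    (hLe : L * e = e * L + Y) (hYe : Y * e = e * Y) (m n : ℕ) :
    Y * L ^ m * adSeq D e n - adSeq D e n * (Y * L ^ m) =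
      powSum L Y m * L ^ n - powSum L Y n * L ^ m := by
  induction m with
  | zero =>
    linear_combination (norm := (simp [powSum]; noncomm_ring))
      Y_commutator_adSeq hDL hDY hLe hYe n
  | succ m ih =>
    have h' := L_commutator_adSeq hDL hDY hLe n
    have hc : L * L ^ n = L ^ n * L := (pow_succ' L n).symm.trans (pow_succ L n)
    simp only [powSum, pow_succ]
    linear_combination (norm := noncomm_ring) ih * L + Y * L ^ m * h' - powSum L Y m * hc

end Ring

section Algebra

open scoped Polynomial

variable {k S : Type*} [Field k] [Ring S] [Algebra k S]

/-- The linear extension of the sequence `(ad D)^n e` to polynomials, sending `X ^ n` to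
`(ad D)^n e`. -/
def adPoly (D e : S) : k[X] →ₗ[k] S :=
  Polynomial.lsum fun n => LinearMap.toSpanSingleton k S (adSeq D e n)

@[simp]
theorem adPoly_monomial (D e : S) (n : ℕ) (c : k) :
    adPoly D e (Polynomial.monomial n c) = c • adSeq D e n := by
  simp [adPoly]

theorem adPoly_X_mul (D e : S) (q : k[X]) :
    adPoly D e (Polynomial.X * q) = D * adPoly D e q - adPoly D e q * D := by
  induction q using Polynomial.induction_on' with
  | add p q hp hq => rw [mul_add, map_add, map_add, hp, hq]; noncomm_ring
  | monomial n c => simp [Polynomial.X_mul_monomial, adSeq, smul_sub]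

variable {D L Y e : S}

theorem L_commutator_adPoly (hDL : D * L = L * D) (hDY : D * Y = Y * D + Y * L)
    (hLe : L * e = e * L + Y) (q : k[X]) :
    L * adPoly D e q = adPoly D e q * L + Y * Polynomial.aeval L q := by
  induction q using Polynomial.induction_on' with
  | add p q hp hq => simp only [map_add, mul_add, add_mul, hp, hq]; abel
  | monomial n c =>
    simp [Polynomial.aeval_monomial, L_commutator_adSeq hDL hDY hLe n, smul_add, ← Algebra.smul_def]

theorem Y_aeval_commutator_adPoly_add (hDL : D * L = L * D) (hDY : D * Y = Y * D + Y * L)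
    (hLe : L * e = e * L + Y) (hYe : Y * e = e * Y) (p q : k[X]) :
    (Y * Polynomial.aeval L p * adPoly D e q - adPoly D e q * (Y * Polynomial.aeval L p)) +
      (Y * Polynomial.aeval L q * adPoly D e p - adPoly D e p * (Y * Polynomial.aeval L q)) = 0 := by
  induction p using Polynomial.induction_on' with
  | add p p' hp hp' =>
    simp only [map_add]
    linear_combination (norm := noncomm_ring) hp + hp'
  | monomial m c =>
    induction q using Polynomial.induction_on' with
    | add p p' hp hp' =>
      simp only [map_add]
      linear_combination (norm := noncomm_ring) hp + hp'
    | monomial n d =>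
      have h := Y_pow_commutator_adSeq hDL hDY hLe hYe m n
      have h' := Y_pow_commutator_adSeq hDL hDY hLe hYe n m
      have key := congrArg₂ (· + ·) h h'
      simp only [sub_add_sub_cancel, sub_self] at key
      simp only [Polynomial.aeval_monomial, adPoly_monomial, ← Algebra.smul_def, mul_smul_comm,
        smul_mul_assoc, smul_comm d c, ← smul_sub, ← smul_add, key, smul_zero]

/-- `Y q(L)` commutes with the linear combination of iterated commutators given by `q`. -/
theorem Y_aeval_commute_adPoly [NeZero (2 : k)]
    (hDL : D * L = L * D) (hDY : D * Y = Y * D + Y * L)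
    (hLe : L * e = e * L + Y) (hYe : Y * e = e * Y) (q : k[X]) :
    Y * Polynomial.aeval L q * adPoly D e q = adPoly D e q * (Y * Polynomial.aeval L q) := by
  have h := Y_aeval_commutator_adPoly_add (k := k) hDL hDY hLe hYe q q
  rw [← two_smul k, smul_eq_zero_iff_right (NeZero.ne (2 : k))] at h
  exact sub_eq_zero.1 h

theorem D_mul_Y_aeval (hDL : D * L = L * D) (hDY : D * Y = Y * D + Y * L) (q : k[X]) :
    D * (Y * Polynomial.aeval L q) = Y * Polynomial.aeval L q * D + Y * Polynomial.aeval L q * L := by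
  induction q using Polynomial.induction_on' with
  | add p q hp hq => simp only [map_add, mul_add, add_mul, hp, hq]; abel
  | monomial n c =>
    have h := D_mul_Y_pow hDL hDY n
    simp only [Polynomial.aeval_monomial, ← Algebra.smul_def, mul_smul_comm, smul_mul_assoc, h, smul_add,
      pow_succ, mul_assoc]

theorem adPoly_X_mul_commutator [NeZero (2 : k)]
    (hDL : D * L = L * D) (hDY : D * Y = Y * D + Y * L)
    (hLe : L * e = e * L + Y) (hYe : Y * e = e * Y) (q : k[X]) :
    adPoly D e (Polynomial.X * q) * (Y * Polynomial.aeval L q) =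
      Y * Polynomial.aeval L q * adPoly D e (Polynomial.X * q) + (Y * Polynomial.aeval L q) ^ 2 := by
  have h1 := L_commutator_adPoly (k := k) hDL hDY hLe q
  have h2 := Y_aeval_commute_adPoly hDL hDY hLe hYe q
  have h3 := D_mul_Y_aeval (k := k) hDL hDY q
  rw [adPoly_X_mul]
  generalize Y * Polynomial.aeval L q = W at *
  linear_combination (norm := noncomm_ring) h3 * adPoly D e q - adPoly D e q * h3
    - D * h2 + h2 * D + W * h1 + h2 * L

end Algebra

end LaxRing

/-! ### The operators on polynomials in a marked variable

The span of the elements `y_n f`, with `f` a polynomial in the `p_i`, is modelled by the univariate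
polynomials `MvPolynomial ℕ k [t]`, with `t ^ n` in the role of `y_n`. -/

namespace LaxModel

variable {k : Type*} [Field k]

/-- Polynomials in the marked variable `t` over the polynomials in the `p_i`. -/
abbrev Marked (k : Type*) [Field k] : Type _ := Polynomial (MvPolynomial ℕ k)

/-- `p_n` for `n ≥ 1`, and `0` for `n = 0`. -/
def theta (n : ℕ) : MvPolynomial ℕ k := if n = 0 then 0 else X n

@[simp]
theorem theta_zero : (theta 0 : MvPolynomial ℕ k) = 0 := if_pos rfl

theorem theta_of_ne {n : ℕ} (h : n ≠ 0) : (theta n : MvPolynomial ℕ k) = X n := if_neg h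

/-- The operator `Θ_Y`, that is `t ^ n f ↦ p_n f`. -/
def contract : Marked k →ₗ[MvPolynomial ℕ k] MvPolynomial ℕ k :=
  Polynomial.lsum fun n => LinearMap.toSpanSingleton _ _ (theta n)

theorem contract_X_pow_mul (n : ℕ) (f : MvPolynomial ℕ k) :
    contract (Polynomial.X ^ n * Polynomial.C f) = theta n * f := by
  rw [mul_comm, Polynomial.C_mul_X_pow_eq_monomial]
  simp [contract, mul_comm]

theorem contract_X_pow (n : ℕ) : contract (Polynomial.X ^ n : Marked k) = theta n := by
  simpa using contract_X_pow_mul n (1 : MvPolynomial ℕ k)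

theorem contract_C_mul (f : MvPolynomial ℕ k) (μ : Marked k) :
    contract (Polynomial.C f * μ) = f * contract μ := by
  rw [← Polynomial.smul_eq_C_mul, map_smul, smul_eq_mul]

theorem contract_C (f : MvPolynomial ℕ k) : contract (Polynomial.C f) = 0 := by
  simpa using contract_X_pow_mul 0 f

/-- The derivation `f ↦ ∑ i, i t ^ i ∂f/∂p_i`. -/
def mark : Derivation k (MvPolynomial ℕ k) (Marked k) :=
  mkDerivation k fun n => (n : Marked k) * Polynomial.X ^ n

theorem mark_X (n : ℕ) : mark (X n : MvPolynomial ℕ k) =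
    (n : Marked k) * Polynomial.X ^ n :=
  mkDerivation_X _ _ _

theorem mark_theta (n : ℕ) : mark (theta n : MvPolynomial ℕ k) =
    (n : Marked k) * Polynomial.X ^ n := by
  rcases eq_or_ne n 0 with rfl | h
  · simp
  · rw [theta_of_ne h, mark_X]

theorem mark_mul (f g : MvPolynomial ℕ k) :
    mark (f * g) = Polynomial.C f * mark g + Polynomial.C g * mark f := by
  rw [Derivation.leibniz, Polynomial.smul_eq_C_mul, Polynomial.smul_eq_C_mul]

theorem mark_X_mul (n : ℕ) (f : MvPolynomial ℕ k) :
    mark (X n * f) = Polynomial.C (X n) * mark f + (n : Marked k) * (Polynomial.X ^ n * Polynomial.C f) := by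
  rw [mark_mul, mark_X]; ring

/-- `∑ t ^ i p_j` over `i + j = n`, `j ≥ 1`. -/
def cut (n : ℕ) : Marked k :=
  ∑ x ∈ Finset.HasAntidiagonal.antidiagonal n, Polynomial.X ^ x.1 * Polynomial.C (theta x.2)

/-- `∑ i t ^ i p_j` over `i + j = n`, `j ≥ 1`. -/
def wcut (n : ℕ) : Marked k :=
  ∑ x ∈ Finset.HasAntidiagonal.antidiagonal n,
    (x.1 : Marked k) * (Polynomial.X ^ x.1 * Polynomial.C (theta x.2))

@[simp]
theorem cut_zero : (cut 0 : Marked k) = 0 := by simp [cut]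

@[simp]
theorem wcut_zero : (wcut 0 : Marked k) = 0 := by simp [wcut]

theorem cut_succ (n : ℕ) : (cut (n + 1) : Marked k) =
    Polynomial.C (theta (n + 1)) + Polynomial.X * cut n := by
  rw [cut, Finset.Nat.sum_antidiagonal_succ, cut, Finset.mul_sum]
  simp [pow_succ', mul_assoc]

theorem wcut_succ (n : ℕ) : (wcut (n + 1) : Marked k) =
    Polynomial.X * wcut n + Polynomial.X * cut n := by
  rw [wcut, Finset.Nat.sum_antidiagonal_succ, wcut, cut, Finset.mul_sum, Finset.mul_sum,
    ← Finset.sum_add_distrib]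
  simp only [Nat.cast_zero, zero_mul, zero_add]
  refine Finset.sum_congr rfl fun x _ => ?_
  push_cast
  ring

theorem contract_cut (n : ℕ) : contract (cut n : Marked k) =
    ∑ x ∈ Finset.HasAntidiagonal.antidiagonal n, theta x.1 * theta x.2 := by
  simp only [cut, map_sum, contract_X_pow_mul]

theorem contract_natCast_mul (n : ℕ) (μ : Marked k) :
    contract ((n : Marked k) * μ) = (n : MvPolynomial ℕ k) * contract μ := by
  simp [← nsmul_eq_mul]

theorem two_mul_contract_wcut (n : ℕ) : 2 * contract (wcut n : Marked k) =
    (n : MvPolynomial ℕ k) * contract (cut n) := by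
  have h : contract (wcut n : Marked k) =
      ∑ x ∈ Finset.HasAntidiagonal.antidiagonal n, (x.1 : MvPolynomial ℕ k) * (theta x.1 * theta x.2) := by
    simp only [wcut, map_sum, contract_natCast_mul, contract_X_pow_mul]
  have h' : contract (wcut n : Marked k) =
      ∑ x ∈ Finset.HasAntidiagonal.antidiagonal n, (x.2 : MvPolynomial ℕ k) * (theta x.1 * theta x.2) := by
    rw [h, ← Finset.Nat.sum_antidiagonal_swap]
    exact Finset.sum_congr rfl fun x _ => by simp only [Prod.fst_swap, Prod.snd_swap]; ring
  rw [two_mul]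
  nth_rewrite 1 [h]
  rw [h', ← Finset.sum_add_distrib, contract_cut, Finset.mul_sum]
  refine Finset.sum_congr rfl fun x hx => ?_
  rw [← Finset.HasAntidiagonal.mem_antidiagonal.1 hx]
  push_cast
  ring

theorem mark_contract_cut (n : ℕ) :
    mark (contract (cut n : Marked k)) = 2 * wcut n := by
  have h : ∑ x ∈ Finset.HasAntidiagonal.antidiagonal n, Polynomial.C (theta x.1) *
      ((x.2 : Marked k) * Polynomial.X ^ x.2) = wcut n := by
    rw [← Finset.Nat.sum_antidiagonal_swap, wcut]
    exact Finset.sum_congr rfl fun x _ => by simp only [Prod.fst_swap, Prod.snd_swap]; ring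
  rw [contract_cut, map_sum]
  simp only [mark_mul, mark_theta]
  rw [Finset.sum_add_distrib, h, two_mul, add_right_inj, wcut]
  exact Finset.sum_congr rfl fun x _ => by ring

theorem marked_induction {p : Marked k → Prop} (μ : Marked k)
    (add : ∀ μ ν, p μ → p ν → p (μ + ν))
    (X_pow_mul_C : ∀ n f, p (Polynomial.X ^ n * Polynomial.C f)) : p μ := by
  induction μ using Polynomial.induction_on' with
  | add μ ν hμ hν => exact add μ ν hμ hν
  | monomial n f =>
    rw [← Polynomial.C_mul_X_pow_eq_monomial, mul_comm]
    exact X_pow_mul_C n f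

theorem lsum_X_pow_mul_C {N : Type*} [AddCommMonoid N] [Module k N]
    (g : ℕ → MvPolynomial ℕ k →ₗ[k] N) (n : ℕ) (f : MvPolynomial ℕ k) :
    Polynomial.lsum g (Polynomial.X ^ n * Polynomial.C f) = g n f := by
  rw [mul_comm, Polynomial.C_mul_X_pow_eq_monomial, Polynomial.lsum_apply,
    Polynomial.sum_monomial_index _ _ (LinearMap.map_zero (g n))]

variable (a b : k)

/-- A scalar viewed as a constant of `MvPolynomial ℕ k [t]`. -/
abbrev cst (c : k) : Marked k := Polynomial.C (C c)

theorem smul_eq_cst_mul (c : k) (μ : Marked k) : c • μ = cst c * μ := by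
  rw [Algebra.smul_def]; rfl

/-- The inclusion `f ↦ y_0 f`. -/
def incl : MvPolynomial ℕ k →ₗ[k] Marked k :=
  (Polynomial.CAlgHom : MvPolynomial ℕ k →ₐ[k] _).toLinearMap

@[simp]
theorem incl_apply (f : MvPolynomial ℕ k) : incl f = Polynomial.C f := rfl

/-- The operator `Λ_Y`. -/
def lam : Module.End k (Marked k) :=
  Polynomial.lsum fun n =>
    LinearMap.mulLeft k (cst a * Polynomial.X ^ n) ∘ₗ (mark : Derivation k _ _).toLinearMap +
      LinearMap.mulLeft k (cut n + cst b * (n : Marked k) * Polynomial.X ^ n) ∘ₗ incl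

theorem lam_apply (n : ℕ) (f : MvPolynomial ℕ k) :
    lam a b (Polynomial.X ^ n * Polynomial.C f) = cst a * Polynomial.X ^ n * mark f +
      cut n * Polynomial.C f + cst b * (n : Marked k) * (Polynomial.X ^ n * Polynomial.C f) := by
  rw [lam, lsum_X_pow_mul_C]
  simp only [LinearMap.add_apply, LinearMap.comp_apply, LinearMap.mulLeft_apply, incl_apply,
    Derivation.coeFn_coe]
  ring

theorem lam_C (f : MvPolynomial ℕ k) : lam a b (Polynomial.C f) = cst a * mark f := by
  simpa using lam_apply a b 0 f

theorem lam_X_mul (m : ℕ) (μ : Marked k) :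
    lam a b (Polynomial.C (X m) * μ) =
      Polynomial.C (X m) * lam a b μ + cst a * (m : Marked k) * Polynomial.X ^ m * μ := by
  induction μ using marked_induction with
  | add μ ν hμ hν => simp only [mul_add, map_add, hμ, hν]; ring
  | X_pow_mul_C n f =>
    rw [mul_left_comm, ← map_mul, lam_apply, lam_apply, mark_X_mul, map_mul]
    ring

theorem lam_shift (μ : Marked k) :
    lam a b (Polynomial.X * μ) = Polynomial.X * lam a b μ +
      Polynomial.C (contract (Polynomial.X * μ)) + cst b * (Polynomial.X * μ) := by
  induction μ using marked_induction with
  | add μ ν hμ hν => simp only [mul_add, map_add, hμ, hν]; ring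
  | X_pow_mul_C n f =>
    rw [← mul_assoc, ← pow_succ', lam_apply, lam_apply, cut_succ, contract_X_pow_mul]
    push_cast
    simp only [map_mul]
    ring

/-- The Laplace–Beltrami operator `D_α`. -/
def lapl : Module.End k (MvPolynomial ℕ k) :=
  (2 : k)⁻¹ • (contract.restrictScalars k ∘ₗ (lam a b - LinearMap.mulLeft k (cst b)) ∘ₗ
    (mark : Derivation k _ _).toLinearMap)

theorem lapl_apply (f : MvPolynomial ℕ k) :
    lapl a b f = C 2⁻¹ * (contract (lam a b (mark f)) - C b * contract (mark f)) := by
  simp [lapl, contract_C_mul, smul_eq_C_mul]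

theorem lapl_one : lapl a b 1 = 0 := by simp [lapl_apply]

theorem lapl_X_mul_aux (n : ℕ) (f : MvPolynomial ℕ k) :
    lapl a b (X n * f) = X n * lapl a b f + C 2⁻¹ *
      (2 * C a * (n : MvPolynomial ℕ k) * contract (Polynomial.X ^ n * mark f) +
        (n : MvPolynomial ℕ k) * contract (cut n) * f +
        C b * (n : MvPolynomial ℕ k) * ((n : MvPolynomial ℕ k) - 1) * theta n * f) := by
  have h1 : lam a b (mark (X n * f)) = Polynomial.C (X n) * lam a b (mark f) +
      Polynomial.C (2 * C a * (n : MvPolynomial ℕ k)) * (Polynomial.X ^ n * mark f) +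
      Polynomial.C ((n : MvPolynomial ℕ k) * f) * cut n +
      Polynomial.C (C b * (n : MvPolynomial ℕ k) * (n : MvPolynomial ℕ k) * f) *
        Polynomial.X ^ n := by
    rw [mark_X_mul, map_add, lam_X_mul, ← nsmul_eq_mul, map_nsmul, lam_apply]
    simp only [nsmul_eq_mul, map_mul, map_natCast, map_ofNat]
    ring
  rw [lapl_apply, lapl_apply, h1, mark_X_mul]
  simp only [map_add, contract_C_mul, contract_natCast_mul, contract_X_pow_mul, contract_X_pow]
  ring

theorem C_two_inv_mul_two [NeZero (2 : k)] : (C (2⁻¹ : k) : MvPolynomial ℕ k) * 2 = 1 := by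
  rw [← map_ofNat C 2, ← map_mul, inv_mul_cancel₀ (NeZero.ne (2 : k)), map_one]

theorem lapl_X_mul [NeZero (2 : k)] (n : ℕ) (f : MvPolynomial ℕ k) :
    lapl a b (X n * f) = X n * lapl a b f +
      (C a * (n : MvPolynomial ℕ k) * contract (Polynomial.X ^ n * mark f) + contract (wcut n) * f +
        C (2⁻¹ * b) * (n : MvPolynomial ℕ k) * ((n : MvPolynomial ℕ k) - 1) * theta n * f) := by
  rw [lapl_X_mul_aux, map_mul C]
  linear_combination (C a * (n : MvPolynomial ℕ k) * contract (Polynomial.X ^ n * mark f) +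
    contract (wcut n) * f) * C_two_inv_mul_two (k := k) - C 2⁻¹ * f * two_mul_contract_wcut (k := k) n

theorem mark_C_mul (c : k) (f : MvPolynomial ℕ k) : mark (C c * f) = cst c * mark f := by
  rw [← smul_eq_C_mul, Derivation.map_smul, smul_eq_cst_mul]

theorem mark_natCast_mul (n : ℕ) (f : MvPolynomial ℕ k) :
    mark ((n : MvPolynomial ℕ k) * f) = (n : Marked k) * mark f := by
  rw [← nsmul_eq_mul, map_nsmul, nsmul_eq_mul]

theorem mark_lapl_X [NeZero (2 : k)] (n : ℕ) : mark (lapl a b (X n)) =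
    (n : Marked k) * (wcut n +
      cst (2⁻¹ * b) * (n : Marked k) * ((n : Marked k) - 1) * Polynomial.X ^ n) := by
  have h := congrArg mark (lapl_X_mul_aux a b n 1)
  rw [mul_one, lapl_one, mul_zero, zero_add, mark_C_mul] at h
  rw [h]
  have h2 : (cst (2⁻¹ : k) : Marked k) * 2 = 1 := by
    rw [← map_ofNat Polynomial.C 2, ← map_mul, C_two_inv_mul_two, map_one]
  have h3 : C b * (n : MvPolynomial ℕ k) * ((n : MvPolynomial ℕ k) - 1) * theta n * 1 =
      C b * ((n : MvPolynomial ℕ k) * ((n : MvPolynomial ℕ k) * theta n)) -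
        C b * ((n : MvPolynomial ℕ k) * theta n) := by ring
  rw [Derivation.map_one_eq_zero, mul_zero, map_zero, mul_zero, zero_add, h3, mul_one, map_add, map_sub]
  have h4 : (cst (2⁻¹ * b) : Marked k) = cst 2⁻¹ * cst b := by simp only [cst, map_mul]
  rw [h4]
  simp only [mark_C_mul, mark_natCast_mul, mark_theta, mark_contract_cut]
  linear_combination (n : Marked k) * wcut n * h2

theorem contract_X_pow_mark (m n : ℕ) (f : MvPolynomial ℕ k) :
    contract (Polynomial.X ^ m * mark (X n * f)) = X n * contract (Polynomial.X ^ m * mark f) +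
      (n : MvPolynomial ℕ k) * theta (m + n) * f := by
  have h : (Polynomial.X ^ m * mark (X n * f) : Marked k) =
      Polynomial.C (X n) * (Polynomial.X ^ m * mark f) +
        (n : Marked k) * (Polynomial.X ^ (m + n) * Polynomial.C f) := by
    rw [mark_X_mul, pow_add]; ring
  rw [h, map_add, contract_C_mul, contract_natCast_mul, contract_X_pow_mul, mul_assoc]

/-- `D_α` is a second order differential operator. -/
theorem lapl_X_mul_X_mul [NeZero (2 : k)] (m n : ℕ) (f : MvPolynomial ℕ k) :
    lapl a b (X m * (X n * f)) = X m * lapl a b (X n * f) + X n * lapl a b (X m * f) -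
      X m * X n * lapl a b f +
      C a * (m : MvPolynomial ℕ k) * (n : MvPolynomial ℕ k) * theta (m + n) * f := by
  rw [lapl_X_mul a b m (X n * f), lapl_X_mul a b m f, contract_X_pow_mark]
  ring

/-- The lift of `D_α` to `MvPolynomial ℕ k [t]`. -/
def lift : Module.End k (Marked k) :=
  Polynomial.lsum fun n =>
    LinearMap.mulLeft k (Polynomial.X ^ n) ∘ₗ incl ∘ₗ lapl a b +
      LinearMap.mulLeft k (cst a * (n : Marked k) * Polynomial.X ^ n) ∘ₗ
        (mark : Derivation k _ _).toLinearMap +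
      LinearMap.mulLeft k (wcut n + cst (2⁻¹ * b) * (n : Marked k) * ((n : Marked k) - 1) *
        Polynomial.X ^ n) ∘ₗ incl

theorem lift_apply (n : ℕ) (f : MvPolynomial ℕ k) :
    lift a b (Polynomial.X ^ n * Polynomial.C f) = Polynomial.X ^ n * Polynomial.C (lapl a b f) +
      cst a * (n : Marked k) * Polynomial.X ^ n * mark f + wcut n * Polynomial.C f +
      cst (2⁻¹ * b) * (n : Marked k) * ((n : Marked k) - 1) *
        (Polynomial.X ^ n * Polynomial.C f) := by
  rw [lift, lsum_X_pow_mul_C]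
  simp only [LinearMap.add_apply, LinearMap.comp_apply, LinearMap.mulLeft_apply, incl_apply,
    Derivation.coeFn_coe]
  ring

theorem lift_C (f : MvPolynomial ℕ k) :
    lift a b (Polynomial.C f) = Polynomial.C (lapl a b f) := by
  simpa using lift_apply a b 0 f

theorem lift_shift [NeZero (2 : k)] (μ : Marked k) :
    lift a b (Polynomial.X * μ) = Polynomial.X * lift a b μ + Polynomial.X * lam a b μ := by
  induction μ using marked_induction with
  | add μ ν hμ hν => simp only [mul_add, map_add, hμ, hν]; ring
  | X_pow_mul_C n f =>
    have h : (cst (2⁻¹ * b) : Marked k) * 2 = cst b := by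
      simp only [cst, map_mul]
      rw [mul_right_comm, ← map_ofNat Polynomial.C 2, ← map_mul, C_two_inv_mul_two, map_one,
        one_mul]
    rw [← mul_assoc, ← pow_succ', lift_apply, lift_apply, lam_apply, wcut_succ, ← h]
    push_cast
    ring

theorem contract_lift [NeZero (2 : k)] (μ : Marked k) :
    contract (lift a b μ) = lapl a b (contract μ) := by
  induction μ using marked_induction with
  | add μ ν hμ hν => simp only [map_add, hμ, hν]
  | X_pow_mul_C n f =>
    rw [contract_X_pow_mul]
    rcases eq_or_ne n 0 with rfl | hn
    · simp [lift_C, contract_C]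
    have h : lift a b (Polynomial.X ^ n * Polynomial.C f) =
        Polynomial.X ^ n * Polynomial.C (lapl a b f) +
        Polynomial.C (C a * (n : MvPolynomial ℕ k)) * (Polynomial.X ^ n * mark f) +
        Polynomial.C f * wcut n +
        Polynomial.C (C (2⁻¹ * b) * (n : MvPolynomial ℕ k) * ((n : MvPolynomial ℕ k) - 1)) *
          (Polynomial.X ^ n * Polynomial.C f) := by
      rw [lift_apply]
      simp only [cst, map_mul, map_natCast, map_sub, map_one]
      ring
    rw [h, theta_of_ne hn, lapl_X_mul]
    simp only [map_add, contract_C_mul, contract_X_pow_mul, theta_of_ne hn]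
    ring

theorem lift_X_mul_X_mul [NeZero (2 : k)] (m n : ℕ) (μ : Marked k) :
    lift a b (Polynomial.C (X m) * (Polynomial.C (X n) * μ)) =
      Polynomial.C (X m) * lift a b (Polynomial.C (X n) * μ) +
      Polynomial.C (X n) * lift a b (Polynomial.C (X m) * μ) -
      Polynomial.C (X m * X n) * lift a b μ +
      cst a * (m : Marked k) * (n : Marked k) * Polynomial.C (theta (m + n)) * μ := by
  induction μ using marked_induction with
  | add μ ν hμ hν => simp only [mul_add, map_add, hμ, hν]; ring
  | X_pow_mul_C i f =>
    have h (g h : MvPolynomial ℕ k) : Polynomial.C g * (Polynomial.X ^ i * Polynomial.C h) =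
        Polynomial.X ^ i * Polynomial.C (g * h) := by rw [map_mul]; ring
    simp only [h, lift_apply, lapl_X_mul_X_mul, mark_X_mul]
    simp only [map_add, map_sub, map_mul, map_natCast]
    ring

theorem lift_X_pow [NeZero (2 : k)] (m : ℕ) :
    lift a b ((m : Marked k) * Polynomial.X ^ m) = mark (lapl a b (X m)) := by
  have h : ((m : Marked k) * Polynomial.X ^ m : Marked k) =
      m • (Polynomial.X ^ m * Polynomial.C 1 : Marked k) := by simp
  rw [h, map_nsmul, lift_apply, mark_lapl_X, lapl_one, Derivation.map_one_eq_zero, nsmul_eq_mul]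
  simp only [map_one, map_zero]
  ring

theorem lift_mark_X_mul_X_mul [NeZero (2 : k)] (m n : ℕ) (f : MvPolynomial ℕ k) :
    lift a b (mark (X m * (X n * f))) - mark (lapl a b (X m * (X n * f))) =
      Polynomial.C (X m) *
        (lift a b (mark (X n * f)) - mark (lapl a b (X n * f))) +
      Polynomial.C (X n) *
        (lift a b (mark (X m * f)) - mark (lapl a b (X m * f))) -
      Polynomial.C (X m * X n) * (lift a b (mark f) - mark (lapl a b f)) := by
  have h1 : mark (X m * (X n * f)) = Polynomial.C (X m) * (Polynomial.C (X n) * mark f) +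
      n • (Polynomial.X ^ n * Polynomial.C (X m * f) : Marked k) +
      m • (Polynomial.X ^ m * Polynomial.C (X n * f) : Marked k) := by
    simp only [mark_X_mul, nsmul_eq_mul, map_mul]; ring
  have h2 (i : ℕ) : mark (X i * f) = Polynomial.C (X i) * mark f +
      i • (Polynomial.X ^ i * Polynomial.C f : Marked k) := by
    simp only [mark_X_mul, nsmul_eq_mul]
  have h3 : mark (C a * (m : MvPolynomial ℕ k) * (n : MvPolynomial ℕ k) * theta (m + n) * f) =
      cst a * (m : Marked k) * (n : Marked k) * (Polynomial.C f *
        (((m + n : ℕ) : Marked k) * Polynomial.X ^ (m + n)) +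
        Polynomial.C (theta (m + n)) * mark f) := by
    rw [mul_assoc, mul_assoc, mul_assoc, mark_C_mul, mark_natCast_mul, mark_natCast_mul, mark_mul,
      mark_theta]
    ring
  rw [h1, lapl_X_mul_X_mul, map_add, map_add, lift_X_mul_X_mul, map_nsmul, map_nsmul, lift_apply,
    lift_apply, map_add, map_sub, map_add, h3, mul_assoc (X m) (X n) (lapl a b f),
    mark_X_mul m (lapl a b (X n * f)), mark_X_mul n (lapl a b (X m * f)),
    mark_X_mul m (X n * lapl a b f), mark_X_mul n (lapl a b f)]
  have h4 (i : ℕ) : lift a b (Polynomial.C (X i) * mark f) = lift a b (mark (X i * f)) -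
     i • lift a b (Polynomial.X ^ i * Polynomial.C f : Marked k) := by
    rw [h2, map_add, map_nsmul]; ring
  rw [h4 m, h4 n, lift_apply, lift_apply, h2, h2]
  simp only [nsmul_eq_mul, map_mul]
  push_cast
  ring

theorem lift_mark [NeZero (2 : k)] (f : MvPolynomial ℕ k) :
    lift a b (mark f) = mark (lapl a b f) := by
  set F : MvPolynomial ℕ k →ₗ[k] Marked k :=
    lift a b ∘ₗ (mark : Derivation k _ _).toLinearMap -
      (mark : Derivation k _ _).toLinearMap ∘ₗ lapl a b with hF
  have hF' (g) : F g = lift a b (mark g) - mark (lapl a b g) := rfl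
  suffices h : F f = 0 ∧ ∀ m, F (X m * f) = 0 from sub_eq_zero.1 (hF' f ▸ h.1)
  induction f using MvPolynomial.induction_on with
  | C c =>
    have h (g) : F (C c * g) = c • F g := by rw [← smul_eq_C_mul, map_smul]
    constructor
    · rw [← mul_one (C c), h, hF', lapl_one]
      simp
    · intro m
      rw [mul_comm, h, hF', mark_X, lift_X_pow, sub_self, smul_zero]
  | add f g hf hg =>
    exact ⟨by rw [map_add, hf.1, hg.1, add_zero],
      fun m => by rw [mul_add, map_add, hf.2, hg.2, add_zero]⟩
  | mul_X f n hf =>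
    refine ⟨by rw [mul_comm, hf.2], fun m => ?_⟩
    rw [mul_comm f, hF', lift_mark_X_mul_X_mul, ← hF', ← hF', ← hF', hf.1, hf.2, hf.2]
    simp

theorem lift_lam [NeZero (2 : k)] (μ : Marked k) :
    lift a b (lam a b μ) = lam a b (lift a b μ) := by
  induction μ using marked_induction with
  | add μ ν hμ hν => simp only [map_add, hμ, hν]
  | X_pow_mul_C n f =>
    induction n with
    | zero =>
      rw [pow_zero, one_mul, lam_C, lift_C, lam_C, ← smul_eq_cst_mul, map_smul, lift_mark,
        smul_eq_cst_mul]
    | succ n ih =>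
      rw [pow_succ', mul_assoc]
      generalize (Polynomial.X ^ n * Polynomial.C f : Marked k) = μ at ih
      rw [lam_shift, lift_shift, map_add, map_add, map_add, lift_shift, lift_C,
        ← smul_eq_cst_mul b, map_smul, lift_shift, lam_shift, lam_shift, ← contract_lift, lift_shift,
        map_add, map_add, ih, smul_eq_cst_mul]
      ring

theorem lam_one_shift (μ : Marked k) :
    lam a b (Polynomial.C (X 1) * μ) =
      Polynomial.C (X 1) * lam a b μ + cst a * (Polynomial.X * μ) := by
  simpa [mul_assoc] using lam_X_mul a b 1 μ

/-! ### The operators `A_{j+1}`, `B_m` and `Ω` -/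

open scoped Polynomial

/-- The operator `Y_+`. -/
def shift : Module.End k (Marked k) := LinearMap.mulLeft k Polynomial.X

@[simp]
theorem shift_apply (μ : Marked k) : shift μ = Polynomial.X * μ := rfl

/-- Multiplication by `a⁻¹ p_1`. -/
def mulP : Module.End k (Marked k) := a⁻¹ • LinearMap.mulLeft k (Polynomial.C (X 1))

theorem mulP_apply (μ : Marked k) : mulP a μ = a⁻¹ • (Polynomial.C (X 1) * μ) := rfl

/-- The operator `f ↦ a⁻¹ Θ_Y (T (y_0 f))`. -/
def compress (T : Module.End k (Marked k)) : Module.End k (MvPolynomial ℕ k) :=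
  a⁻¹ • (contract.restrictScalars k ∘ₗ T ∘ₗ incl)

theorem compress_apply (T : Module.End k (Marked k)) (f : MvPolynomial ℕ k) :
    compress a T f = a⁻¹ • contract (T (Polynomial.C f)) := rfl

theorem lift_mul_lam [NeZero (2 : k)] : lift a b * lam a b = lam a b * lift a b :=
  LinearMap.ext fun μ => lift_lam a b μ

theorem lift_mul_shift [NeZero (2 : k)] :
    lift a b * shift = shift * lift a b + shift * lam a b :=
  LinearMap.ext fun μ => lift_shift a b μ

theorem lam_mul_mulP (ha : a ≠ 0) : lam a b * mulP a = mulP a * lam a b + shift := by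
  refine LinearMap.ext fun μ => ?_
  have h : a⁻¹ • (cst a * (Polynomial.X * μ)) = Polynomial.X * μ := by
    rw [← smul_eq_cst_mul, inv_smul_smul₀ ha]
  simp only [Module.End.mul_apply, LinearMap.add_apply, mulP_apply, map_smul, lam_one_shift,
    smul_add, h, shift_apply]

theorem shift_mul_mulP : shift * mulP a = mulP a * (shift : Module.End k (Marked k)) := by
  refine LinearMap.ext fun μ => ?_
  simp only [Module.End.mul_apply, mulP_apply, shift_apply, mul_smul_comm]
  rw [mul_left_comm]

theorem compress_shift_aeval_X_mul [NeZero (2 : k)] (q : k[X]) :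
    compress a (shift * Polynomial.aeval (lam a b) (Polynomial.X * q)) =
      lapl a b * compress a (shift * Polynomial.aeval (lam a b) q) -
        compress a (shift * Polynomial.aeval (lam a b) q) * lapl a b := by
  have h := LaxRing.D_mul_Y_aeval (S := Module.End k (Marked k)) (lift_mul_lam a b) (lift_mul_shift a b) q
  refine LinearMap.ext fun f => ?_
  have h' := LinearMap.congr_fun h (Polynomial.C f)
  simp only [Module.End.mul_apply, LinearMap.add_apply, lift_C] at h'
  simp only [LinearMap.sub_apply, Module.End.mul_apply, compress_apply, map_smul, ← contract_lift, h',
    ← smul_sub, map_add, add_sub_cancel_left, mul_comm Polynomial.X q, map_mul, Polynomial.aeval_X]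

theorem compress_shift_aeval_one (f : MvPolynomial ℕ k) :
    compress a (shift * Polynomial.aeval (lam a b) (1 : k[X])) f = a⁻¹ • (X 1 * f) := by
  have h := contract_X_pow_mul 1 f
  rw [pow_one, theta_of_ne one_ne_zero] at h
  rw [map_one, mul_one, compress_apply, shift_apply, h]

theorem compress_shift_lam_pow [NeZero (2 : k)] (n : ℕ) :
    compress a (shift * lam a b ^ n) = LaxRing.adSeq (lapl a b) (compress a shift) n := by
  induction n with
  | zero => simp [LaxRing.adSeq]
  | succ n ih =>
    have h := compress_shift_aeval_X_mul a b (Polynomial.X ^ n)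
    rw [← pow_succ'] at h
    simpa [LaxRing.adSeq, ih] using h

theorem X_induction {p : k[X] → Prop} (q : k[X]) (one : p 1)
    (X_mul : ∀ q, p q → p (Polynomial.X * q)) (add : ∀ q r, p q → p r → p (q + r))
    (smul : ∀ (c : k) q, p q → p (c • q)) : p q := by
  induction q using Polynomial.induction_on' with
  | add q r hq hr => exact add q r hq hr
  | monomial n c =>
    rw [← mul_one c, ← smul_eq_mul, ← Polynomial.smul_monomial]
    refine smul c _ ?_
    rw [Polynomial.monomial_one_right_eq_X_pow]
    induction n with
    | zero => rwa [pow_zero]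
    | succ n ih => rw [pow_succ']; exact X_mul _ ih

theorem adPoly_one (D e : Module.End k (Marked k)) :
    LaxRing.adPoly D e (1 : k[X]) = e := by
  rw [← Polynomial.monomial_zero_one, LaxRing.adPoly_monomial, one_smul]
  rfl

theorem adPoly_mulP_C [NeZero (2 : k)] (q : k[X]) (f : MvPolynomial ℕ k) :
    LaxRing.adPoly (lift a b) (mulP a) q (Polynomial.C f) =
      Polynomial.C (compress a (shift * Polynomial.aeval (lam a b) q) f) := by
  induction q using X_induction generalizing f with
  | one =>
    rw [adPoly_one, compress_shift_aeval_one, mulP_apply, ← map_mul, smul_eq_cst_mul,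
      ← map_mul, ← smul_eq_C_mul]
  | X_mul q ih =>
    rw [LaxRing.adPoly_X_mul, compress_shift_aeval_X_mul]
    simp only [LinearMap.sub_apply, Module.End.mul_apply, ih, lift_C, map_sub]
  | add q r hq hr =>
    simp only [map_add, mul_add, LinearMap.add_apply, compress_apply, smul_add] at hq hr ⊢
    rw [hq, hr]
  | smul c q ih =>
    simp only [map_smul, mul_smul_comm, LinearMap.smul_apply, compress_apply,
      LinearMap.map_smul_of_tower] at ih ⊢
    rw [ih, smul_comm a⁻¹ c, smul_eq_cst_mul c, ← map_mul, ← smul_eq_C_mul]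

theorem contract_adPoly_mulP [NeZero (2 : k)] (q : k[X]) (μ : Marked k) :
    contract (LaxRing.adPoly (lift a b) (mulP a) q μ) =
      compress a (shift * Polynomial.aeval (lam a b) q) (contract μ) := by
  induction q using X_induction generalizing μ with
  | one =>
    rw [adPoly_one, compress_shift_aeval_one, mulP_apply, LinearMap.map_smul_of_tower, contract_C_mul]
  | X_mul q ih =>
    rw [LaxRing.adPoly_X_mul, compress_shift_aeval_X_mul]
    simp only [LinearMap.sub_apply, Module.End.mul_apply, ih, contract_lift, map_sub]
  | add q r hq hr =>
    simp only [map_add, mul_add, LinearMap.add_apply, compress_apply, smul_add] at hq hr ⊢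
    rw [hq, hr]
  | smul c q ih =>
    simp only [map_smul, mul_smul_comm, LinearMap.smul_apply, compress_apply,
      LinearMap.map_smul_of_tower] at ih ⊢
    rw [ih, smul_comm c]

theorem mul_pow_of_commutator {S : Type*} [Ring S] {D W : S} (h : D * W = W * D + W ^ 2) (n : ℕ) :
    D * W ^ n = W ^ n * D + n * W ^ (n + 1) := by
  induction n with
  | zero => simp
  | succ n ih =>
    have hc : (n : S) * W ^ (n + 1) = W ^ (n + 1) * n := Nat.cast_commute n _
    have hc' : (n : S) * W ^ (n + 1 + 1) = W ^ (n + 1 + 1) * n := Nat.cast_commute n _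
    push_cast
    rw [add_mul, hc']
    rw [hc] at ih
    have h2 : W * (n : S) = n * W := (Nat.cast_commute n _).symm
    simp only [pow_succ] at ih ⊢
    linear_combination (norm := noncomm_ring) ih * W + W ^ n * h - W ^ n * W * h2

/-- The operator `B_{j+1}`, where `Y_+ q(Λ_Y)` is the operator being iterated. -/
def opB (q : k[X]) (j : ℕ) : Module.End k (MvPolynomial ℕ k) :=
  (j.factorial : k) • compress a ((shift * Polynomial.aeval (lam a b) q) ^ (j + 1))

/-- The operator `Ω_Y`. -/
def opOmega (q : k[X]) : Module.End k (MvPolynomial ℕ k) :=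
  compress a (shift * Polynomial.aeval (lam a b) (Polynomial.X * q))

theorem opB_succ [NeZero (2 : k)] (ha : a ≠ 0) (q : k[X]) (j : ℕ) :
    opB a b q (j + 1) = opOmega a b q * opB a b q j - opB a b q j * opOmega a b q := by
  have h := mul_pow_of_commutator (LaxRing.adPoly_X_mul_commutator (S := Module.End k (Marked k))
    (lift_mul_lam a b) (lift_mul_shift a b) (lam_mul_mulP a b ha) (shift_mul_mulP a) q) (j + 1)
  refine LinearMap.ext fun f => ?_
  have h' := congrArg contract (LinearMap.congr_fun h (Polynomial.C f))
  simp only [Module.End.mul_apply, LinearMap.add_apply, map_add, contract_adPoly_mulP, adPoly_mulP_C,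
    ← nsmul_eq_mul, LinearMap.smul_apply, map_nsmul] at h'
  simp only [LinearMap.sub_apply, Module.End.mul_apply, opB, LinearMap.smul_apply, map_smul,
    opOmega]
  rw [compress_apply a (_ ^ (j + 1)) f, map_smul, h', compress_apply a _ f, compress_apply a (_ ^ (j + 1)),
    smul_add, smul_add, add_sub_cancel_left, Nat.factorial_succ, ← Nat.cast_smul_eq_nsmul k]
  simp only [smul_smul]
  congr 1
  push_cast
  ring

theorem opB_eq_adSeq [NeZero (2 : k)] (ha : a ≠ 0) (q : k[X]) (j : ℕ) :
    opB a b q j = LaxRing.adSeq (opOmega a b q) (opB a b q 0) j := by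
  induction j with
  | zero => rfl
  | succ j ih => rw [opB_succ a b ha, LaxRing.adSeq, ← ih]

end LaxModel

/-! ### Comparison with the operators on `R` -/

namespace LaxOperators

open LaxModel

theorem pderiv_comm {σ k : Type*} [CommRing k] (i j : σ) (f : MvPolynomial σ k) :
    pderiv i (pderiv j f) = pderiv j (pderiv i f) := by
  classical
  have h : ⁅(pderiv i : Derivation k (MvPolynomial σ k) _), pderiv j⁆ = 0 :=
    derivation_ext fun n => by
      rw [Derivation.commutator_apply, pderiv_X, pderiv_X, Pi.single_apply, Pi.single_apply]
      split_ifs <;> simp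
  rw [← sub_eq_zero, ← Derivation.commutator_apply, h, Derivation.zero_apply]

theorem exists_bound {σ k : Type*} [CommSemiring k] {v : ℕ → σ} (hv : Function.Injective v)
    (f : MvPolynomial σ k) : ∃ N, ∀ i, N ≤ i → pderiv (v i) f = 0 := by
  obtain ⟨N, hN⟩ := ((f.vars.finite_toSet.preimage hv.injOn).bddAbove)
  refine ⟨N + 1, fun i hi => pderiv_eq_zero_of_notMem_vars fun h => ?_⟩
  have := hN (show i ∈ v ⁻¹' _ from h)
  lia

theorem p_injective : Function.Injective Var.p := fun _ _ h => Var.p.inj h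

theorem y_injective : Function.Injective Var.y := fun _ _ h => Var.y.inj h

theorem finsum_eq_sum_range {M : Type*} [AddCommMonoid M] {F : ℕ → M} {N : ℕ}
    (h : ∀ i, N ≤ i → F i = 0) : ∑ᶠ i, F i = ∑ i ∈ Finset.range N, F i := by
  refine finsum_eq_sum_of_support_subset _ fun i hi => ?_
  rw [Finset.coe_range, Set.mem_Iio]
  by_contra! hN
  exact hi (h i hN)

theorem finsum_map_add {T : ℕ → R → R} (hadd : ∀ i f g, T i (f + g) = T i f + T i g)
    (hz : ∀ f, ∃ N, ∀ i, N ≤ i → T i f = 0) (f g : R) :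
    ∑ᶠ i, T i (f + g) = ∑ᶠ i, T i f + ∑ᶠ i, T i g := by
  obtain ⟨N, hN⟩ := hz f
  obtain ⟨N', hN'⟩ := hz g
  have h1 (i) (hi : max N N' ≤ i) : T i f = 0 := hN i (le_trans (le_max_left _ _) hi)
  have h2 (i) (hi : max N N' ≤ i) : T i g = 0 := hN' i (le_trans (le_max_right _ _) hi)
  rw [finsum_eq_sum_range h1, finsum_eq_sum_range h2, finsum_eq_sum_range (N := max N N'),
    ← Finset.sum_add_distrib]
  · exact Finset.sum_congr rfl fun i _ => hadd i f g
  · intro i hi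
    rw [hadd, h1 i hi, h2 i hi, add_zero]

theorem dP_add (i : ℕ) (f g : R) : dP i (f + g) = dP i f + dP i g := map_add _ _ _

theorem dY_add (i : ℕ) (f g : R) : dY i (f + g) = dY i f + dY i g := map_add _ _ _

theorem dP_zero (i : ℕ) : dP i 0 = 0 := map_zero _

theorem dP_dY_comm (i j : ℕ) (f : R) : dP i (dY j f) = dY j (dP i f) := pderiv_comm _ _ _

theorem dP_dP_comm (i j : ℕ) (f : R) : dP i (dP j f) = dP j (dP i f) := pderiv_comm _ _ _

theorem dY_zero (i : ℕ) : dY i 0 = 0 := map_zero _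

theorem exists_bound_dP (f : R) : ∃ N, ∀ i, N ≤ i → dP i f = 0 := exists_bound p_injective f

theorem exists_bound_dY (f : R) : ∃ N, ∀ i, N ≤ i → dY i f = 0 := exists_bound y_injective f

theorem Yplus_add (f g : R) : Yplus (f + g) = Yplus f + Yplus g := by
  refine finsum_map_add (T := fun i f => Y (i + 1) * dY i f) (fun i f g => ?_) (fun f => ?_) f g
  · simp only [dY_add, mul_add]
  · obtain ⟨N, hN⟩ := exists_bound_dY f
    exact ⟨N, fun i hi => by simp only [hN i hi, mul_zero]⟩

theorem ThetaY_add (f g : R) : ThetaY (f + g) = ThetaY f + ThetaY g := by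
  refine finsum_map_add (T := fun i f => P (i + 1) * dY (i + 1) f) (fun i f g => ?_)
    (fun f => ?_) f g
  · simp only [dY_add, mul_add]
  · obtain ⟨N, hN⟩ := exists_bound_dY f
    exact ⟨N, fun i hi => by simp only [hN (i + 1) (by lia), mul_zero]⟩

theorem LamY_add (f g : R) : LamY (f + g) = LamY f + LamY g := by
  have h1 := finsum_map_add
    (T := fun i f => ∑ᶠ j : ℕ, ((i + 1 : ℕ) : K) • (Y (i + j + 1) * dP (i + 1) (dY j f)))
    (fun i => finsum_map_add
      (T := fun j f => ((i + 1 : ℕ) : K) • (Y (i + j + 1) * dP (i + 1) (dY j f)))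
      (fun j f g => by simp only [dY_add, dP_add, mul_add, smul_add])
      (fun f => by
        obtain ⟨N, hN⟩ := exists_bound_dY f
        exact ⟨N, fun j hj => by simp only [hN j hj, dP_zero, mul_zero, smul_zero]⟩))
    (fun f => by
      obtain ⟨N, hN⟩ := exists_bound_dP f
      exact ⟨N, fun i hi => by
        simp only [dP_dY_comm, hN (i + 1) (by lia), dY_zero, mul_zero, smul_zero, finsum_zero]⟩) f g
  have h2 := finsum_map_add (T := fun i f => ∑ᶠ j : ℕ, Y i * P (j + 1) * dY (i + j + 1) f)
    (fun i => finsum_map_add (T := fun j f => Y i * P (j + 1) * dY (i + j + 1) f)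
      (fun j f g => by simp only [dY_add, mul_add])
      (fun f => by
        obtain ⟨N, hN⟩ := exists_bound_dY f
        exact ⟨N, fun j hj => by simp only [hN (i + j + 1) (by lia), mul_zero]⟩))
    (fun f => by
      obtain ⟨N, hN⟩ := exists_bound_dY f
      exact ⟨N, fun i hi => finsum_eq_zero_of_forall_eq_zero fun j => by
        rw [hN (i + j + 1) (by lia), mul_zero]⟩) f g
  have h3 := finsum_map_add (T := fun i f => ((i + 1 : ℕ) : K) • (Y (i + 1) * dY (i + 1) f))
    (fun j f g => by simp only [dY_add, mul_add, smul_add])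
    (fun f => by
      obtain ⟨N, hN⟩ := exists_bound_dY f
      exact ⟨N, fun i hi => by simp only [hN (i + 1) (by lia), mul_zero, smul_zero]⟩) f g
  simp only [LamY]
  rw [h1, h2, h3]
  simp only [smul_add]
  abel

/-- The inclusion of the polynomials in the `p_i` into `R`. -/
def inclP : MvPolynomial ℕ K →ₐ[K] R := rename Var.p

/-- The map `t ^ n f ↦ y_n f`. -/
def inclY : Marked K →ₗ[K] R :=
  Polynomial.lsum fun n => LinearMap.mulLeft K (Y n) ∘ₗ inclP.toLinearMap

theorem inclY_X_pow_mul_C (n : ℕ) (f : MvPolynomial ℕ K) :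
    inclY (Polynomial.X ^ n * Polynomial.C f) = Y n * inclP f := by
  rw [inclY, lsum_X_pow_mul_C]; rfl

theorem inclP_X (n : ℕ) : inclP (X n) = P n := rename_X _ _

theorem inclY_mul_C (μ : Marked K) (f : MvPolynomial ℕ K) :
    inclY (μ * Polynomial.C f) = inclY μ * inclP f := by
  induction μ using marked_induction with
  | add μ ν hμ hν => simp only [add_mul, map_add, hμ, hν]
  | X_pow_mul_C n g =>
    rw [mul_assoc, ← map_mul, inclY_X_pow_mul_C, inclY_X_pow_mul_C, map_mul, mul_assoc]

theorem dY_inclP (i : ℕ) (f : MvPolynomial ℕ K) : dY i (inclP f) = 0 := by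
  refine pderiv_eq_zero_of_notMem_vars fun h => ?_
  have := vars_rename Var.p f h
  simp at this

theorem dP_inclP (i : ℕ) (f : MvPolynomial ℕ K) : dP i (inclP f) = inclP (pderiv i f) :=
  pderiv_rename p_injective i f

theorem dY_Y_mul (i n : ℕ) (f : MvPolynomial ℕ K) :
    dY i (Y n * inclP f) = if i = n then inclP f else 0 := by
  have h : dY i (Y n * inclP f) = Y n * dY i (inclP f) + inclP f * pderiv (Var.y i) (Y n) :=
    Derivation.leibniz _ _ _
  rw [h, dY_inclP, Y, pderiv_X, Pi.single_apply]
  split_ifs with h1 h2 h2 <;> simp_all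

theorem exists_mark_eq (f : MvPolynomial ℕ K) : ∃ N, ∀ M, N ≤ M →
    (∀ i, M ≤ i → pderiv i f = 0) ∧ mark f = ∑ i ∈ Finset.range M,
      ((i + 1 : ℕ) : K) • (Polynomial.X ^ (i + 1) * Polynomial.C (pderiv (i + 1) f) : Marked K) := by
  refine ⟨f.vars.sup id + 1, fun M hM => ?_⟩
  have hlt {i} (hi : i ∈ f.vars) : i < M :=
    lt_of_lt_of_le (Nat.lt_succ_of_le (Finset.le_sup (f := id) hi)) hM
  refine ⟨fun i hi => pderiv_eq_zero_of_notMem_vars fun h => (hlt h).not_ge hi, ?_⟩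
  set D : Derivation K (MvPolynomial ℕ K) (Marked K) := ∑ i ∈ Finset.range M,
    (LinearMap.toSpanSingleton (MvPolynomial ℕ K) (Marked K)
      (((i + 1 : ℕ) : K) • Polynomial.X ^ (i + 1))).compDer (pderiv (i + 1)) with hD
  have hDf (g) : D g = ∑ i ∈ Finset.range M,
      ((i + 1 : ℕ) : K) • (Polynomial.X ^ (i + 1) * Polynomial.C (pderiv (i + 1) g) : Marked K) := by
    rw [hD, ← Derivation.coeFnAddMonoidHom_apply, map_sum, Finset.sum_apply]
    refine Finset.sum_congr rfl fun i _ => ?_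
    change pderiv (i + 1) g • (((i + 1 : ℕ) : K) • Polynomial.X ^ (i + 1) : Marked K) = _
    rw [smul_comm, Polynomial.smul_eq_C_mul, mul_comm (Polynomial.C _)]
  rw [← hDf]
  refine derivation_eq_of_forall_mem_vars fun n hn => ?_
  rw [hDf, mark_X]
  rcases n with _ | n
  · simp [pderiv_X]
  · rw [Finset.sum_eq_single n]
    · simp [Algebra.smul_def]
    · intro i _ hi
      simp [pderiv_X, hi.symm]
    · intro h
      exact absurd (hlt hn) (by simp at h; lia)

theorem Yplus_inclY (μ : Marked K) : Yplus (inclY μ) = inclY (Polynomial.X * μ) := by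
  induction μ using marked_induction with
  | add μ ν hμ hν => simp only [mul_add, map_add, Yplus_add, hμ, hν]
  | X_pow_mul_C n f =>
    rw [← mul_assoc, ← pow_succ', inclY_X_pow_mul_C, inclY_X_pow_mul_C, Yplus,
      finsum_eq_single _ n fun i hi => by rw [dY_Y_mul, if_neg hi, mul_zero], dY_Y_mul, if_pos rfl]

theorem ThetaY_inclY (μ : Marked K) : ThetaY (inclY μ) = inclP (contract μ) := by
  induction μ using marked_induction with
  | add μ ν hμ hν => simp only [map_add, ThetaY_add, hμ, hν]
  | X_pow_mul_C n f =>
    rw [inclY_X_pow_mul_C, contract_X_pow_mul, ThetaY]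
    rcases n with _ | n
    · simp [dY_Y_mul]
    · rw [finsum_eq_single _ n fun i hi => by rw [dY_Y_mul, if_neg (by lia), mul_zero], dY_Y_mul,
        if_pos rfl, theta_of_ne n.succ_ne_zero, map_mul, inclP_X]

theorem LamY_inclY (μ : Marked K) : LamY (inclY μ) = inclY (lam alpha bb μ) := by
  induction μ using marked_induction with
  | add μ ν hμ hν => simp only [map_add, LamY_add, hμ, hν]
  | X_pow_mul_C n f =>
    have h1 : ∑ᶠ (i : ℕ) (j : ℕ), ((i + 1 : ℕ) : K) •
        (Y (i + j + 1) * dP (i + 1) (dY j (Y n * inclP f))) =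
        inclY (Polynomial.X ^ n * mark f) := by
      obtain ⟨N, hN⟩ := exists_mark_eq f
      obtain ⟨hN, hm⟩ := hN N le_rfl
      have h (i : ℕ) : ∑ᶠ j : ℕ, ((i + 1 : ℕ) : K) •
          (Y (i + j + 1) * dP (i + 1) (dY j (Y n * inclP f))) =
          ((i + 1 : ℕ) : K) • (Y (i + n + 1) * inclP (pderiv (i + 1) f)) := by
        rw [finsum_eq_single _ n fun j hj => by
          rw [dY_Y_mul, if_neg hj, dP_zero, mul_zero, smul_zero], dY_Y_mul, if_pos rfl, dP_inclP]
      simp only [h]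
      rw [finsum_eq_sum_range (N := N) fun i hi => by
        rw [hN (i + 1) (by lia), map_zero, mul_zero, smul_zero], hm, Finset.mul_sum, map_sum]
      refine Finset.sum_congr rfl fun i _ => ?_
      rw [mul_smul_comm, ← mul_assoc, ← pow_add, map_smul, inclY_X_pow_mul_C,
        show n + (i + 1) = i + n + 1 by lia]
    have h2 : ∑ᶠ (i : ℕ) (j : ℕ), Y i * P (j + 1) * dY (i + j + 1) (Y n * inclP f) =
        inclY (cut n * Polynomial.C f) := by
      rw [finsum_eq_sum_range (N := n) fun i hi => finsum_eq_zero_of_forall_eq_zero fun j => by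
        rw [dY_Y_mul, if_neg (by lia), mul_zero], inclY_mul_C, cut, map_sum,
        Finset.Nat.sum_antidiagonal_eq_sum_range_succ
          (fun i j => inclY (Polynomial.X ^ i * Polynomial.C (theta j))), Finset.sum_range_succ,
        Nat.sub_self, theta_zero, map_zero, mul_zero, map_zero, add_zero, Finset.sum_mul]
      refine Finset.sum_congr rfl fun i hi => ?_
      have hi := Finset.mem_range.1 hi
      rw [finsum_eq_single _ (n - i - 1) fun j hj => by
          rw [dY_Y_mul, if_neg (by lia), mul_zero], dY_Y_mul, if_pos (by lia),
        inclY_X_pow_mul_C, theta_of_ne (by lia), inclP_X, Nat.sub_add_cancel (by lia)]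
    have h3 : ∑ᶠ i : ℕ, ((i + 1 : ℕ) : K) • (Y (i + 1) * dY (i + 1) (Y n * inclP f)) =
        inclY ((n : K) • (Polynomial.X ^ n * Polynomial.C f)) := by
      rw [map_smul, inclY_X_pow_mul_C]
      rcases n with _ | n
      · simp [dY_Y_mul]
      · rw [finsum_eq_single _ n fun i hi => by
          rw [dY_Y_mul, if_neg (by lia), mul_zero, smul_zero], dY_Y_mul, if_pos rfl]
    rw [inclY_X_pow_mul_C, LamY, h1, h2, h3, ← map_smul, ← map_smul, ← map_add, ← map_add,
      lam_apply, smul_eq_cst_mul, smul_eq_cst_mul, Nat.cast_smul_eq_nsmul, nsmul_eq_mul]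
    simp only [mul_assoc]

theorem contract_X_pow_succ_mul (n : ℕ) (f : MvPolynomial ℕ K) :
    contract (Polynomial.X ^ (n + 1) * Polynomial.C f) = X (n + 1) * f := by
  rw [contract_X_pow_mul, theta_of_ne n.succ_ne_zero]

theorem sum_contract_cut_mul (c : ℕ → MvPolynomial ℕ K) {N : ℕ} (hc : ∀ i, N ≤ i → c i = 0) :
    ∑ n ∈ Finset.range N, contract (cut (n + 1)) * c (n + 1) =
      ∑ i ∈ Finset.range N, ∑ j ∈ Finset.range N,
        X (i + 1) * X (j + 1) * c (i + 1 + (j + 1)) := by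
  have h1 (n : ℕ) : contract (cut (n + 1) : Marked K) * c (n + 1) =
      ∑ k ∈ Finset.range n, X (k + 1) * X (n - 1 - k + 1) * c (n + 1) := by
    rw [contract_cut, Finset.Nat.sum_antidiagonal_eq_sum_range_succ (fun i j => theta i * theta j),
      Finset.sum_range_succ, Finset.sum_range_succ', Nat.sub_self, theta_zero, zero_mul, mul_zero,
      add_zero, add_zero, Finset.sum_mul]
    refine Finset.sum_congr rfl fun k hk => ?_
    have hk := Finset.mem_range.1 hk
    rw [theta_of_ne (by lia), theta_of_ne (by lia), show n - 1 - k + 1 = n + 1 - (k + 1) by lia]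
  simp only [h1]
  rcases N with _ | N
  · simp
  rw [Finset.sum_range_succ', Finset.range_zero, Finset.sum_empty, add_zero]
  have h2 := Finset.sum_range_diag_flip N fun i j =>
    (X (i + 1) * X (j + 1) * c (i + 1 + (j + 1)) : MvPolynomial ℕ K)
  have h3 : ∑ n ∈ Finset.range N, ∑ k ∈ Finset.range (n + 1),
      (X (k + 1) * X (n + 1 - 1 - k + 1) * c (n + 1 + 1) : MvPolynomial ℕ K) =
      ∑ n ∈ Finset.range N, ∑ k ∈ Finset.range (n + 1),
        X (k + 1) * X (n - k + 1) * c (k + 1 + (n - k + 1)) := by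
    refine Finset.sum_congr rfl fun n _ => Finset.sum_congr rfl fun k hk => ?_
    have hk := Finset.mem_range.1 hk
    rw [show k + 1 + (n - k + 1) = n + 1 + 1 by lia, Nat.add_sub_cancel]
  have h4 (i : ℕ) : ∑ j ∈ Finset.range (N + 1), X (i + 1) * X (j + 1) * c (i + 1 + (j + 1)) =
      ∑ j ∈ Finset.range (N - i), X (i + 1) * X (j + 1) * c (i + 1 + (j + 1)) := by
    refine (Finset.sum_subset (Finset.range_mono (by lia)) fun j _ hj => ?_).symm
    rw [Finset.mem_range] at hj
    rw [hc _ (by lia), mul_zero]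
  rw [h3, h2, Finset.sum_range_succ, h4 N]
  simp [h4]

theorem Dalpha_inclP (f : MvPolynomial ℕ K) :
    Dalpha (inclP f) = inclP (lapl alpha bb f) := by
  obtain ⟨N₀, hN₀⟩ := exists_mark_eq f
  choose N' hN' using fun i => exists_mark_eq (pderiv i f)
  set N := max N₀ ((Finset.range (N₀ + 1)).sup N') with hNdef
  obtain ⟨hN, hm⟩ := hN₀ N (le_max_left _ _)
  have hm' (i : ℕ) : mark (pderiv i f) = ∑ j ∈ Finset.range N, ((j + 1 : ℕ) : K) •
      (Polynomial.X ^ (j + 1) * Polynomial.C (pderiv (j + 1) (pderiv i f)) : Marked K) := by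
    rcases le_or_gt i N₀ with hi | hi
    · exact (hN' i N (le_trans (Finset.le_sup (Finset.mem_range.2 (by lia)))
        (le_max_right _ _))).2
    · simp [(hN₀ i hi.le).1 i le_rfl]
  have h1 : ∑ᶠ (i : ℕ) (j : ℕ), (((i + 1) * (j + 1) : ℕ) : K) •
        (P (i + 1 + (j + 1)) * dP (i + 1) (dP (j + 1) (inclP f))) =
      inclP (∑ i ∈ Finset.range N, ((i + 1 : ℕ) : K) •
        contract (Polynomial.X ^ (i + 1) * mark (pderiv (i + 1) f))) := by
    rw [finsum_eq_sum_range (N := N) fun i hi => finsum_eq_zero_of_forall_eq_zero fun j => by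
      rw [dP_dP_comm, dP_inclP, hN _ (by lia), map_zero, dP_zero, mul_zero, smul_zero], map_sum]
    refine Finset.sum_congr rfl fun i _ => ?_
    rw [finsum_eq_sum_range (N := N) fun j hj => by
      rw [dP_inclP, hN _ (by lia), map_zero, dP_zero, mul_zero, smul_zero], hm', Finset.mul_sum,
      map_sum, Finset.smul_sum, map_sum]
    refine Finset.sum_congr rfl fun j _ => ?_
    rw [mul_smul_comm, ← mul_assoc, ← pow_add, LinearMap.map_smul_of_tower, smul_smul, map_smul,
      ← add_assoc, contract_X_pow_succ_mul, map_mul, inclP_X, dP_inclP, dP_inclP, pderiv_comm,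
      ← Nat.cast_mul]
  have h2 : ∑ᶠ (i : ℕ) (j : ℕ), (((i + 1) + (j + 1) : ℕ) : K) •
        (P (i + 1) * P (j + 1) * dP (i + 1 + (j + 1)) (inclP f)) =
      inclP (∑ n ∈ Finset.range N, ((n + 1 : ℕ) : K) •
        (contract (cut (n + 1)) * pderiv (n + 1) f)) := by
    have h := sum_contract_cut_mul (fun n => (n : K) • pderiv n f) (N := N)
      fun i hi => by simp only [hN i hi, smul_zero]
    simp only [mul_smul_comm] at h
    rw [h, finsum_eq_sum_range (N := N) fun i hi => finsum_eq_zero_of_forall_eq_zero fun j => by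
      rw [dP_inclP, hN _ (by lia), map_zero, mul_zero, smul_zero], map_sum]
    refine Finset.sum_congr rfl fun i _ => ?_
    rw [finsum_eq_sum_range (N := N) fun j hj => by
      rw [dP_inclP, hN _ (by lia), map_zero, mul_zero, smul_zero], map_sum]
    refine Finset.sum_congr rfl fun j _ => ?_
    rw [map_smul, map_mul, map_mul, inclP_X, inclP_X, dP_inclP]
  have h3 : ∑ᶠ i : ℕ, (((i + 1) * i : ℕ) : K) • (P (i + 1) * dP (i + 1) (inclP f)) =
      inclP (∑ i ∈ Finset.range N, (((i + 1) * i : ℕ) : K) • (X (i + 1) * pderiv (i + 1) f)) := by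
    rw [finsum_eq_sum_range (N := N) fun i hi => by
      rw [dP_inclP, hN _ (by lia), map_zero, mul_zero, smul_zero], map_sum]
    refine Finset.sum_congr rfl fun i _ => ?_
    rw [map_smul, map_mul, inclP_X, dP_inclP]
  rw [Dalpha, h1, h2, h3, ← map_smul, ← map_smul, ← map_add, ← map_add, ← map_smul, lapl_apply,
    ← smul_eq_C_mul, ← smul_eq_C_mul, hm]
  congr 2
  simp only [map_sum, Finset.smul_sum]
  rw [← Finset.sum_add_distrib, ← Finset.sum_add_distrib, ← Finset.sum_sub_distrib]
  refine Finset.sum_congr rfl fun i _ => ?_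
  have h4 : lam alpha bb (Polynomial.X ^ (i + 1) * Polynomial.C (pderiv (i + 1) f)) =
      Polynomial.C (C alpha) * (Polynomial.X ^ (i + 1) * mark (pderiv (i + 1) f)) +
        Polynomial.C (pderiv (i + 1) f) * cut (i + 1) +
      Polynomial.C (C (bb * (i + 1 : ℕ))) *
        (Polynomial.X ^ (i + 1) * Polynomial.C (pderiv (i + 1) f)) := by
    rw [lam_apply]
    simp only [cst, map_mul, map_natCast]
    ring
  rw [map_smul, LinearMap.map_smul_of_tower, LinearMap.map_smul_of_tower, h4, map_add, map_add,
    contract_C_mul, contract_C_mul, contract_C_mul, contract_X_pow_succ_mul]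
  simp only [smul_eq_C_mul, map_mul]
  push_cast
  simp only [map_mul, map_add, map_one, map_natCast]
  ring

/-- The polynomial `(x + u_1) ⋯ (x + u_k)`. -/
def shiftPoly {k : ℕ} (u : Fin k → K) : Polynomial K :=
  ((List.ofFn u).map fun c => Polynomial.X + Polynomial.C c).prod

theorem foldr_Lu_inclY (l : List K) (μ : Marked K) :
    (l.map Lu).foldr (fun g h => g ∘ h) id (inclY μ) = inclY (Polynomial.aeval (lam alpha bb)
      (l.map fun c => Polynomial.X + Polynomial.C c).prod μ) := by
  induction l with
  | nil => simp
  | cons c l ih =>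
    have h : Polynomial.aeval (lam alpha bb) (Polynomial.X + Polynomial.C c) =
        lam alpha bb + algebraMap K _ c := by
      rw [map_add, Polynomial.aeval_X, Polynomial.aeval_C]
    rw [List.map_cons, List.foldr_cons, Function.comp_apply, ih, Lu, LamY_inclY, ← map_smul,
      ← map_add, List.map_cons, List.prod_cons, map_mul, h]
    rfl

theorem prodLu_inclY {k : ℕ} (u : Fin k → K) (μ : Marked K) :
    prodLu k u (inclY μ) = inclY (Polynomial.aeval (lam alpha bb) (shiftPoly u) μ) := by
  rw [prodLu, shiftPoly, ← foldr_Lu_inclY, List.map_ofFn]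
  rfl

theorem iterate_inclY {F : R → R} {G : Module.End K (Marked K)}
    (h : ∀ μ, F (inclY μ) = inclY (G μ)) (n : ℕ) (μ : Marked K) :
    F^[n] (inclY μ) = inclY ((G ^ n) μ) := by
  rw [Module.End.pow_apply]
  exact ((Function.Semiconj.iterate_right (fun μ => (h μ).symm) n) μ).symm

theorem iterate_inclP {F : R → R} {G : Module.End K (MvPolynomial ℕ K)}
    (h : ∀ f, F (inclP f) = inclP (G f)) (n : ℕ) (f : MvPolynomial ℕ K) :
    F^[n] (inclP f) = inclP ((G ^ n) f) := by
  rw [Module.End.pow_apply]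
  exact ((Function.Semiconj.iterate_right (fun μ => (h μ).symm) n) f).symm

theorem Y_zero_mul_inclP (f : MvPolynomial ℕ K) : Y 0 * inclP f = inclY (Polynomial.C f) := by
  simpa using (inclY_X_pow_mul_C 0 f).symm

theorem A_inclP (j : ℕ) (f : MvPolynomial ℕ K) :
    A j (inclP f) = inclP (compress alpha (shift * lam alpha bb ^ j) f) := by
  rw [A, Y_zero_mul_inclP, iterate_inclY LamY_inclY, Yplus_inclY, ThetaY_inclY, ← map_smul]
  rfl

theorem B_inclP {k : ℕ} (u : Fin k → K) (j : ℕ) (f : MvPolynomial ℕ K) :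
    B k u (j + 1) (inclP f) = inclP (opB alpha bb (shiftPoly u) j f) := by
  set W : Module.End K (Marked K) :=
    shift * Polynomial.aeval (lam alpha bb) (shiftPoly u) with hWdef
  have hW (μ : Marked K) : Wop k u (inclY μ) = inclY (W μ) := by
    rw [Wop, prodLu_inclY, Yplus_inclY, hWdef, Module.End.mul_apply, shift_apply]
  rw [B, Y_zero_mul_inclP, iterate_inclY hW, ThetaY_inclY, Nat.add_sub_cancel, ← map_smul,
    mul_smul, opB, ← hWdef, LinearMap.smul_apply, compress_apply]
  rfl

theorem Omega_inclP {k : ℕ} (u : Fin k → K) (f : MvPolynomial ℕ K) :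
    Omega k u (inclP f) = inclP (opOmega alpha bb (shiftPoly u) f) := by
  rw [Omega, Y_zero_mul_inclP, LamY_inclY, prodLu_inclY, Yplus_inclY, ThetaY_inclY, ← map_smul,
    opOmega, mul_comm Polynomial.X (shiftPoly u), map_mul (Polynomial.aeval _), Polynomial.aeval_X,
    compress_apply]
  rfl

theorem alpha_ne_zero : alpha ≠ 0 := by
  have h : alpha = algebraMap (Polynomial ℚ) K (1 + Polynomial.X) := by
    rw [map_add, map_one, RatFunc.algebraMap_X]
    rfl
  rw [h]
  refine RatFunc.algebraMap_ne_zero fun h => ?_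
  simpa using congrArg (Polynomial.coeff · 0) h

theorem inclP_adSeq {F G : R → R} {D T : Module.End K (MvPolynomial ℕ K)}
    (hF : ∀ f, F (inclP f) = inclP (D f)) (hG : ∀ f, G (inclP f) = inclP (T f)) (j : ℕ)
    (f : MvPolynomial ℕ K) :
    inclP (LaxRing.adSeq D T j f) = ∑ i ∈ Finset.range (j + 1),
      ((-1 : K) ^ (j - i) * (j.choose i : K)) • F^[i] (G (F^[j - i] (inclP f))) := by
  rw [LaxRing.adSeq_eq_sum, LinearMap.sum_apply, map_sum]
  refine Finset.sum_congr rfl fun i _ => ?_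
  rw [iterate_inclP hF, hG, iterate_inclP hF, ← map_smul, LinearMap.smul_apply,
    ← Int.cast_smul_eq_zsmul K]
  push_cast
  rfl

theorem exists_inclP_eq {f : R} (hf : f ∈ Psub) : ∃ g, inclP g = f :=
  exists_rename_eq_of_vars_subset_range f Var.p p_injective (mem_supported.1 hf)

end LaxOperators

/-- **Lax equations in solved form** (Proposition 4.7 of Chapuy–Dołęga): for every `j ≥ 0`
and `f ∈ 𝒫`,
`A_{j+1} f = Σ_{i=0}^{j} (−1)^{j−i}·C(j,i)·D_α^i(A₁(D_α^{j−i} f))` and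
`B^{(k)}_{j+1} f = Σ_{i=0}^{j} (−1)^{j−i}·C(j,i)·(Ω_Y^{(k)})^i(B^{(k)}₁((Ω_Y^{(k)})^{j−i} f))`.
(Here `A j` denotes the operator `A_{j+1}` of the paper, so `A 0 = A₁`.) -/
theorem lax_equations_solved_form (k : ℕ) (hk : 1 ≤ k) (u : Fin k → K) :
    ∀ j : ℕ, ∀ f ∈ Psub,
      (A j f = ∑ i ∈ Finset.range (j + 1),
        ((-1 : K) ^ (j - i) * (j.choose i : K)) • Dalpha^[i] (A 0 (Dalpha^[j - i] f))) ∧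
      (B k u (j + 1) f = ∑ i ∈ Finset.range (j + 1),
        ((-1 : K) ^ (j - i) * (j.choose i : K)) •
          (Omega k u)^[i] (B k u 1 ((Omega k u)^[j - i] f))) := by
  intro j f hf
  obtain ⟨g, rfl⟩ := LaxOperators.exists_inclP_eq hf
  constructor
  · rw [LaxOperators.A_inclP, LaxModel.compress_shift_lam_pow]
    refine LaxOperators.inclP_adSeq LaxOperators.Dalpha_inclP (fun f => ?_) j g
    rw [LaxOperators.A_inclP, pow_zero, mul_one]
  · rw [LaxOperators.B_inclP, LaxModel.opB_eq_adSeq _ _ LaxOperators.alpha_ne_zero]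
    exact LaxOperators.inclP_adSeq (LaxOperators.Omega_inclP u) (LaxOperators.B_inclP u 0) j g
end
end
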